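/- arXiv:1710.05079 — 6 statements merged into one kernel-verified Lean document; each statement's English description precedes it below -/
import Mathlib

section
/- The set of trees T on ℕ × ℕ such that the set [T] of infinite branches of T (a closed subset of ℕ^ℕ × ℕ^ℕ) contains the graph of a Borel function ℕ^ℕ → ℕ^ℕ is Σ¹₂-complete. -/
open MeasureTheory Set

/-- The Baire space `ℕ^ℕ`. -/
abbrev NN : Type := ℕ → ℕ

/-- Subsets of `(List ℕ × List ℕ)`, i.e. candidate trees on `ℕ × ℕ`, represented by their
characteristic functions. -/
abbrev TreeRep : Type := (List ℕ × List ℕ) → Bool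

/-- `T` is a tree on `ℕ × ℕ`: a set of pairs of finite sequences of equal length closed
under taking initial segments. -/
def IsTreeOn (T : TreeRep) : Prop :=
  ∀ p : List ℕ × List ℕ, T p = true →
    p.1.length = p.2.length ∧ ∀ n : ℕ, T (p.1.take n, p.2.take n) = true

/-- The standard Borel space of trees on `ℕ × ℕ`. -/
abbrev Trees : Type := {T : TreeRep // IsTreeOn T}

/-- `[T]`, the set of infinite branches of `T`, a (closed) subset of `ℕ^ℕ × ℕ^ℕ`. -/
def branches (T : TreeRep) : Set (NN × NN) :=
  {xy | ∀ n : ℕ, T ((List.range n).map xy.1, (List.range n).map xy.2) = true}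

/-- Analytic subsets of a standard Borel (here: arbitrary measurable) space:
empty or the range of a Borel map from `ℕ^ℕ`. -/
def MAnalytic {Z : Type} [MeasurableSpace Z] (S : Set Z) : Prop :=
  S = ∅ ∨ ∃ g : NN → Z, Measurable g ∧ S = Set.range g

/-- `Σ¹₂` subsets of a standard Borel space: projections of coanalytic subsets of
`Z × ℕ^ℕ`. -/
def MSigma12 {Z : Type} [MeasurableSpace Z] (A : Set Z) : Prop :=
  ∃ C : Set (Z × NN), MAnalytic Cᶜ ∧ A = Prod.fst '' C

/-- Coanalytic (`Π¹₁`) subsets of a topological space. -/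
def IsCoanalytic {X : Type} [TopologicalSpace X] (S : Set X) : Prop := AnalyticSet Sᶜ

/-- `Σ¹₂` subsets of a topological space: projections of coanalytic subsets of
`X × ℕ^ℕ`. -/
def IsSigma12 {X : Type} [TopologicalSpace X] (A : Set X) : Prop :=
  ∃ C : Set (X × NN), IsCoanalytic C ∧ A = Prod.fst '' C

/-- `A` is `Σ¹₂`-hard: every `Σ¹₂` subset of a Polish space Borel-reduces to `A`. -/
def Sigma12Hard {X : Type} [MeasurableSpace X] (A : Set X) : Prop :=
  ∀ (Z : Type) [TopologicalSpace Z] [PolishSpace Z] [MeasurableSpace Z] [BorelSpace Z],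
    ∀ A' : Set Z, IsSigma12 A' → ∃ f : Z → X, Measurable f ∧ ∀ z, z ∈ A' ↔ f z ∈ A

namespace BorelUniformization

open Filter Topology

/-! ### Initial segments and closed sets -/

/-- The initial segment of `x` of length `n`, listed with the latest entry first. -/
def revPrefix (x : NN) : ℕ → List ℕ
  | 0 => []
  | n + 1 => x n :: revPrefix x n

lemma length_revPrefix (x : NN) (n : ℕ) : (revPrefix x n).length = n := by
  induction n with
  | zero => rfl
  | succ n ih => simp [revPrefix, ih]

lemma revPrefix_eq_iff {x y : NN} {n : ℕ} :
    revPrefix x n = revPrefix y n ↔ ∀ k < n, x k = y k := by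
  induction n with
  | zero => simp [revPrefix]
  | succ n ih =>
    simp only [revPrefix, List.cons.injEq, ih]
    refine ⟨fun h k hk => ?_, fun h => ⟨h n (by omega), fun k hk => h k (by omega)⟩⟩
    rcases Nat.lt_succ_iff_lt_or_eq.1 hk with hk | rfl
    exacts [h.2 k hk, h.1]

lemma map_range_eq_iff {x y : NN} {n : ℕ} :
    (List.range n).map x = (List.range n).map y ↔ ∀ k < n, x k = y k := by
  simp [List.map_inj_left]

lemma revPrefix_map (g : ℕ → ℕ) (x : NN) (n : ℕ) :
    (revPrefix x n).map g = revPrefix (g ∘ x) n := by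
  induction n with
  | zero => rfl
  | succ n ih => simp [revPrefix, ih]

lemma tendsto_of_forall_agree {q : ℕ → NN} {x : NN} (h : ∀ n, ∀ k < n, q n k = x k) :
    Tendsto q atTop (𝓝 x) :=
  tendsto_pi_nhds.2 fun k => tendsto_const_nhds.congr' <|
    (eventually_gt_atTop k).mono fun n hn => (h n k hn).symm

lemma mem_of_forall_agree₂ {F : Set (NN × NN)} (hF : IsClosed F) {x y : NN}
    (h : ∀ n, ∃ x' y', (x', y') ∈ F ∧ (∀ k < n, x' k = x k) ∧ ∀ k < n, y' k = y k) :
    (x, y) ∈ F := by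
  choose a b hF' ha hb using h
  exact hF.mem_of_tendsto
    ((tendsto_of_forall_agree ha).prodMk_nhds (tendsto_of_forall_agree hb)) (.of_forall hF')

lemma mem_of_forall_agree₃ {F : Set (NN × NN × NN)} (hF : IsClosed F) {x y z : NN}
    (h : ∀ n, ∃ x' y' z', (x', y', z') ∈ F ∧ (∀ k < n, x' k = x k) ∧ (∀ k < n, y' k = y k) ∧
      ∀ k < n, z' k = z k) :
    (x, y, z) ∈ F := by
  choose a b c hF' ha hb hc using h
  exact hF.mem_of_tendsto ((tendsto_of_forall_agree ha).prodMk_nhds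
    ((tendsto_of_forall_agree hb).prodMk_nhds (tendsto_of_forall_agree hc))) (.of_forall hF')

lemma eventually_apply_eq (x : NN) (k : ℕ) : ∀ᶠ y in 𝓝 x, y k = x k :=
  (continuous_apply k).continuousAt.eventually (eventually_of_mem
    (isOpen_discrete {x k} |>.mem_nhds rfl) fun _ h => h)

lemma isLocallyConstant_revPrefix (n : ℕ) : IsLocallyConstant fun x : NN => revPrefix x n := by
  refine (IsLocallyConstant.iff_eventually_eq _).2 fun x => ?_
  simp only [revPrefix_eq_iff]
  exact (Set.finite_lt_nat n).eventually_all.2 fun k _ => eventually_apply_eq x k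

lemma isLocallyConstant_map_range (n : ℕ) :
    IsLocallyConstant fun x : NN => (List.range n).map x := by
  refine (IsLocallyConstant.iff_eventually_eq _).2 fun x => ?_
  simp only [map_range_eq_iff]
  exact (Set.finite_lt_nat n).eventually_all.2 fun k _ => eventually_apply_eq x k

/-- An analytic set is the projection of a closed set. -/
lemma exists_isClosed_of_analyticSet {X : Type} [TopologicalSpace X] [T2Space X] {E : Set X}
    (hE : AnalyticSet E) : ∃ F : Set (X × NN), IsClosed F ∧ ∀ a, a ∈ E ↔ ∃ w, (a, w) ∈ F := by
  rw [AnalyticSet] at hE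
  rcases hE with rfl | ⟨h, hc, rfl⟩
  · exact ⟨∅, isClosed_empty, by simp⟩
  · exact ⟨{p | h p.2 = p.1}, isClosed_eq (hc.comp continuous_snd) continuous_fst, by simp⟩

lemma measurableSet_fiber {X Y : Type} [MeasurableSpace X] [MeasurableSpace Y]
    [MeasurableSingletonClass Y] {f : X → Y} (hf : Measurable f) (a : Y) :
    MeasurableSet {x | f x = a} := hf (measurableSet_singleton a)

lemma measurable_sInf_setOf {X : Type} [MeasurableSpace X] {P : X → ℕ → Prop}
    (hP : ∀ n, MeasurableSet {x | P x n}) : Measurable fun x => sInf {n | P x n} := by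
  refine measurable_of_Iio fun n => ?_
  have : (fun x => sInf {m | P x m}) ⁻¹' Iio n =
      (⋃ m : Fin n, {x | P x m}) ∪ ((⋂ m, {x | P x m}ᶜ) ∩ {_x | 0 < n}) := by
    ext x
    simp only [mem_preimage, mem_Iio, mem_union, mem_iUnion, mem_ofPred_eq, mem_inter_iff,
      mem_iInter, mem_compl_iff]
    rcases Set.eq_empty_or_nonempty {m | P x m} with he | hne
    · have h : ∀ m, ¬ P x m := fun m hm => Set.eq_empty_iff_forall_notMem.1 he m hm
      simp [h]
    · constructor
      · exact fun h => .inl ⟨⟨_, h⟩, Nat.sInf_mem hne⟩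
      · rintro (⟨m, hm⟩ | ⟨h, -⟩)
        · exact (Nat.sInf_le (s := {m | P x m}) hm).trans_lt m.2
        · exact (h _ hne.some_mem).elim
  rw [this]
  exact (MeasurableSet.iUnion fun m : Fin n => hP m).union
    ((MeasurableSet.iInter fun m => (hP m).compl).inter (MeasurableSet.const _))

/-! ### Comparing trees by a game -/

/-- The player building a branch of `B`, who is at `v`, can answer every move of the player
building a branch of `A`, who is at `u`, so as not to leave `B` first. -/
inductive Dominates (A B : Set (List ℕ)) : List ℕ → List ℕ → Prop
  | intro {u v : List ℕ} (f : ℕ → ℕ) (hf : ∀ m, m :: u ∈ A → f m :: v ∈ B)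
      (h : ∀ m, m :: u ∈ A → Dominates A B (m :: u) (f m :: v)) : Dominates A B u v

lemma dominates_iff {A B : Set (List ℕ)} {u v : List ℕ} :
    Dominates A B u v ↔ ∀ m, m :: u ∈ A → ∃ n, n :: v ∈ B ∧ Dominates A B (m :: u) (n :: v) := by
  constructor
  · rintro ⟨f, hf, h⟩ m hm
    exact ⟨f m, hf m hm, h m hm⟩
  · intro h
    have h' : ∀ m, ∃ n, m :: u ∈ A → n :: v ∈ B ∧ Dominates A B (m :: u) (n :: v) := fun m => by
      by_cases hm : m :: u ∈ A
      · obtain ⟨n, hn⟩ := h m hm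
        exact ⟨n, fun _ => hn⟩
      · exact ⟨0, fun hm' => (hm hm').elim⟩
    choose f hf using h'
    exact .intro f (fun m hm => (hf m hm).1) fun m hm => (hf m hm).2

/-- `u'` is a one-step extension of `u` lying in `W`. -/
def StepIn (W : Set (List ℕ)) (u' u : List ℕ) : Prop := u' ∈ W ∧ ∃ m, u' = m :: u

lemma dominates_total {A B : Set (List ℕ)} (hA : WellFounded (StepIn A)) (u v : List ℕ) :
    Dominates A B u v ∨ Dominates B A v u := by
  induction u using hA.induction generalizing v with
  | _ u ih =>
    by_contra! h
    rw [dominates_iff, dominates_iff] at h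
    obtain ⟨h₁, h₂⟩ := h
    push Not at h₁
    obtain ⟨m, hm, h₁⟩ := h₁
    exact h₂ fun n hn => ⟨m, hm, (ih _ ⟨hm, m, rfl⟩ (n :: v)).resolve_left (h₁ n hn)⟩

lemma measurableSet_dominates {X : Type} [MeasurableSpace X] {A B : X → Set (List ℕ)}
    {W : Set (List ℕ)} (hW : WellFounded (StepIn W)) (hAW : ∀ x, A x ⊆ W)
    (hA : ∀ u, MeasurableSet {x | u ∈ A x}) (hB : ∀ u, MeasurableSet {x | u ∈ B x})
    (u v : List ℕ) : MeasurableSet {x | Dominates (A x) (B x) u v} := by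
  induction u using hW.induction generalizing v with
  | _ u ih =>
    have : {x | Dominates (A x) (B x) u v} = ⋂ m, {x | m :: u ∈ A x}ᶜ ∪
        ⋃ n, {x | n :: v ∈ B x} ∩ {x | Dominates (A x) (B x) (m :: u) (n :: v)} := by
      ext x
      rw [mem_ofPred_eq, dominates_iff]
      simp [imp_iff_not_or]
    rw [this]
    refine MeasurableSet.iInter fun m => ?_
    by_cases hm : m :: u ∈ W
    · exact (hA _).compl.union (.iUnion fun n => (hB _).inter (ih _ ⟨hm, m, rfl⟩ _))
    · convert MeasurableSet.univ
      exact eq_univ_of_forall fun x => .inl fun h => hm (hAW x h)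

/-- A tree without infinite branches is well-founded. -/
lemma wellFounded_stepIn {W : Set (List ℕ)} (htail : ∀ m u, m :: u ∈ W → u ∈ W)
    (hbranch : ∀ w : NN, ∃ n, revPrefix w n ∉ W) : WellFounded (StepIn W) := by
  have hnil : Acc (StepIn W) [] := by
    by_contra h
    have step : ∀ u, ∃ m, ¬ Acc (StepIn W) u → m :: u ∈ W ∧ ¬ Acc (StepIn W) (m :: u) := fun u => by
      by_cases hu : Acc (StepIn W) u
      · exact ⟨0, fun h => (h hu).elim⟩
      · by_contra! hc
        refine hu ⟨_, ?_⟩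
        rintro _ ⟨hm, m, rfl⟩
        by_contra hacc
        exact hacc ((hc m).2 hm)
    choose g hg using step
    let l : ℕ → List ℕ := fun n => Nat.rec [] (fun _ u => g u :: u) n
    have hl : ∀ n, revPrefix (fun n => g (l n)) n = l n := fun n => by
      induction n with
      | zero => rfl
      | succ n ih => simp only [revPrefix, ih]; rfl
    have hacc : ∀ n, ¬ Acc (StepIn W) (l n) := fun n => by
      induction n with
      | zero => exact h
      | succ n ih => exact (hg _ ih).2
    obtain ⟨n, hn⟩ := hbranch fun n => g (l n)
    refine hn ?_
    have hsucc := (hg _ (hacc n)).1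
    rw [hl]
    exact htail _ _ hsucc
  refine ⟨fun u => ?_⟩
  by_cases hu : u ∈ W
  · induction u with
    | nil => exact hnil
    | cons m u ih => exact (ih (htail _ _ hu)).inv ⟨hu, m, rfl⟩
  · refine ⟨_, ?_⟩
    rintro _ ⟨hm, m, rfl⟩
    exact (hu (htail _ _ hm)).elim

/-- The strategy witnessing `Dominates A B [] []` that always plays the least good move. -/
noncomputable def strategy (A B : Set (List ℕ)) : List ℕ → List ℕ
  | [] => []
  | m :: u => sInf {n | n :: strategy A B u ∈ B ∧ Dominates A B (m :: u) (n :: strategy A B u)} ::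
      strategy A B u

lemma strategy_mem {A B : Set (List ℕ)} (htail : ∀ m u, m :: u ∈ A → u ∈ A)
    (hnil : [] ∈ A → [] ∈ B) (h : Dominates A B [] []) {u : List ℕ} (hu : u ∈ A) :
    strategy A B u ∈ B ∧ Dominates A B u (strategy A B u) := by
  induction u with
  | nil => exact ⟨hnil hu, h⟩
  | cons m u ih => exact Nat.sInf_mem (dominates_iff.1 (ih (htail _ _ hu)).2 m hu)

lemma measurableSet_strategy_eq {X : Type} [MeasurableSpace X] {A B : X → Set (List ℕ)}
    (hB : ∀ u, MeasurableSet {x | u ∈ B x})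
    (hAB : ∀ u v, MeasurableSet {x | Dominates (A x) (B x) u v}) (u v : List ℕ) :
    MeasurableSet {x | strategy (A x) (B x) u = v} := by
  induction u generalizing v with
  | nil => simp [strategy]
  | cons m u ih =>
    cases v with
    | nil => simp [strategy]
    | cons n v =>
      have : {x | strategy (A x) (B x) (m :: u) = n :: v} =
          {x | strategy (A x) (B x) u = v} ∩
            {x | sInf {n | n :: v ∈ B x ∧ Dominates (A x) (B x) (m :: u) (n :: v)} = n} := by
        ext x
        simp only [strategy, List.cons.injEq, mem_ofPred_eq, mem_inter_iff]
        constructor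
        · rintro ⟨h₁, rfl⟩
          exact ⟨rfl, h₁⟩
        · rintro ⟨rfl, h₁⟩
          exact ⟨h₁, rfl⟩
      rw [this]
      exact (ih v).inter (measurable_sInf_setOf (fun n => (hB _).inter (hAB _ _))
        (measurableSet_singleton n))

lemma measurable_headI_strategy {X : Type} [MeasurableSpace X] {A B : X → Set (List ℕ)}
    (hB : ∀ u, MeasurableSet {x | u ∈ B x})
    (hAB : ∀ u v, MeasurableSet {x | Dominates (A x) (B x) u v}) (u : List ℕ) :
    Measurable fun x => (strategy (A x) (B x) u).headI := by
  refine measurable_to_countable' fun n => ?_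
  have : (fun x => (strategy (A x) (B x) u).headI) ⁻¹' {n} =
      ⋃ v : {v : List ℕ // v.headI = n}, {x | strategy (A x) (B x) u = v} := by
    ext x
    simp
  rw [this]
  exact .iUnion fun v => measurableSet_strategy_eq hB hAB u v

/-! ### The trees of the reduction -/

open Encodable Denumerable

/-- Two trees coded by `x`. Every pair of closed subsets of `NN × NN` has, by
`exists_forall_branch_iff`, a code `x` for which the branches of these trees are the sections of the
closed sets at `x` itself. -/
def diagTree (i : Bool) (x : NN) : Set (List ℕ) :=
  {p | ∀ q, q <:+ p → q ≠ [] → x (encode (i, revPrefix x q.length, q)) = 1}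

lemma diagTree_tail {i : Bool} {x : NN} {m : ℕ} {p : List ℕ} (h : m :: p ∈ diagTree i x) :
    p ∈ diagTree i x := fun q hq => h q (hq.trans (List.suffix_cons m p))

lemma isLocallyConstant_mem_diagTree (i : Bool) (p : List ℕ) :
    IsLocallyConstant fun x => p ∈ diagTree i x := by
  refine (IsLocallyConstant.iff_eventually_eq _).2 fun x => ?_
  have key : ∀ᶠ y in 𝓝 x, ∀ q ∈ {q : List ℕ | q <:+ p},
      y (encode (i, revPrefix y q.length, q)) = x (encode (i, revPrefix x q.length, q)) := by
    refine (Set.Finite.eventually_all ?_).2 fun q _ => ?_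
    · refine p.tails.toFinset.finite_toSet.subset fun q hq => ?_
      simpa using hq
    · filter_upwards [(isLocallyConstant_revPrefix q.length).eventually_eq x,
        eventually_apply_eq x (encode (i, revPrefix x q.length, q))] with y h₁ h₂
      rw [h₁, h₂]
  filter_upwards [key] with y hy
  refine propext (forall₂_congr fun q hq => ?_)
  rw [hy q hq]

lemma suffix_revPrefix {w : NN} {n : ℕ} {q : List ℕ} (h : q <:+ revPrefix w n) :
    ∃ k ≤ n, q = revPrefix w k := by
  induction n with
  | zero => exact ⟨0, le_rfl, List.suffix_nil.1 h⟩
  | succ n ih =>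
    rcases List.suffix_cons_iff.1 h with h | h
    · exact ⟨n + 1, le_rfl, h⟩
    · obtain ⟨k, hk, rfl⟩ := ih h
      exact ⟨k, hk.trans n.le_succ, rfl⟩

lemma exists_forall_branch_iff {F : Bool → Set (NN × NN)} (hF : ∀ i, IsClosed (F i)) :
    ∃ x : NN, ∀ i w, (∀ n, revPrefix w n ∈ diagTree i x) ↔ (x, w) ∈ F i := by
  classical
  let good : Bool × List ℕ × List ℕ → Prop := fun p => ∃ a b, (a, b) ∈ F p.1 ∧
    revPrefix a p.2.1.length = p.2.1 ∧ revPrefix b p.2.2.length = p.2.2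
  let x : NN := fun k => if ∃ p, encode p = k ∧ good p then 1 else 0
  have hx : ∀ p, x (encode p) = 1 ↔ good p := fun p => by
    simp only [x, ite_eq_left_iff, zero_ne_one, imp_false, not_not]
    refine ⟨fun ⟨q, hq, hg⟩ => encode_injective hq ▸ hg, fun h => ⟨p, rfl, h⟩⟩
  refine ⟨x, fun i w => ⟨fun h => mem_of_forall_agree₂ (hF i) fun n => ?_, fun h n q hq _ => ?_⟩⟩
  · obtain ⟨a, b, hab, ha, hb⟩ := (hx _).1 (h (n + 1) _ List.suffix_rfl (List.cons_ne_nil _ _))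
    simp only [length_revPrefix, revPrefix_eq_iff] at ha hb
    exact ⟨a, b, hab, fun k hk => ha k (by omega), fun k hk => hb k (by omega)⟩
  · obtain ⟨k, -, rfl⟩ := suffix_revPrefix hq
    refine (hx _).2 ⟨x, w, h, ?_, ?_⟩ <;> simp [length_revPrefix]

/-- The tree of the section of `F` at `(z, y)`. -/
def sectionTree (F : Set (NN × NN × NN)) (z y : NN) : Set (List ℕ) :=
  {p | ∃ z' y' w', (z', y', w') ∈ F ∧ revPrefix z' p.length = revPrefix z p.length ∧
    revPrefix y' p.length = revPrefix y p.length ∧ revPrefix w' p.length = p}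

lemma sectionTree_tail {F : Set (NN × NN × NN)} {z y : NN} {m : ℕ} {p : List ℕ}
    (h : m :: p ∈ sectionTree F z y) : p ∈ sectionTree F z y := by
  obtain ⟨z', y', w', hF, hz, hy, hw⟩ := h
  simp only [List.length_cons, revPrefix, List.cons.injEq] at hz hy hw
  exact ⟨z', y', w', hF, hz.2, hy.2, hw.2⟩

lemma isLocallyConstant_mem_sectionTree (F : Set (NN × NN × NN)) (p : List ℕ) :
    IsLocallyConstant fun q : NN × NN => p ∈ sectionTree F q.1 q.2 :=
  ((isLocallyConstant_revPrefix p.length).comp_continuous continuous_fst).comp₂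
    ((isLocallyConstant_revPrefix p.length).comp_continuous continuous_snd)
    fun a b => ∃ z' y' w', (z', y', w') ∈ F ∧ revPrefix z' p.length = a ∧
      revPrefix y' p.length = b ∧ revPrefix w' p.length = p

lemma forall_mem_sectionTree_iff {F : Set (NN × NN × NN)} (hF : IsClosed F) {z y w : NN} :
    (∀ n, revPrefix w n ∈ sectionTree F z y) ↔ (z, y, w) ∈ F := by
  refine ⟨fun h => mem_of_forall_agree₃ hF fun n => ?_, fun h n => ⟨z, y, w, h, rfl, rfl, ?_⟩⟩
  · obtain ⟨z', y', w', hm, hz, hy, hw⟩ := h n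
    rw [length_revPrefix] at hz hy hw
    exact ⟨z', y', w', hm, revPrefix_eq_iff.1 hz, revPrefix_eq_iff.1 hy, revPrefix_eq_iff.1 hw⟩
  · rw [length_revPrefix]

/-- The tree whose branches are the pairs of a branch of `diagTree i x` and a branch of
`sectionTree F z y`. -/
def gameTree (F : Set (NN × NN × NN)) (i : Bool) (z x y : NN) : Set (List ℕ) :=
  {u | u.map (fun m => m.unpair.1) ∈ diagTree i x ∧
    u.map (fun m => m.unpair.2) ∈ sectionTree F z y}

lemma gameTree_tail (F : Set (NN × NN × NN)) (i : Bool) (z x y : NN) (m : ℕ) (u : List ℕ)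
    (h : m :: u ∈ gameTree F i z x y) : u ∈ gameTree F i z x y :=
  ⟨diagTree_tail h.1, sectionTree_tail h.2⟩

lemma isLocallyConstant_mem_gameTree (F : Set (NN × NN × NN)) (i : Bool) (u : List ℕ) :
    IsLocallyConstant fun q : NN × NN × NN => u ∈ gameTree F i q.1 q.2.1 q.2.2 :=
  ((isLocallyConstant_mem_diagTree i _).comp_continuous
    (continuous_fst.comp continuous_snd)).comp₂
    ((isLocallyConstant_mem_sectionTree F _).comp_continuous
      (continuous_fst.prodMk (continuous_snd.comp continuous_snd))) fun a b => a ∧ b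

lemma exists_branch_gameTree_iff {F : Set (NN × NN × NN)} {i : Bool} {z x y : NN} :
    (∃ w : NN, ∀ n, revPrefix w n ∈ gameTree F i z x y) ↔
      (∃ w : NN, ∀ n, revPrefix w n ∈ diagTree i x) ∧
        ∃ w : NN, ∀ n, revPrefix w n ∈ sectionTree F z y := by
  constructor
  · rintro ⟨w, hw⟩
    refine ⟨⟨fun n => (w n).unpair.1, fun n => ?_⟩, ⟨fun n => (w n).unpair.2, fun n => ?_⟩⟩
    · have := (hw n).1
      rwa [revPrefix_map] at this
    · have := (hw n).2
      rwa [revPrefix_map] at this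
  · rintro ⟨⟨a, ha⟩, ⟨b, hb⟩⟩
    refine ⟨fun n => Nat.pair (a n) (b n), fun n => ⟨?_, ?_⟩⟩
    · rw [revPrefix_map]
      convert ha n
      simp [Function.comp_def]
    · rw [revPrefix_map]
      convert hb n
      simp [Function.comp_def]

/-! ### The closed relation -/

/-- The run of the player following the strategy coded by `s`. -/
def response (s : NN) : List ℕ → List ℕ
  | [] => []
  | m :: u => s (encode (m :: u)) :: response s u

lemma isLocallyConstant_response (u : List ℕ) : IsLocallyConstant fun s => response s u := by
  induction u with
  | nil => exact IsLocallyConstant.const _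
  | cons m u ih =>
    refine (IsLocallyConstant.iff_eventually_eq _).2 fun s => ?_
    filter_upwards [ih.eventually_eq s, eventually_apply_eq s (encode (m :: u))] with t h₁ h₂
    simp only [response, h₁, h₂]

lemma response_revPrefix (s v : NN) (n : ℕ) :
    response s (revPrefix v n) = revPrefix (fun k => s (encode (revPrefix v (k + 1)))) n := by
  induction n with
  | zero => rfl
  | succ n ih =>
    change _ :: _ = _ :: _
    rw [ih]
    rfl

/-- The side chosen by `v`. -/
def side (v : NN) : Bool := v 0 == 0

/-- The parameter chosen by `v`. -/
def param (v : NN) : NN := fun n => v (2 * n + 1)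

/-- The strategy chosen by `v`. -/
def strat (v : NN) : NN := fun n => v (2 * n + 2)

/-- The point with given side, parameter and strategy. -/
def assemble (i : Bool) (y s : NN) : NN
  | 0 => if i then 0 else 1
  | n + 1 => if n % 2 = 0 then y (n / 2) else s (n / 2)

lemma side_assemble (i : Bool) (y s : NN) : side (assemble i y s) = i := by
  cases i <;> rfl

lemma param_assemble (i : Bool) (y s : NN) : param (assemble i y s) = y := by
  funext n
  simp [param, assemble]

lemma strat_assemble (i : Bool) (y s : NN) : strat (assemble i y s) = s := by
  funext n
  have h₁ : (2 * n + 1) % 2 = 1 := by omega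
  have h₂ : (2 * n + 1) / 2 = n := by omega
  simp [strat, assemble, h₁, h₂]

/-- The points `(z, x, v)` such that the strategy chosen by `v` lets its player stay in the game tree
as long as the opponent does. -/
def goodStrategies (F : Set (NN × NN × NN)) : Set (NN × NN × NN) :=
  {q | ∀ u, u ∈ gameTree F (!side q.2.2) q.1 q.2.1 (param q.2.2) →
    response (strat q.2.2) u ∈ gameTree F (side q.2.2) q.1 q.2.1 (param q.2.2)}

lemma isClosed_goodStrategies (F : Set (NN × NN × NN)) : IsClosed (goodStrategies F) := by
  have hparam : Continuous param := continuous_pi fun n => continuous_apply _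
  have hstrat : Continuous strat := continuous_pi fun n => continuous_apply _
  have hmap : Continuous fun q : NN × NN × NN => (q.1, q.2.1, param q.2.2) := by fun_prop
  have hv : Continuous fun q : NN × NN × NN => q.2.2 := by fun_prop
  have key : ∀ u, IsLocallyConstant fun q : NN × NN × NN =>
      u ∈ gameTree F (!side q.2.2) q.1 q.2.1 (param q.2.2) →
        response (strat q.2.2) u ∈ gameTree F (side q.2.2) q.1 q.2.1 (param q.2.2) := fun u => by
    refine (IsLocallyConstant.iff_eventually_eq _).2 fun q => ?_
    have h₁ : ∀ᶠ r : NN × NN × NN in 𝓝 q, r.2.2 0 = q.2.2 0 :=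
      hv.continuousAt.eventually (eventually_apply_eq q.2.2 0)
    filter_upwards [h₁,
      ((isLocallyConstant_response u).comp_continuous (hstrat.comp hv)).eventually_eq q,
      ((isLocallyConstant_mem_gameTree F (!side q.2.2) u).comp_continuous hmap).eventually_eq q,
      ((isLocallyConstant_mem_gameTree F (side q.2.2)
        (response (strat q.2.2) u)).comp_continuous hmap).eventually_eq q] with r h₁ h₂ h₃ h₄
    simp only [Function.comp_apply] at h₂ h₃ h₄
    have hside : side r.2.2 = side q.2.2 := by simp only [side, h₁]
    rw [hside, h₂, h₃, h₄]
  have : goodStrategies F = ⋂ u, {q | (u ∈ gameTree F (!side q.2.2) q.1 q.2.1 (param q.2.2) →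
      response (strat q.2.2) u ∈ gameTree F (side q.2.2) q.1 q.2.1 (param q.2.2)) = True} := by
    ext q
    simp [goodStrategies]
  rw [this]
  exact isClosed_iInter fun u => (key u).isClosed_fiber True

/-- A parameter for which the section of `F` is empty yields a Borel uniformization: the comparison
game is clopen, so it is determined in a Borel way. -/
lemma exists_uniformization {F : Set (NN × NN × NN)} (hF : IsClosed F) {z y : NN}
    (hy : ∀ w, (z, y, w) ∉ F) :
    ∃ f : NN → NN, Measurable f ∧ ∀ x, (z, x, f x) ∈ goodStrategies F := by
  let A : Bool → NN → Set (List ℕ) := fun i x => gameTree F i z x y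
  let W : Set (List ℕ) := {u | u.map (fun m => m.unpair.2) ∈ sectionTree F z y}
  have hW : WellFounded (StepIn W) := by
    refine wellFounded_stepIn (fun m u h => sectionTree_tail h) fun w => ?_
    by_contra! h
    refine hy (fun n => (w n).unpair.2) ((forall_mem_sectionTree_iff hF).1 fun n => ?_)
    have := h n
    simp only [W, mem_ofPred_eq, revPrefix_map] at this
    exact this
  have hAW : ∀ i x, A i x ⊆ W := fun i x u hu => hu.2
  have hA : ∀ i u, MeasurableSet {x | u ∈ A i x} := fun i u => by
    have : IsLocallyConstant fun x => u ∈ A i x :=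
      (isLocallyConstant_mem_gameTree F i u).comp_continuous (f := fun x => (z, x, y))
        (by fun_prop)
    simpa using (this.isOpen_fiber True).measurableSet
  have hdom : ∀ i u v, MeasurableSet {x | Dominates (A (!i) x) (A i x) u v} := fun i =>
    measurableSet_dominates hW (hAW _) (hA _) (hA _)
  have hnil : ∀ i j x, [] ∈ A i x → [] ∈ A j x := fun i j x h =>
    ⟨fun q hq hne => (hne (List.suffix_nil.1 hq)).elim, h.2⟩
  have htot : ∀ x, Dominates (A false x) (A true x) [] [] ∨ Dominates (A true x) (A false x) [] [] :=
    fun x => dominates_total (hW.mono fun u v h => ⟨hAW _ _ h.1, h.2⟩) _ _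
  let g : Bool → NN → NN := fun i x => assemble i y fun n =>
    (strategy (A (!i) x) (A i x) (ofNat (List ℕ) n)).headI
  have hg : ∀ i, Measurable (g i) := fun i => by
    refine measurable_pi_iff.2 fun n => ?_
    cases n with
    | zero => exact measurable_const
    | succ n =>
      simp only [g, assemble]
      split_ifs
      · exact measurable_const
      · exact measurable_headI_strategy (hA i) (hdom i) _
  have hgood : ∀ i x, Dominates (A (!i) x) (A i x) [] [] → (z, x, g i x) ∈ goodStrategies F := by
    intro i x h u
    have hresp : ∀ u, response (strat (g i x)) u = strategy (A (!i) x) (A i x) u := fun u => by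
      induction u with
      | nil => rfl
      | cons m u ih => 
        rw [response, ih, strategy]
        simp [g, strat_assemble, strategy]
    simp only [hresp]
    simp only [g, side_assemble, param_assemble]
    exact fun hu => (strategy_mem (gameTree_tail F _ z x y) (hnil _ _ x) h hu).1
  classical
  refine ⟨fun x => if Dominates (A false x) (A true x) [] [] then g true x else g false x,
    Measurable.ite (hdom true [] []) (hg true) (hg false), fun x => ?_⟩
  dsimp only
  split_ifs with h
  · exact hgood true x h
  · exact hgood false x ((htot x).resolve_left h)

/-- If all sections of `F` are nonempty, there is no Borel uniformization: it would decide a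
coded pair of complementary analytic sets, contrary to the choice of the code. -/
lemma not_exists_uniformization {F : Set (NN × NN × NN)} (hF : IsClosed F) {z : NN}
    (hz : ∀ y, ∃ w, (z, y, w) ∈ F) {f : NN → NN} (hf : Measurable f)
    (hfF : ∀ x, (z, x, f x) ∈ goodStrategies F) : False := by
  have hside : ∀ i, MeasurableSet {x | side (f x) = !i} := fun i => by
    have : Measurable fun x => side (f x) :=
      (measurable_of_countable fun n : ℕ => n == 0).comp ((measurable_pi_apply 0).comp hf)
    exact this (measurableSet_singleton _)
  choose G hG hGside using fun i => exists_isClosed_of_analyticSet (hside i).analyticSet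
  obtain ⟨x, hx⟩ := exists_forall_branch_iff hG
  have hbranch : ∀ i, (∃ w : NN, ∀ n, revPrefix w n ∈ diagTree i x) ↔ side (f x) = !i :=
    fun i => by
      simp only [hx]
      exact (hGside i x).symm
  obtain ⟨w, hw⟩ := hz (param (f x))
  obtain ⟨v, hv⟩ := exists_branch_gameTree_iff.2
    ⟨(hbranch (!side (f x))).2 (by simp), w, (forall_mem_sectionTree_iff hF).2 hw⟩
  have := (exists_branch_gameTree_iff.1 ⟨_, fun n => by
    have := hfF x _ (hv n)
    rwa [response_revPrefix] at this⟩).1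
  exact absurd ((hbranch _).1 this) (by simp)

/-! ### Hardness -/

open Classical in
/-- The tree of the section at `z` of a set `R` of triples. -/
noncomputable def treeAt (R : Set (NN × NN × NN)) (z : NN) : Trees :=
  ⟨fun p => decide (∃ q ∈ R, (List.range p.1.length).map q.1 = (List.range p.1.length).map z ∧
    (List.range p.1.length).map q.2.1 = p.1 ∧ (List.range p.1.length).map q.2.2 = p.2), by
    intro p hp
    simp only [decide_eq_true_eq] at hp ⊢
    obtain ⟨q, hq, hz, hx, hv⟩ := hp
    refine ⟨by rw [← hv]; simp, fun n => ⟨q, hq, ?_⟩⟩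
    rw [map_range_eq_iff] at hz
    rw [List.length_take]
    refine ⟨map_range_eq_iff.2 fun k hk => hz k (hk.trans_le (min_le_right _ _)), ?_, ?_⟩
    · rw [← hx, ← List.map_take, List.take_range]
      simp
    · rw [← hv, ← List.map_take, List.take_range]⟩

lemma mem_branches_treeAt {R : Set (NN × NN × NN)} (hR : IsClosed R) {z x v : NN} :
    (x, v) ∈ branches (treeAt R z).1 ↔ (z, x, v) ∈ R := by
  simp only [branches, treeAt, mem_ofPred_eq, decide_eq_true_eq, List.length_map,
    List.length_range, map_range_eq_iff]
  refine ⟨fun h => mem_of_forall_agree₃ hR fun n => ?_, fun h n => ⟨_, h, by simp⟩⟩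
  obtain ⟨⟨z', x', v'⟩, h⟩ := h n
  exact ⟨z', x', v', h⟩

lemma measurable_treeAt (R : Set (NN × NN × NN)) : Measurable (treeAt R) := by
  refine Measurable.subtype_mk (measurable_pi_iff.2 fun p => Continuous.measurable ?_)
  classical
  refine IsLocallyConstant.continuous ((isLocallyConstant_map_range p.1.length).comp fun l => decide (∃ q ∈ R,
      (List.range p.1.length).map q.1 = l ∧ (List.range p.1.length).map q.2.1 = p.1 ∧
        (List.range p.1.length).map q.2.2 = p.2))

theorem sigma12Hard_uniformizable : Sigma12Hard
    {T : Trees | ∃ f : NN → NN, Measurable f ∧ ∀ x : NN, (x, f x) ∈ branches T.1} := by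
  rintro Z _ _ _ _ A' ⟨C, hC, rfl⟩
  obtain ⟨j₀, hj₀, hinj₀⟩ := MeasurableSpace.measurable_injection_nat_bool_of_countablySeparated Z
  let j : Z → NN := fun z n => (j₀ z n).toNat
  have hj : Measurable j := measurable_pi_iff.2 fun n =>
    (measurable_of_countable Bool.toNat).comp ((measurable_pi_apply n).comp hj₀)
  have hinj : Function.Injective j := fun z z' h => hinj₀ <| funext fun n =>
    (by decide : ∀ a b : Bool, a.toNat = b.toNat → a = b) _ _ (congrFun h n)
  let J : Z × NN → NN × NN := Prod.map j id
  have hJ : Measurable J := hj.prodMap measurable_id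
  have hJinj : Function.Injective J := hinj.prodMap Function.injective_id
  have hE : AnalyticSet (J '' Cᶜ) := by
    rw [IsCoanalytic, AnalyticSet] at hC
    rcases hC with hC | ⟨g, hg, hC⟩
    · rw [hC, image_empty]
      exact analyticSet_empty
    · rw [← hC, ← range_comp, ← image_univ]
      exact MeasurableSet.univ.analyticSet_image (hJ.comp hg.measurable)
  obtain ⟨F₀, hF₀, hEF⟩ := exists_isClosed_of_analyticSet hE
  let F : Set (NN × NN × NN) := {q | ((q.1, q.2.1), q.2.2) ∈ F₀}
  have hF : IsClosed F := hF₀.preimage (by fun_prop)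
  have hCF : ∀ z y, (z, y) ∈ C ↔ ∀ w, (j z, y, w) ∉ F := fun z y => by
    have : (j z, y) ∈ J '' Cᶜ ↔ (z, y) ∈ Cᶜ := hJinj.mem_set_image (a := (z, y))
    rw [← not_iff_not, ← mem_compl_iff, ← this, hEF]
    simp [F]
  refine ⟨fun z => treeAt (goodStrategies F) (j z), (measurable_treeAt _).comp hj, fun z => ?_⟩
  simp only [mem_ofPred_eq, mem_branches_treeAt (isClosed_goodStrategies F)]
  constructor
  · rintro ⟨⟨z, y⟩, hy, rfl⟩
    exact exists_uniformization hF ((hCF z y).1 hy)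
  · rintro ⟨f, hf, hfF⟩
    by_contra h
    refine not_exists_uniformization hF (fun y => ?_) hf hfF
    by_contra! hy
    exact h ⟨(z, y), (hCF z y).2 hy, rfl⟩

/-! ### Borel codes -/

/-- The set coded by a leaf with label `k + 1`. -/
def leafSet (k : ℕ) : Set NN := {x | x k.unpair.1 + 1 = k.unpair.2}

lemma measurableSet_leafSet (k : ℕ) : MeasurableSet (leafSet k) :=
  measurableSet_fiber ((measurable_pi_apply k.unpair.1).add_const 1) _

/-- The labelled tree `c`, with inner nodes labelled by `0`, has no infinite branch. -/
def IsCode (c : List ℕ → ℕ) : Prop :=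
  ∀ (u : List ℕ) (w : NN), ∃ n, c (u ++ (List.range n).map w) ≠ 0

/-- `e` evaluates the code `c` at `x`: an inner node is the union of the complements of its
children. -/
def Evaluates (c : List ℕ → ℕ) (x : NN) (e : List ℕ → Bool) : Prop :=
  ∀ u, (c u = 0 → (e u = true ↔ ∃ n, e (u ++ [n]) = false)) ∧
    ∀ k, c u = k + 1 → (e u = true ↔ x ∈ leafSet k)

/-- `B` has a Borel code. -/
def IsCoded (B : Set NN) : Prop :=
  ∃ c, IsCode c ∧ ∃ e : NN → List ℕ → Bool, (∀ x, Evaluates c x (e x)) ∧ ∀ x, x ∈ B ↔ e x [] = true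

/-- The code with an inner node at the root, above the codes `c n`. -/
def graft (c : ℕ → List ℕ → ℕ) : List ℕ → ℕ
  | [] => 0
  | n :: u => c n u

lemma isCode_graft {c : ℕ → List ℕ → ℕ} (hc : ∀ n, IsCode (c n)) : IsCode (graft c) := by
  intro u w
  cases u with
  | nil =>
    obtain ⟨n, hn⟩ := hc (w 0) [] fun k => w (k + 1)
    refine ⟨n + 1, ?_⟩
    simpa [List.range_succ_eq_map, graft, Function.comp_def] using hn
  | cons m u => exact hc m u w

open Classical in
/-- The evaluation of `graft c` from evaluations of the codes `c n`. -/
noncomputable def graftEval (e : ℕ → List ℕ → Bool) : List ℕ → Bool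
  | [] => decide (∃ n, e n [] = false)
  | n :: u => e n u

lemma evaluates_graftEval {c : ℕ → List ℕ → ℕ} {x : NN} {e : ℕ → List ℕ → Bool}
    (h : ∀ n, Evaluates (c n) x (e n)) : Evaluates (graft c) x (graftEval e) := by
  intro u
  cases u with
  | nil => exact ⟨fun _ => by simp [graftEval], fun k hk => by simp [graft] at hk⟩
  | cons m u => exact h m u

lemma isCoded_leafSet (k : ℕ) : IsCoded (leafSet k) := by
  classical
  refine ⟨fun _ => k + 1, fun _ _ => ⟨0, by simp⟩, fun x _ => decide (x ∈ leafSet k),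
    fun x u => ⟨by simp, ?_⟩, by simp⟩
  rintro l hl
  obtain rfl : k = l := Nat.succ_injective hl
  simp

lemma isCoded_iUnion_compl {B : ℕ → Set NN} (hB : ∀ n, IsCoded (B n)) :
    IsCoded (⋃ n, (B n)ᶜ) := by
  choose c hc e he hBe using hB
  refine ⟨graft c, isCode_graft hc, fun x => graftEval fun n => e n x,
    fun x => evaluates_graftEval fun n => he n x, fun x => ?_⟩
  simp [graftEval, hBe]

lemma IsCoded.compl {B : Set NN} (hB : IsCoded B) : IsCoded Bᶜ := by
  simpa [iUnion_const] using isCoded_iUnion_compl fun _ : ℕ => hB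

lemma IsCoded.iUnion {B : ℕ → Set NN} (hB : ∀ n, IsCoded (B n)) : IsCoded (⋃ n, B n) := by
  simpa using isCoded_iUnion_compl fun n => (hB n).compl

/-- Every Borel set has a Borel code. -/
lemma isCoded_of_measurableSet {B : Set NN} (hB : MeasurableSet B) : IsCoded B := by
  let M : MeasurableSpace NN :=
    { MeasurableSet' := IsCoded
      measurableSet_empty := by
        convert isCoded_leafSet (Nat.pair 0 0)
        ext x
        simp [leafSet]
      measurableSet_compl := fun _ h => h.compl
      measurableSet_iUnion := fun _ h => IsCoded.iUnion h }
  have hle : (MeasurableSpace.pi : MeasurableSpace NN) ≤ M := by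
    refine iSup_le fun n => Measurable.comap_le ?_
    refine @measurable_to_countable' _ _ _ _ M _ fun m => ?_
    change IsCoded _
    convert isCoded_leafSet (Nat.pair n (m + 1))
    ext x
    simp [leafSet]
  exact hle B hB

/-- The child relation below inner nodes of `c`. -/
def IsChild (c : List ℕ → ℕ) (u' u : List ℕ) : Prop := c u = 0 ∧ ∃ n, u' = u ++ [n]

lemma IsCode.wellFounded {c : List ℕ → ℕ} (hc : IsCode c) : WellFounded (IsChild c) := by
  rw [wellFounded_iff_isEmpty_descending_chain]
  refine ⟨fun ⟨l, hl⟩ => ?_⟩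
  choose h0 w hw using hl
  have key : ∀ n, l 0 ++ (List.range n).map w = l n := fun n => by
    induction n with
    | zero => simp
    | succ n ih => rw [List.range_succ, List.map_append, ← List.append_assoc, ih, hw n]; rfl
  obtain ⟨n, hn⟩ := hc (l 0) w
  exact hn (by rw [key]; exact h0 n)

lemma Evaluates.unique {c : List ℕ → ℕ} (hc : IsCode c) {x : NN} {e e' : List ℕ → Bool}
    (he : Evaluates c x e) (he' : Evaluates c x e') : e = e' := by
  funext u
  induction u using hc.wellFounded.induction with
  | _ u ih =>
    rw [Bool.eq_iff_iff]
    rcases h : c u with _ | k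
    · rw [(he u).1 h, (he' u).1 h]
      exact exists_congr fun n => by rw [ih _ ⟨h, n, rfl⟩]
    · rw [(he u).2 k h, (he' u).2 k h]

lemma IsCode.exists_evaluates {c : List ℕ → ℕ} (hc : IsCode c) :
    ∃ e : NN → List ℕ → Bool, (∀ x, Evaluates c x (e x)) ∧ Measurable e := by
  classical
  let S : List ℕ → Set NN := hc.wellFounded.fix fun u rec =>
    if h : c u = 0 then ⋃ n, (rec (u ++ [n]) ⟨h, n, rfl⟩)ᶜ else leafSet (c u - 1)
  have hS0 : ∀ u, c u = 0 → S u = ⋃ n, (S (u ++ [n]))ᶜ := fun u h => by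
    simp only [S]
    rw [WellFounded.fix_eq, dif_pos h]
  have hS1 : ∀ u, c u ≠ 0 → S u = leafSet (c u - 1) := fun u h => by
    simp only [S]
    rw [WellFounded.fix_eq, dif_neg h]
  refine ⟨fun x u => decide (x ∈ S u), fun x u => ⟨fun h => ?_, fun k hk => ?_⟩,
    measurable_pi_iff.2 fun u => ?_⟩
  · simp [hS0 u h]
  · simp [hS1 u (by omega), hk]
  · have : MeasurableSet (S u) := by
      induction u using hc.wellFounded.induction with
      | _ u ih =>
        by_cases h : c u = 0
        · rw [hS0 u h]
          exact .iUnion fun n => (ih _ ⟨h, n, rfl⟩).compl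
        · rw [hS1 u h]
          exact measurableSet_leafSet _
    exact (measurable_to_bool (by simpa [preimage] using this))

/-- The point of `NN` described by an evaluation `e`: the value at `n` is the least `m` such that
the child of the root with index `Nat.pair n m` holds. -/
noncomputable def decodeEval (e : List ℕ → Bool) : NN :=
  fun n => sInf {m | e [Nat.pair n m] = true}

lemma measurableSet_apply_eq_true (u : List ℕ) :
    MeasurableSet {e : List ℕ → Bool | e u = true} :=
  measurableSet_fiber (f := fun e : List ℕ → Bool => e u) (measurable_pi_apply u) true

lemma measurable_decodeEval : Measurable decodeEval :=
  measurable_pi_iff.2 fun _ => measurable_sInf_setOf fun _ => measurableSet_apply_eq_true _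

/-- Every Borel function has a Borel code. -/
lemma exists_code_of_measurable {f : NN → NN} (hf : Measurable f) :
    ∃ c, IsCode c ∧ ∃ e : NN → List ℕ → Bool, (∀ x, Evaluates c x (e x)) ∧
      ∀ x, decodeEval (e x) = f x := by
  have hB : ∀ k : ℕ, IsCoded {x | f x k.unpair.1 = k.unpair.2} := fun k =>
    isCoded_of_measurableSet
      (measurableSet_fiber ((measurable_pi_apply k.unpair.1).comp hf) k.unpair.2)
  choose c hc e he hBe using hB
  refine ⟨graft c, isCode_graft hc, fun x => graftEval fun n => e n x,
    fun x => evaluates_graftEval fun n => he n x, fun x => funext fun n => ?_⟩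
  have : ∀ m, e (Nat.pair n m) x [] = true ↔ f x n = m := fun m => by
    rw [← hBe]
    simp
  simp [decodeEval, graftEval, this]

/-! ### The upper bound -/

/-- The tree labelled by `c : NN`. -/
def labels (c : NN) : List ℕ → ℕ := fun u => c (encode u)

/-- `c` codes a Borel uniformization of the branches of `T`. -/
def codedUniformizations : Set (Trees × NN) :=
  {p | IsCode (labels p.2) ∧
    ∀ x e, Evaluates (labels p.2) x e → (x, decodeEval e) ∈ branches p.1.1}

lemma exists_mem_codedUniformizations_iff (T : Trees) :
    (∃ c, (T, c) ∈ codedUniformizations) ↔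
      ∃ f : NN → NN, Measurable f ∧ ∀ x : NN, (x, f x) ∈ branches T.1 := by
  constructor
  · rintro ⟨c, hc, h⟩
    obtain ⟨e, he, hem⟩ := hc.exists_evaluates
    exact ⟨fun x => decodeEval (e x), measurable_decodeEval.comp hem, fun x => h x _ (he x)⟩
  · rintro ⟨f, hf, hfT⟩
    obtain ⟨c, hc, e, he, hef⟩ := exists_code_of_measurable hf
    have hl : labels (fun n => c (ofNat (List ℕ) n)) = c := by
      funext u
      simp [labels]
    refine ⟨fun n => c (ofNat (List ℕ) n), ?_⟩
    simp only [codedUniformizations, mem_ofPred_eq, hl]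
    refine ⟨hc, fun x e' he' => ?_⟩
    rw [he'.unique hc (he x), hef]
    exact hfT x

lemma isClosed_setOf_isTreeOn : IsClosed {T : TreeRep | IsTreeOn T} := by
  have : {T : TreeRep | IsTreeOn T} = ⋂ p : List ℕ × List ℕ, {T : TreeRep | T p = true →
      p.1.length = p.2.length ∧ ∀ n : ℕ, T (p.1.take n, p.2.take n) = true} := by
    ext T
    simp [IsTreeOn]
  rw [this]
  refine isClosed_iInter fun p => ?_
  have hclosed : ∀ q (b : Bool), IsClosed {T : TreeRep | T q = b} := fun q b =>
    isClosed_eq (continuous_apply q) continuous_const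
  simp only [imp_iff_not_or, Bool.not_eq_true, ofPred_or, ofPred_and, ofPred_forall]
  exact (hclosed _ _).union ((isClosed_const).inter (isClosed_iInter fun n => hclosed _ _))

instance {ι : Type} [Countable ι] : PolishSpace (ι → Bool) :=
  have : TopologicalSpace.IsCompletelyMetrizableSpace (ι → Bool) := inferInstance
  inferInstance

instance : PolishSpace Trees := isClosed_setOf_isTreeOn.polishSpace

lemma measurableSet_mem_branches :
    MeasurableSet {p : Trees × NN × NN | p.2 ∈ branches p.1.1} := by
  have : {p : Trees × NN × NN | p.2 ∈ branches p.1.1} =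
      ⋂ n, ⋃ s, ⋃ t, {p : Trees × NN × NN | p.1.1 (s, t) = true} ∩
        ({p | (List.range n).map p.2.1 = s} ∩ {p | (List.range n).map p.2.2 = t}) := by
    ext p
    simp [branches]
  rw [this]
  have hmap : ∀ n (s : List ℕ), MeasurableSet {x : NN | (List.range n).map x = s} := fun n s =>
    ((isLocallyConstant_map_range n).isOpen_fiber s).measurableSet
  refine .iInter fun n => .iUnion fun s => .iUnion fun t => .inter ?_ (.inter ?_ ?_)
  · exact measurableSet_fiber (f := fun p : Trees × NN × NN => p.1.1 (s, t))
      ((measurable_pi_apply (s, t)).comp (measurable_subtype_coe.comp measurable_fst)) true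
  · exact (measurable_fst.comp measurable_snd) (hmap n s)
  · exact (measurable_snd.comp measurable_snd) (hmap n t)

lemma measurableSet_evaluates :
    MeasurableSet {p : NN × NN × (List ℕ → Bool) | Evaluates (labels p.1) p.2.1 p.2.2} := by
  have he : ∀ u b, MeasurableSet {p : NN × NN × (List ℕ → Bool) | p.2.2 u = b} := fun u b =>
    measurableSet_fiber (f := fun p : NN × NN × (List ℕ → Bool) => p.2.2 u)
      ((measurable_pi_apply u).comp (measurable_snd.comp measurable_snd)) b
  have hc : ∀ u k, MeasurableSet {p : NN × NN × (List ℕ → Bool) | labels p.1 u = k} := fun u k =>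
    measurableSet_fiber (f := fun p : NN × NN × (List ℕ → Bool) => p.1 (encode u))
      ((measurable_pi_apply (encode u)).comp measurable_fst) k
  have hx : ∀ k, MeasurableSet {p : NN × NN × (List ℕ → Bool) | p.2.1 ∈ leafSet k} := fun k =>
    (measurable_fst.comp measurable_snd) (measurableSet_leafSet k)
  refine measurableSet_setOfPred.2 ?_
  unfold Evaluates
  refine .forall fun u => .and ?_ (.forall fun k => ?_)
  · exact (measurableSet_setOfPred.1 (hc u 0)).imp ((measurableSet_setOfPred.1 (he u true)).iff
      (.exists fun n => measurableSet_setOfPred.1 (he _ false)))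
  · exact (measurableSet_setOfPred.1 (hc u _)).imp ((measurableSet_setOfPred.1 (he u true)).iff
      (measurableSet_setOfPred.1 (hx k)))

lemma measurableSet_labels_branch (u : List ℕ) :
    MeasurableSet {p : NN × NN | ∀ n, labels p.1 (u ++ (List.range n).map p.2) = 0} := by
  have : {p : NN × NN | ∀ n, labels p.1 (u ++ (List.range n).map p.2) = 0} =
      ⋂ n, ⋃ s, {p : NN × NN | p.1 (encode (u ++ s)) = 0} ∩
        {p | (List.range n).map p.2 = s} := by
    ext p
    simp [labels]
  rw [this]
  exact .iInter fun n => .iUnion fun s => .inter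
    (measurableSet_fiber ((measurable_pi_apply (encode (u ++ s))).comp measurable_fst) 0)
    (measurable_snd ((isLocallyConstant_map_range n).isOpen_fiber s).measurableSet)

lemma analyticSet_compl_codedUniformizations : AnalyticSet codedUniformizationsᶜ := by
  let S : Bool → Set (Trees × NN) := fun b => cond b
    (⋃ u, Prod.fst '' {q : (Trees × NN) × NN |
      ∀ n, labels q.1.2 (u ++ (List.range n).map q.2) = 0})
    (Prod.fst '' {q : (Trees × NN) × NN × (List ℕ → Bool) |
      Evaluates (labels q.1.2) q.2.1 q.2.2 ∧ (q.2.1, decodeEval q.2.2) ∉ branches q.1.1.1})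
  have : codedUniformizationsᶜ = ⋃ b, S b := by
    ext p
    rw [mem_iUnion, Bool.exists_bool, or_comm]
    simp only [codedUniformizations, IsCode, mem_compl_iff, mem_ofPred_eq, not_and_or, S,
      cond_true, cond_false, mem_iUnion, mem_image, Prod.exists, exists_and_right, exists_eq_right]
    push Not
    simp
  rw [this]
  refine AnalyticSet.iUnion fun b => ?_
  cases b
  · refine MeasurableSet.analyticSet_image (.inter ?_ (.compl ?_)) measurable_fst
    · exact ((measurable_snd.comp measurable_fst).prodMk measurable_snd) measurableSet_evaluates
    · exact ((measurable_fst.comp measurable_fst).prodMk ((measurable_fst.comp measurable_snd).prodMk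
        (measurable_decodeEval.comp (measurable_snd.comp measurable_snd))))
        measurableSet_mem_branches
  · exact AnalyticSet.iUnion fun u => MeasurableSet.analyticSet_image
      (((measurable_snd.comp measurable_fst).prodMk measurable_snd)
        (measurableSet_labels_branch u)) measurable_fst

theorem mSigma12_uniformizable : MSigma12
    {T : Trees | ∃ f : NN → NN, Measurable f ∧ ∀ x : NN, (x, f x) ∈ branches T.1} := by
  refine ⟨codedUniformizations, ?_, ?_⟩
  · have h := analyticSet_compl_codedUniformizations
    rw [AnalyticSet] at h
    exact h.imp id fun ⟨g, hg, hr⟩ => ⟨g, hg.measurable, hr.symm⟩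
  · ext T
    simp [← exists_mem_codedUniformizations_iff]

end BorelUniformization

/-- (Adams–Kechris) The set of trees `T` on `ℕ × ℕ` whose set of branches `[T]` contains
the graph of a Borel function `ℕ^ℕ → ℕ^ℕ` (a full Borel uniformization) is
`Σ¹₂`-complete. -/
theorem trees_with_full_Borel_uniformization_Sigma12_complete :
    Sigma12Hard {T : Trees | ∃ f : NN → NN, Measurable f ∧ ∀ x : NN, (x, f x) ∈ branches T.1} ∧
    MSigma12 {T : Trees | ∃ f : NN → NN, Measurable f ∧ ∀ x : NN, (x, f x) ∈ branches T.1} :=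
  ⟨BorelUniformization.sigma12Hard_uniformizable, BorelUniformization.mSigma12_uniformizable⟩
end

section
/- There exists a closed set C ⊆ ℕ^ℕ × [ℕ]^ℕ such that the set {s ∈ ℕ^ℕ : χ_B(G_S|_{C_s}) < ∞} is Σ¹₂-complete. -/
open MeasureTheory Set

/-- The space `[ℕ]^ℕ` of infinite subsets of `ℕ`, identified with their increasing
enumerations, with the topology inherited from `ℕ^ℕ`. -/
abbrev IncSeq : Type := {x : NN // StrictMono x}

/-- The shift map `S(x) = x \ {min x}`. -/
def shift (x : IncSeq) : IncSeq :=
  ⟨fun n => x.1 (n + 1), fun _ _ h => x.2 (Nat.add_lt_add_right h 1)⟩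

/-- The edge relation of the shift graph `G_S` on `[ℕ]^ℕ`. -/
def shiftEdge (x y : IncSeq) : Prop := x ≠ y ∧ (shift x = y ∨ shift y = x)

/-- `G_S|_B` admits a Borel coloring with `n` colors. -/
def BorelColoringLE (B : Set IncSeq) (n : ℕ) : Prop :=
  ∃ c : B → Fin n, Measurable c ∧ ∀ x y : B, shiftEdge x.1 y.1 → c x ≠ c y

/-- The first `n` values of `w`, listed in reverse order. -/
def revPrefix (w : ℕ → ℕ) : ℕ → List ℕ
  | 0 => []
  | n + 1 => w n :: revPrefix w n

@[simp] theorem revPrefix_length (w : ℕ → ℕ) (n : ℕ) : (revPrefix w n).length = n := by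
  induction n with
  | zero => rfl
  | succ n ih => simp [revPrefix, ih]

theorem revPrefix_reverse (w : ℕ → ℕ) (n : ℕ) :
    (revPrefix w n).reverse = (List.range n).map w := by
  induction n with
  | zero => rfl
  | succ n ih => simp [revPrefix, ih, List.range_succ]

theorem eq_of_revPrefix_eq {w w' : ℕ → ℕ} {n : ℕ} (h : revPrefix w n = revPrefix w' n) :
    ∀ m < n, w m = w' m := by
  induction n with
  | zero => intro m hm; exact absurd hm (Nat.not_lt_zero m)
  | succ n ih =>
    simp only [revPrefix, List.cons.injEq] at h
    intro m hm
    rcases Nat.lt_succ_iff_lt_or_eq.1 hm with hm | rfl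
    · exact ih h.2 m hm
    · exact h.1

theorem exists_revPrefix_of_step (f : List ℕ → ℕ) :
    ∃ w : ℕ → ℕ, ∀ n, w n = f (revPrefix w n) := by
  let st : ℕ → List ℕ := fun n => Nat.rec [] (fun _ u => f u :: u) n
  have hst : ∀ n, revPrefix (fun n => f (st n)) n = st n := by
    intro n
    induction n with
    | zero => rfl
    | succ n ih => rw [revPrefix, ih]
  exact ⟨fun n => f (st n), fun n => by rw [hst]⟩

theorem revPrefix_shift (x : IncSeq) (n : ℕ) :
    revPrefix (shift x).1 n = (revPrefix x.1 (n + 1)).dropLast := by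
  induction n with
  | zero => rfl
  | succ n ih =>
    rw [revPrefix, ih]
    rfl

/-- `x` passes through the node `u` and above it follows the branching sets `A`. -/
def Follows (A : List ℕ → Set ℕ) (u : List ℕ) (x : IncSeq) : Prop :=
  revPrefix x.1 u.length = u ∧ ∀ n, u.length ≤ n → x.1 n ∈ A (revPrefix x.1 n)

/-- The Ramsey property relative to trees whose branching sets lie in the nonprincipal
ultrafilter `hyperfilter ℕ`. -/
def UltraRamsey (X : Set IncSeq) : Prop :=
  ∀ u : List ℕ, ∃ A : List ℕ → Set ℕ, (∀ v, A v ∈ Filter.hyperfilter ℕ) ∧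
    ((∀ x, Follows A u x → x ∈ X) ∨ ∀ x, Follows A u x → x ∉ X)

theorem UltraRamsey.compl {X : Set IncSeq} (h : UltraRamsey X) : UltraRamsey Xᶜ := by
  intro u
  obtain ⟨A, hA, h1 | h1⟩ := h u
  · exact ⟨A, hA, Or.inr fun x hx hx' => hx' (h1 x hx)⟩
  · exact ⟨A, hA, Or.inl h1⟩

theorem UltraRamsey.iUnion {X : ℕ → Set IncSeq} (h : ∀ k, UltraRamsey (X k)) :
    UltraRamsey (⋃ k, X k) := by
  classical
  let good : List ℕ → Prop := fun u =>
    ∃ A : List ℕ → Set ℕ, (∀ v, A v ∈ Filter.hyperfilter ℕ) ∧ ∀ x, Follows A u x → x ∈ ⋃ k, X k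
  have hstep : ∀ u, ¬ good u → {n | ¬ good (n :: u)} ∈ Filter.hyperfilter ℕ := by
    intro u hu
    by_contra hc
    have hc' : {n | good (n :: u)} ∈ Filter.hyperfilter ℕ := by
      have := Ultrafilter.compl_mem_iff_notMem.2 hc
      simpa [Set.compl_def] using this
    have hch : ∀ n : ℕ, ∃ A : List ℕ → Set ℕ, (∀ v, A v ∈ Filter.hyperfilter ℕ) ∧
        (good (n :: u) → ∀ x, Follows A (n :: u) x → x ∈ ⋃ k, X k) := by
      intro n
      by_cases hn : good (n :: u)
      · obtain ⟨A, hA, hA'⟩ := hn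
        exact ⟨A, hA, fun _ => hA'⟩
      · exact ⟨fun _ => Set.univ, fun _ => Filter.univ_mem, fun h => absurd h hn⟩
    choose A hA hA' using hch
    refine hu ⟨fun v => if v = u then {n | good (n :: u)} else
      A ((v.reverse.drop u.length).headD 0) v, ?_, ?_⟩
    · intro v
      by_cases hv : v = u
      · simp only [hv, if_true]; exact hc'
      · simp only [hv, if_false]; exact hA _ _
    · rintro x ⟨hx1, hx2⟩
      have hg : good (x.1 u.length :: u) := by
        have := hx2 _ le_rfl
        rw [hx1] at this
        simpa using this
      refine hA' _ hg x ⟨?_, ?_⟩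
      · simp [revPrefix, hx1]
      · intro n hn
        have hn' : u.length < n := by simpa using hn
        have h2 := hx2 n hn'.le
        have hne : revPrefix x.1 n ≠ u := by
          intro h
          have := congrArg List.length h
          simp at this
          omega
        simp only [hne, if_false] at h2
        have hd : ((revPrefix x.1 n).reverse.drop u.length).headD 0 = x.1 u.length := by
          rw [revPrefix_reverse, List.headD_eq_head?_getD, List.head?_drop]
          simp [hn']
        rwa [hd] at h2
  intro u
  by_cases hu : good u
  · obtain ⟨A, hA, hA'⟩ := hu
    exact ⟨A, hA, Or.inl hA'⟩
  have hav : ∀ (v : List ℕ) (k : ℕ), ∃ A : List ℕ → Set ℕ, (∀ v, A v ∈ Filter.hyperfilter ℕ) ∧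
      (¬ good v → ∀ x, Follows A v x → x ∉ X k) := by
    intro v k
    obtain ⟨A, hA, h1 | h1⟩ := h k v
    · exact ⟨A, hA, fun hv => absurd ⟨A, hA, fun x hx => Set.mem_iUnion.2 ⟨k, h1 x hx⟩⟩ hv⟩
    · exact ⟨A, hA, fun _ => h1⟩
  choose A hA hA' using hav
  refine ⟨fun v => {n | ¬ good v → ¬ good (n :: v)} ∩
    ⋂ i ∈ Finset.range (v.length + 1), ⋂ k ∈ Finset.range (v.length + 1), A (v.drop i) k v,
    ?_, Or.inr ?_⟩
  · intro v
    refine Filter.inter_mem ?_ ?_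
    · by_cases hv : good v
      · simp [hv]
      · simpa [hv] using hstep v hv
    · exact (Filter.biInter_finset_mem _).2 fun i _ =>
        (Filter.biInter_finset_mem _).2 fun k _ => hA _ _ _
  · rintro x ⟨hx1, hx2⟩ hx
    obtain ⟨k, hk⟩ := Set.mem_iUnion.1 hx
    have hng : ∀ m, ¬ good (revPrefix x.1 (u.length + m)) := by
      intro m
      induction m with
      | zero => simpa [hx1] using hu
      | succ m ih => exact (hx2 (u.length + m) (Nat.le_add_right _ _)).1 ih
    have hdrop : ∀ n m, (revPrefix x.1 (n + m)).drop m = revPrefix x.1 n := by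
      intro n m
      induction m with
      | zero => rfl
      | succ m ih => simpa [revPrefix] using ih
    refine hA' _ k (hng k) x ⟨by simp, ?_⟩ hk
    intro n hn
    rw [revPrefix_length] at hn
    have h2 := (hx2 n (by omega)).2
    simp only [Set.mem_iInter, Finset.mem_range, revPrefix_length] at h2
    have h3 := h2 (n - (u.length + k)) (by omega) k (by omega)
    have h4 := hdrop (u.length + k) (n - (u.length + k))
    rw [Nat.add_sub_cancel' hn] at h4
    rwa [h4] at h3

theorem ultraRamsey_coord (n m : ℕ) : UltraRamsey {x : IncSeq | x.1 n = m} := by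
  intro u
  rcases lt_or_ge n u.length with hn | hn
  · refine ⟨fun _ => Set.univ, fun _ => Filter.univ_mem, ?_⟩
    by_cases hm : ∃ x : IncSeq, revPrefix x.1 u.length = u ∧ x.1 n = m
    · obtain ⟨x, hx, hxm⟩ := hm
      refine Or.inl fun z hz => ?_
      have := eq_of_revPrefix_eq (hz.1.trans hx.symm) n hn
      exact this.trans hxm
    · exact Or.inr fun z hz hz' => hm ⟨z, hz.1, hz'⟩
  · refine ⟨fun _ => {m}ᶜ, fun _ => ?_, Or.inr fun x hx hx' => hx.2 n hn hx'⟩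
    exact Filter.hyperfilter_le_cofinite (by simp)

theorem MeasurableSet.ultraRamsey {X : Set IncSeq} (hX : MeasurableSet X) : UltraRamsey X := by
  let m' : MeasurableSpace IncSeq :=
    { MeasurableSet' := UltraRamsey
      measurableSet_empty := fun _ => ⟨fun _ => Set.univ, fun _ => Filter.univ_mem,
        Or.inr fun _ _ h => h⟩
      measurableSet_compl := fun _ h => h.compl
      measurableSet_iUnion := fun _ h => UltraRamsey.iUnion h }
  have hle : (Subtype.instMeasurableSpace : MeasurableSpace IncSeq) ≤ m' := by
    refine Measurable.comap_le (m₁ := m') ?_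
    refine @measurable_pi_iff _ _ _ m' _ _ |>.2 fun n => ?_
    refine @measurable_to_countable' _ _ _ _ m' _ fun k => ?_
    exact ultraRamsey_coord n k
  exact hle X hX

theorem exists_follows {A : List ℕ → Set ℕ} (hA : ∀ v, A v ∈ Filter.hyperfilter ℕ) :
    ∃ x : IncSeq, ∀ n, x.1 n ∈ A (revPrefix x.1 n) := by
  have hne : ∀ v : List ℕ, ∃ n, n ∈ A v ∧ ∀ m ∈ v.head?, m < n := by
    intro v
    have : {n | ∀ m ∈ v.head?, m < n} ∈ Filter.hyperfilter ℕ := by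
      refine Filter.hyperfilter_le_cofinite ?_
      rw [Nat.cofinite_eq_atTop]
      cases v with
      | nil => simp
      | cons a v => simpa using Filter.eventually_gt_atTop a
    exact (Filter.nonempty_of_mem (Filter.inter_mem (hA v) this))
  choose f hf hf' using hne
  obtain ⟨w, hw⟩ := exists_revPrefix_of_step f
  refine ⟨⟨w, strictMono_nat_of_lt_succ fun n => ?_⟩, fun n => ?_⟩
  · rw [hw (n + 1)]
    exact hf' _ _ (by simp [revPrefix])
  · show w n ∈ _
    rw [hw n]
    exact hf _

theorem shift_ne (x : IncSeq) : x ≠ shift x := by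
  intro h
  have : x.1 0 = x.1 1 := congrArg (fun y : IncSeq => y.1 0) h
  exact absurd this (x.2 Nat.zero_lt_one).ne

/-- Every Borel map from `[ℕ]^ℕ` to a finite set is constant on some edge of the shift graph. -/
theorem exists_eq_shift {k : ℕ} (c : IncSeq → Fin k) (hc : Measurable c) :
    ∃ x, c x = c (shift x) := by
  have hr : ∀ i, UltraRamsey (c ⁻¹' {i}) := fun i => (hc (measurableSet_singleton i)).ultraRamsey
  choose A hA hA' using fun i => hr i []
  obtain ⟨i, hi⟩ : ∃ i, ∀ x, Follows (A i) [] x → x ∈ c ⁻¹' {i} := by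
    by_contra hcon
    push Not at hcon
    obtain ⟨x, hx⟩ := exists_follows (A := fun v => ⋂ i, A i v)
      (fun v => Filter.iInter_mem.2 fun i => hA i v)
    refine ((hA' (c x)).resolve_left ?_) x ⟨rfl, fun n _ => Set.mem_iInter.1 (hx n) _⟩ rfl
    intro h
    obtain ⟨z, hz, hz'⟩ := hcon (c x)
    exact hz' (h z hz)
  obtain ⟨x, hx⟩ := exists_follows (A := fun v => A i v ∩ A i v.dropLast)
    (fun v => Filter.inter_mem (hA i v) (hA i _))
  refine ⟨x, ?_⟩
  have h1 : c x = i := hi x ⟨rfl, fun n _ => (hx n).1⟩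
  have h2 : c (shift x) = i := by
    refine hi _ ⟨rfl, fun n _ => ?_⟩
    rw [revPrefix_shift]
    exact (hx (n + 1)).2
  rw [h1, h2]

/-- The node `u` (a reversed finite sequence) and all its initial segments satisfy `ρ`. -/
def InTree (ρ : List ℕ → Prop) : List ℕ → Prop
  | [] => ρ []
  | i :: u => ρ (i :: u) ∧ InTree ρ u

theorem InTree.self {ρ : List ℕ → Prop} {u : List ℕ} (h : InTree ρ u) : ρ u := by
  cases u with
  | nil => exact h
  | cons i u => exact h.1

theorem inTree_revPrefix {ρ : List ℕ → Prop} {w : ℕ → ℕ} (h : ∀ n, ρ (revPrefix w n)) (n : ℕ) :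
    InTree ρ (revPrefix w n) := by
  induction n with
  | zero => exact h 0
  | succ n ih => exact ⟨h (n + 1), ih⟩

/-- The tree given by `ρ` has no infinite branch. -/
def NoBranch (ρ : List ℕ → Prop) : Prop := ∀ w : ℕ → ℕ, ∃ n, ¬ ρ (revPrefix w n)

/-- The first tree coded by the parameter `s`, at the point `y`. -/
def leftTree (s y : NN) (c : List ℕ) : Prop :=
  s (Encodable.encode (false, revPrefix y c.length, c, ([] : List ℕ))) = 0

/-- The second tree coded by the parameter `s`, at the point `y`; it may also depend on `s`
itself. -/
def rightTree (s y : NN) (c : List ℕ) : Prop :=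
  s (Encodable.encode (true, revPrefix s c.length, revPrefix y c.length, c)) = 0

/-- The point of Baire space coded by the first half of `v`. -/
def basePoint (v : NN) : NN := fun m => v (Encodable.encode (Sum.inl m : ℕ ⊕ List ℕ))

/-- The length-preserving monotone map on nodes coded by the second half of `v`. -/
def nodeMap (v : NN) : List ℕ → List ℕ
  | [] => []
  | i :: u => v (Encodable.encode (Sum.inr (i :: u) : ℕ ⊕ List ℕ)) :: nodeMap v u

/-- Up to stage `h`, `nodeMap v` maps the first tree at `basePoint v` into the second
tree at `y`. -/
def EmbedsBelow (h : ℕ) (s y v : NN) : Prop :=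
  ∀ u : List ℕ, Encodable.encode u < h → InTree (leftTree s (basePoint v)) u →
    InTree (rightTree s y) (nodeMap v u)

/-- No point below `x` passes stage `h`. -/
def Blocked (h : ℕ) (s y x : NN) : Prop :=
  ∀ w : NN, ¬ EmbedsBelow h s y (fun m => min (w m) (x m))

theorem EmbedsBelow.anti {h h' : ℕ} (hh : h ≤ h') {s y v : NN} (H : EmbedsBelow h' s y v) :
    EmbedsBelow h s y v := fun u hu => H u (hu.trans_le hh)

theorem Blocked.not_embedsBelow {h : ℕ} {s y x v : NN} (H : Blocked h s y x) (hv : v ≤ x) :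
    ¬ EmbedsBelow h s y v := by
  have := H v
  rwa [show (fun m => min (v m) (x m)) = v from funext fun m => min_eq_left (hv m)] at this

theorem Blocked.anti {h : ℕ} {s y x x' : NN} (hx : x ≤ x') (H : Blocked h s y x') :
    Blocked h s y x := fun _ => H.not_embedsBelow fun m => (min_le_right _ _).trans (hx m)

/-- The sequence of points coded by `z`. -/
def pointSeq (z : NN) (n : ℕ) : ℕ := (z n).unpair.1

/-- The sequence of stages coded by `z`. -/
def stageSeq (z : NN) (n : ℕ) : ℕ := (z n).unpair.2.unpair.1

/-- The sequence of codes of nodes coded by `z`. -/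
def codeSeq (z : NN) (n : ℕ) : ℕ := (z n).unpair.2.unpair.2

/-- The limit of the nodes coded by `z`. -/
def limitPoint (z : NN) : NN := fun m =>
  ((Encodable.decode (codeSeq z (m + 1)) : Option (List ℕ)).getD []).reverse.getD m 0

/-- The universal closed set. -/
def witnessSet : Set (NN × IncSeq) :=
  {p | (∀ n, pointSeq p.2.1 n < pointSeq p.2.1 (n + 1)) ∧
    (∀ n, codeSeq p.2.1 n =
      Encodable.encode (revPrefix (limitPoint p.2.1) (pointSeq p.2.1 n))) ∧
    ∀ n, Blocked (stageSeq p.2.1 n) p.1 (limitPoint p.2.1) fun m => pointSeq p.2.1 (n + m)}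

section LocallyConstant

variable {X : Type*} [TopologicalSpace X]

theorem isLocallyConstant_apply {a : X → NN} (ha : Continuous a) {f : X → ℕ}
    (hf : IsLocallyConstant f) : IsLocallyConstant fun x => a x (f x) := by
  rw [IsLocallyConstant.iff_continuous] at hf ⊢
  have h : Continuous fun p : NN × ℕ => p.1 p.2 :=
    continuous_prod_of_discrete_right.2 fun n => continuous_apply n
  exact h.comp (ha.prodMk hf)

theorem isLocallyConstant_apply_const {a : X → NN} (ha : Continuous a) (n : ℕ) :
    IsLocallyConstant fun x => a x n :=
  isLocallyConstant_apply ha (IsLocallyConstant.const n)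

theorem continuous_of_isLocallyConstant {a : X → NN}
    (ha : ∀ n, IsLocallyConstant fun x => a x n) : Continuous a :=
  continuous_pi fun n => (ha n).continuous

theorem IsLocallyConstant.map₂ {α β γ : Type*} {f : X → α} {g : X → β}
    (hf : IsLocallyConstant f) (hg : IsLocallyConstant g) (F : α → β → γ) :
    IsLocallyConstant fun x => F (f x) (g x) :=
  (hf.prodMk hg).comp fun p => F p.1 p.2

theorem isLocallyConstant_revPrefix {a : X → NN} (ha : Continuous a) (n : ℕ) :
    IsLocallyConstant fun x => revPrefix (a x) n := by
  induction n with
  | zero => exact IsLocallyConstant.const _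
  | succ n ih => exact (isLocallyConstant_apply_const ha n).map₂ ih List.cons

theorem isLocallyConstant_leftTree {a b : X → NN} (ha : Continuous a) (hb : Continuous b)
    (c : List ℕ) : IsLocallyConstant fun x => leftTree (a x) (b x) c :=
  (isLocallyConstant_apply ha ((isLocallyConstant_revPrefix hb c.length).comp fun r =>
    Encodable.encode (false, r, c, ([] : List ℕ)))).comp (· = 0)

theorem isLocallyConstant_rightTree {a b : X → NN} (ha : Continuous a) (hb : Continuous b)
    (c : List ℕ) : IsLocallyConstant fun x => rightTree (a x) (b x) c :=
  (isLocallyConstant_apply ha ((isLocallyConstant_revPrefix ha c.length).map₂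
    (isLocallyConstant_revPrefix hb c.length) fun r r' =>
    Encodable.encode (true, r, r', c))).comp (· = 0)

theorem isLocallyConstant_inTree {ρ : X → List ℕ → Prop}
    (h : ∀ c, IsLocallyConstant fun x => ρ x c) (u : List ℕ) :
    IsLocallyConstant fun x => InTree (ρ x) u := by
  induction u with
  | nil => exact h []
  | cons i u ih => exact (h (i :: u)).map₂ ih And

theorem isLocallyConstant_nodeMap {a : X → NN} (ha : Continuous a) (u : List ℕ) :
    IsLocallyConstant fun x => nodeMap (a x) u := by
  induction u with
  | nil => exact IsLocallyConstant.const _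
  | cons i u ih => exact (isLocallyConstant_apply_const ha _).map₂ ih List.cons

theorem isLocallyConstant_comp_of_forall {α β : Type*} {f : X → α} (hf : IsLocallyConstant f)
    {g : X → α → β} (hg : ∀ a, IsLocallyConstant fun x => g x a) :
    IsLocallyConstant fun x => g x (f x) := by
  rw [IsLocallyConstant.iff_eventually_eq] at hf ⊢
  intro x
  filter_upwards [hf x, (IsLocallyConstant.iff_eventually_eq _).1 (hg (f x)) x] with y h1 h2
  rw [h1, h2]

theorem continuous_basePoint : Continuous basePoint :=
  continuous_pi fun _ => continuous_apply _

theorem IsLocallyConstant.isClosed_setOf {p : X → Prop} (h : IsLocallyConstant p) :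
    IsClosed {x | p x} := by
  have := h.isClosed_fiber True
  simpa using this

theorem isClopen_embedsBelow {a b d : X → NN} (ha : Continuous a) (hb : Continuous b)
    (hd : Continuous d) (h : ℕ) : IsClopen {x | EmbedsBelow h (a x) (b x) (d x)} := by
  have hu : ∀ u : List ℕ, IsLocallyConstant fun x =>
      InTree (leftTree (a x) (basePoint (d x))) u → InTree (rightTree (a x) (b x))
        (nodeMap (d x) u) := fun u =>
    (isLocallyConstant_inTree
      (isLocallyConstant_leftTree ha (continuous_basePoint.comp hd)) u).map₂
      (isLocallyConstant_comp_of_forall (isLocallyConstant_nodeMap hd u) fun c =>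
        isLocallyConstant_inTree (isLocallyConstant_rightTree ha hb) c) (fun p q => p → q)
  have hfin : {u : List ℕ | Encodable.encode u < h}.Finite :=
    (Set.finite_Iio h).preimage Encodable.encode_injective.injOn
  have : {x | EmbedsBelow h (a x) (b x) (d x)} = ⋂ u ∈ {u : List ℕ | Encodable.encode u < h},
      {x | InTree (leftTree (a x) (basePoint (d x))) u → InTree (rightTree (a x) (b x))
        (nodeMap (d x) u)} := by
    ext x
    simp [EmbedsBelow]
  rw [this]
  refine hfin.isClopen_biInter fun u _ => ?_
  have := (hu u).isClopen_fiber True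
  simpa using this

theorem isClosed_blocked {a b d : X → NN} (ha : Continuous a) (hb : Continuous b)
    (hd : Continuous d) (h : ℕ) : IsClosed {x | Blocked h (a x) (b x) (d x)} := by
  simp only [Blocked, Set.ofPred_forall]
  refine isClosed_iInter fun w => ?_
  have := isClopen_embedsBelow ha hb (d := fun x m => min (w m) (d x m))
    (continuous_pi fun m => continuous_const.min ((continuous_apply m).comp hd)) h
  exact this.compl.isClosed

end LocallyConstant

theorem isLocallyConstant_pointSeq (n : ℕ) : IsLocallyConstant fun z => pointSeq z n :=
  (isLocallyConstant_apply_const continuous_id n).comp fun k => k.unpair.1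

theorem isLocallyConstant_stageSeq (n : ℕ) : IsLocallyConstant fun z => stageSeq z n :=
  (isLocallyConstant_apply_const continuous_id n).comp fun k => k.unpair.2.unpair.1

theorem isLocallyConstant_codeSeq (n : ℕ) : IsLocallyConstant fun z => codeSeq z n :=
  (isLocallyConstant_apply_const continuous_id n).comp fun k => k.unpair.2.unpair.2

theorem continuous_limitPoint : Continuous limitPoint :=
  continuous_of_isLocallyConstant fun m => (isLocallyConstant_codeSeq (m + 1)).comp fun k =>
    ((Encodable.decode k : Option (List ℕ)).getD []).reverse.getD m 0

theorem isClosed_witnessSet : IsClosed witnessSet := by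
  have hz : Continuous fun p : NN × IncSeq => p.2.1 := continuous_subtype_val.comp continuous_snd
  have hX := fun n => (isLocallyConstant_pointSeq n).comp_continuous hz
  have hH := fun n => (isLocallyConstant_stageSeq n).comp_continuous hz
  have hC := fun n => (isLocallyConstant_codeSeq n).comp_continuous hz
  have hY := continuous_limitPoint.comp hz
  simp only [witnessSet, Set.ofPred_and, Set.ofPred_forall]
  refine IsClosed.inter ?_ (IsClosed.inter ?_ ?_)
  · exact isClosed_iInter fun n => ((hX n).map₂ (hX (n + 1)) (· < ·)).isClosed_setOf
  · refine isClosed_iInter fun n => IsLocallyConstant.isClosed_setOf ?_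
    refine (hC n).map₂ (isLocallyConstant_comp_of_forall (hX n) fun k =>
      (isLocallyConstant_revPrefix hY k).comp Encodable.encode) Eq
  · refine isClosed_iInter fun n => ?_
    have : {p : NN × IncSeq | Blocked (stageSeq p.2.1 n) p.1 (limitPoint p.2.1)
        fun m => pointSeq p.2.1 (n + m)} = ⋂ h, ({p : NN × IncSeq | ¬ stageSeq p.2.1 n = h} ∪
        {p : NN × IncSeq | Blocked h p.1 (limitPoint p.2.1) fun m => pointSeq p.2.1 (n + m)}) := by
      ext p
      simp [← imp_iff_not_or]
    rw [this]
    refine isClosed_iInter fun h => IsClosed.union ?_ ?_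
    · exact ((hH n).comp fun k => ¬ k = h).isClosed_setOf
    · exact isClosed_blocked continuous_fst hY
        (continuous_pi fun m => (hX (n + m)).continuous) h

theorem limitPoint_eq_of_code {z Y : NN} {m k : ℕ}
    (h : codeSeq z (m + 1) = Encodable.encode (revPrefix Y k)) (hm : m < k) :
    limitPoint z m = Y m := by
  simp [limitPoint, h, revPrefix_reverse, hm]

theorem strictMono_pointSeq {s : NN} {z : IncSeq} (hz : (s, z) ∈ witnessSet) :
    StrictMono (pointSeq z.1) := strictMono_nat_of_lt_succ hz.1

theorem limitPoint_shift {s : NN} {z : IncSeq} (hz : (s, z) ∈ witnessSet) :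
    limitPoint (shift z).1 = limitPoint z.1 := by
  funext m
  refine limitPoint_eq_of_code (k := pointSeq z.1 (m + 2)) (hz.2.1 (m + 2)) ?_
  have := (strictMono_pointSeq hz).id_le (m + 2)
  simp only [id] at this
  omega

theorem shift_mem_witnessSet {s : NN} {z : IncSeq} (hz : (s, z) ∈ witnessSet) :
    (s, shift z) ∈ witnessSet := by
  have hY := limitPoint_shift hz
  refine ⟨fun n => hz.1 (n + 1), fun n => ?_, fun n => ?_⟩
  · simp only [hY]
    exact hz.2.1 (n + 1)
  · simp only [hY]
    have := hz.2.2 (n + 1)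
    simp only [Nat.add_right_comm n 1] at this
    exact this

theorem measurable_shift : Measurable shift :=
  Measurable.subtype_mk (f := fun (x : IncSeq) n => x.1 (n + 1)) (measurable_pi_lambda _ fun n =>
    (measurable_pi_apply (n + 1)).comp measurable_subtype_coe)

theorem measurable_sInf_setOf {X : Type*} [MeasurableSpace X] {Q : ℕ → X → Prop}
    (hQ : ∀ k, MeasurableSet {x | Q k x}) : Measurable fun x => sInf {k | Q k x} := by
  refine measurable_to_countable' fun m => ?_
  have : (fun x => sInf {k | Q k x}) ⁻¹' {m} =
      {x | (Q m x ∧ ∀ k < m, ¬ Q k x) ∨ (m = 0 ∧ ∀ k, ¬ Q k x)} := by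
    ext x
    simp only [mem_preimage, mem_singleton_iff, mem_ofPred_eq]
    constructor
    · rintro rfl
      by_cases hne : {k | Q k x}.Nonempty
      · exact Or.inl ⟨Nat.sInf_mem hne, fun k hk => Nat.notMem_of_lt_sInf hk⟩
      · rw [Set.not_nonempty_iff_eq_empty] at hne
        refine Or.inr ⟨by rw [hne, Nat.sInf_empty], fun k hk => ?_⟩
        have : k ∈ {k | Q k x} := hk
        simp [hne] at this
    · rintro (⟨h1, h2⟩ | ⟨rfl, h2⟩)
      · refine le_antisymm (Nat.sInf_le h1) (not_lt.1 fun hlt => ?_)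
        exact h2 _ hlt (Nat.sInf_mem (s := {k | Q k x}) ⟨m, h1⟩)
      · have : {k | Q k x} = ∅ := Set.eq_empty_iff_forall_notMem.2 h2
        rw [this, Nat.sInf_empty]
  rw [this]
  refine ((hQ m).inter (?_ : MeasurableSet {x | ∀ k < m, ¬ Q k x})).union
    ((MeasurableSet.const _).inter (?_ : MeasurableSet {x | ∀ k, ¬ Q k x}))
  · simp only [Set.ofPred_forall]
    exact MeasurableSet.iInter fun k => MeasurableSet.iInter fun _ => (hQ k).compl
  · simp only [Set.ofPred_forall]
    exact MeasurableSet.iInter fun k => (hQ k).compl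

/-- A forward-recurrent Borel set without consecutive points yields a Borel 3-coloring. -/
theorem borelColoringLE_of_marker {B E : Set IncSeq} (hE : MeasurableSet E)
    (hrec : ∀ z ∈ B, ∃ n, shift^[n] z ∈ E) (hind : ∀ z ∈ B, z ∈ E → shift z ∉ E) :
    BorelColoringLE B 3 := by
  classical
  let N : IncSeq → ℕ := fun z => sInf {n | shift^[n] z ∈ E}
  have hN : Measurable N := measurable_sInf_setOf fun n => (measurable_shift.iterate n) hE
  let c : IncSeq → Fin 3 := fun z => if z ∈ E then 2 else if N z % 2 = 0 then 0 else 1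
  have hc : Measurable c := Measurable.ite hE measurable_const
    (Measurable.ite (hN (MeasurableSet.of_discrete (s := {k | k % 2 = 0})))
      measurable_const measurable_const)
  have key : ∀ z ∈ B, c z ≠ c (shift z) := by
    intro z hz
    by_cases hzE : z ∈ E
    · have := hind z hz hzE
      simp only [c, hzE, this, if_true, if_false]
      split_ifs <;> decide
    · by_cases hsE : shift z ∈ E
      · simp only [c, hzE, hsE, if_true, if_false]
        split_ifs <;> decide
      · have hNz : N z = N (shift z) + 1 := by
          have h0 := Nat.sInf_mem (s := {n | shift^[n] z ∈ E}) (hrec z hz)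
          change shift^[N z] z ∈ E at h0
          rcases hk : N z with _ | k
          · rw [hk] at h0; exact absurd h0 hzE
          · rw [hk, Function.iterate_succ_apply] at h0
            have h1 : N (shift z) ≤ k := Nat.sInf_le h0
            have h2 : shift^[N (shift z)] (shift z) ∈ E :=
              Nat.sInf_mem (s := {n | shift^[n] (shift z) ∈ E}) ⟨k, h0⟩
            rw [← Function.iterate_succ_apply] at h2
            have h3 : N z ≤ N (shift z) + 1 := Nat.sInf_le h2
            omega
        simp only [c, hzE, hsE, if_false, hNz]
        split_ifs <;> omega
  refine ⟨fun z => c z.1, hc.comp measurable_subtype_coe, ?_⟩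
  rintro ⟨x, hx⟩ ⟨y, hy⟩ ⟨-, h | h⟩
  · have h : shift x = y := h
    subst h
    exact key x hx
  · have h : shift y = x := h
    subst h
    exact (key y hy).symm

/-- A strictly increasing function above `f`. -/
def partialSums (f : NN) (m : ℕ) : ℕ := m + ∑ k ∈ Finset.range (m + 1), f k

theorem strictMono_partialSums (f : NN) : StrictMono (partialSums f) :=
  strictMono_nat_of_lt_succ fun m => by
    simp only [partialSums, Finset.sum_range_succ _ (m + 1)]
    omega

theorem le_partialSums (f : NN) (m : ℕ) : f m ≤ partialSums f m := by
  simp only [partialSums, Finset.sum_range_succ]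
  omega

/-- The index of the interval between consecutive values of `partialSums f` containing `t`. -/
noncomputable def intervalIndex (f : NN) (t : ℕ) : ℕ := sInf {j | t < partialSums f j}

theorem lt_intervalIndex_iff {f : NN} {t j : ℕ} :
    j < intervalIndex f t ↔ partialSums f j ≤ t := by
  constructor
  · intro h
    exact not_lt.1 (Nat.notMem_of_lt_sInf (s := {j | t < partialSums f j}) h)
  · intro h
    by_contra hc
    have hmem : t < partialSums f (intervalIndex f t) :=
      Nat.sInf_mem (s := {j | t < partialSums f j})
        ⟨t + 1, lt_of_lt_of_le (Nat.lt_succ_self t) ((strictMono_partialSums f).id_le (t + 1))⟩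
    have := (strictMono_partialSums f).monotone (not_lt.1 hc)
    omega

theorem intervalIndex_mono (f : NN) : Monotone (intervalIndex f) := by
  intro t t' h
  by_contra hc
  have := lt_intervalIndex_iff.1 (not_le.1 hc)
  exact absurd (lt_intervalIndex_iff.2 (this.trans h)) (lt_irrefl _)

/-- If `f` escapes every tail of the increasing sequence `X`, then some interval
contains two consecutive values of `X`, the second being the last one in it. -/
theorem exists_last_in_interval {f X : NN} (hX : StrictMono X)
    (h : ∀ n, ∃ m, X (n + m) < f m) :
    ∃ n, intervalIndex f (X n) = intervalIndex f (X (n + 1)) ∧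
      intervalIndex f (X (n + 1)) ≠ intervalIndex f (X (n + 2)) := by
  obtain ⟨n, hn⟩ : ∃ n, intervalIndex f (X n) = intervalIndex f (X (n + 1)) := by
    by_contra! hc
    have hlt : ∀ n, intervalIndex f (X n) < intervalIndex f (X (n + 1)) := fun n =>
      lt_of_le_of_ne (intervalIndex_mono f (hX n.lt_succ_self).le) (hc n)
    have hge : ∀ m, m < intervalIndex f (X (1 + m)) := by
      intro m
      induction m with
      | zero => exact Nat.zero_lt_of_lt (hlt 0)
      | succ m ih => exact lt_of_le_of_lt ih (hlt (1 + m))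
    obtain ⟨m, hm⟩ := h 1
    have := lt_intervalIndex_iff.1 (hge m)
    have := le_partialSums f m
    omega
  have hex : ∃ m, intervalIndex f (X (n + m + 1)) ≠ intervalIndex f (X (n + m + 2)) := by
    by_contra! hc
    have hconst : ∀ m, intervalIndex f (X (n + m + 1)) = intervalIndex f (X (n + 1)) := by
      intro m
      induction m with
      | zero => rfl
      | succ m ih => rw [← ih, hc m]; rfl
    set J := intervalIndex f (X (n + 1))
    have h1 : J < intervalIndex f (X (n + partialSums f J + 1)) :=
      lt_intervalIndex_iff.2 (by
        have := hX.id_le (n + partialSums f J + 1)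
        simp only [id] at this
        omega)
    rw [hconst] at h1
    exact lt_irrefl _ h1
  classical
  refine ⟨n + Nat.find hex, ?_, Nat.find_spec hex⟩
  rcases hk : Nat.find hex with _ | k
  · exact hn
  · have := Nat.find_min hex (m := k) (by omega)
    push Not at this
    exact this

/-- The nodes `t` from which a strategy following the well-founded tree `ρ` above `u` stays
inside `ρ'`. -/
inductive Extendable (ρ ρ' : List ℕ → Prop) : List ℕ → List ℕ → Prop
  | mk (u t : List ℕ) (ht : InTree ρ' t) (k : ℕ → ℕ)
      (h : ∀ i, InTree ρ (i :: u) → Extendable ρ ρ' (i :: u) (k i :: t)) : Extendable ρ ρ' u t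

theorem extendable_iff {ρ ρ' : List ℕ → Prop} {u t : List ℕ} :
    Extendable ρ ρ' u t ↔
      InTree ρ' t ∧ ∀ i, InTree ρ (i :: u) → ∃ k, Extendable ρ ρ' (i :: u) (k :: t) := by
  constructor
  · rintro ⟨_, _, ht, k, h⟩
    exact ⟨ht, fun i hi => ⟨k i, h i hi⟩⟩
  · rintro ⟨ht, h⟩
    have : ∀ i, ∃ k, InTree ρ (i :: u) → Extendable ρ ρ' (i :: u) (k :: t) := by
      intro i
      by_cases hi : InTree ρ (i :: u)
      · obtain ⟨k, hk⟩ := h i hi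
        exact ⟨k, fun _ => hk⟩
      · exact ⟨0, fun h => absurd h hi⟩
    choose k hk using this
    exact ⟨u, t, ht, k, hk⟩

/-- The relation of being an immediate extension inside the tree `ρ`. -/
def ChildIn (ρ : List ℕ → Prop) (v u : List ℕ) : Prop := ∃ i, v = i :: u ∧ InTree ρ v

theorem NoBranch.acc {ρ : List ℕ → Prop} (h : NoBranch ρ) (u : List ℕ) : Acc (ChildIn ρ) u := by
  classical
  have h0 : Acc (ChildIn ρ) [] := by
    by_contra hc
    have hstep : ∀ v, ∃ i, ¬ Acc (ChildIn ρ) v →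
        InTree ρ (i :: v) ∧ ¬ Acc (ChildIn ρ) (i :: v) := by
      intro v
      by_cases hv : Acc (ChildIn ρ) v
      · exact ⟨0, fun h => absurd hv h⟩
      · by_contra! hcon
        refine hv ⟨v, ?_⟩
        rintro _ ⟨i, rfl, hi⟩
        exact (hcon i).2 hi
    choose f hf using hstep
    obtain ⟨w, hw⟩ := exists_revPrefix_of_step f
    have hna : ∀ n, ¬ Acc (ChildIn ρ) (revPrefix w n) := by
      intro n
      induction n with
      | zero => exact hc
      | succ n ih => rw [revPrefix, hw n]; exact (hf _ ih).2
    have hin : ∀ n, InTree ρ (revPrefix w (n + 1)) := by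
      intro n
      rw [revPrefix, hw n]
      exact (hf _ (hna n)).1
    obtain ⟨n, hn⟩ := h w
    cases n with
    | zero => exact hn (hin 0).2
    | succ n => exact hn (hin n).self
  induction u with
  | nil => exact h0
  | cons i u ih =>
    by_cases hi : InTree ρ (i :: u)
    · exact ih.inv ⟨i, rfl, hi⟩
    · refine ⟨_, ?_⟩
      rintro _ ⟨j, rfl, hj⟩
      exact absurd hj.2 hi

theorem Extendable.of_branch {ρ ρ' : List ℕ → Prop} (h : NoBranch ρ) {w : ℕ → ℕ}
    (hw : ∀ n, ρ' (revPrefix w n)) (u : List ℕ) (n : ℕ) :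
    Extendable ρ ρ' u (revPrefix w n) := by
  induction h.acc u generalizing n with
  | intro u _ ih =>
    exact ⟨_, _, inTree_revPrefix hw n, fun _ => w n, fun i hi => ih _ ⟨i, rfl, hi⟩ (n + 1)⟩

theorem measurableSet_inTree {X : Type*} [MeasurableSpace X] {ρ : X → List ℕ → Prop}
    (hρ : ∀ t, MeasurableSet {x | ρ x t}) (t : List ℕ) : MeasurableSet {x | InTree (ρ x) t} := by
  induction t with
  | nil => exact hρ []
  | cons i t ih => exact (hρ (i :: t)).inter ih

theorem measurableSet_extendable {X : Type*} [MeasurableSpace X] {ρ : List ℕ → Prop}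
    {ρ' : X → List ℕ → Prop} (h : NoBranch ρ) (hρ' : ∀ t, MeasurableSet {x | ρ' x t})
    (u t : List ℕ) : MeasurableSet {x | Extendable ρ (ρ' x) u t} := by
  induction h.acc u generalizing t with
  | intro u _ ih =>
    simp only [extendable_iff (u := u) (t := t), Set.ofPred_and, Set.ofPred_forall,
      Set.ofPred_exists]
    exact (measurableSet_inTree hρ' t).inter (MeasurableSet.iInter fun i =>
      MeasurableSet.iInter fun hi => MeasurableSet.iUnion fun k => ih _ ⟨i, rfl, hi⟩ (k :: t))

/-- The image of a node under the strategy given by `Extendable`. -/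
noncomputable def strategy (ρ ρ' : List ℕ → Prop) : List ℕ → List ℕ
  | [] => []
  | i :: u => sInf {k | Extendable ρ ρ' (i :: u) (k :: strategy ρ ρ' u)} :: strategy ρ ρ' u

theorem extendable_strategy {ρ ρ' : List ℕ → Prop} (h : Extendable ρ ρ' [] []) {u : List ℕ}
    (hu : InTree ρ u) : Extendable ρ ρ' u (strategy ρ ρ' u) := by
  induction u with
  | nil => exact h
  | cons i u ih => exact Nat.sInf_mem ((extendable_iff.1 (ih hu.2)).2 i hu)

/-- The point coding `y` together with the strategy. -/
noncomputable def strategyCode (y : NN) (ρ ρ' : List ℕ → Prop) : NN := fun n =>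
  match (Encodable.decode n : Option (ℕ ⊕ List ℕ)) with
  | some (Sum.inl m) => y m
  | some (Sum.inr (i :: u)) => sInf {k | Extendable ρ ρ' (i :: u) (k :: strategy ρ ρ' u)}
  | _ => 0

theorem basePoint_strategyCode (y : NN) (ρ ρ' : List ℕ → Prop) :
    basePoint (strategyCode y ρ ρ') = y := by
  funext m
  simp only [basePoint, strategyCode, Encodable.encodek]

theorem nodeMap_strategyCode (y : NN) (ρ ρ' : List ℕ → Prop) (u : List ℕ) :
    nodeMap (strategyCode y ρ ρ') u = strategy ρ ρ' u := by
  induction u with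
  | nil => rfl
  | cons i u ih =>
    rw [nodeMap, ih, strategy]
    simp only [strategyCode, Encodable.encodek]

theorem measurable_strategyCode {X : Type*} [MeasurableSpace X] {ρ : List ℕ → Prop}
    {ρ' : X → List ℕ → Prop} (h : NoBranch ρ) (hρ' : ∀ t, MeasurableSet {x | ρ' x t}) (y : NN) :
    Measurable fun x => strategyCode y ρ (ρ' x) := by
  have hone : ∀ v t : List ℕ, Measurable fun x => sInf {k | Extendable ρ (ρ' x) v (k :: t)} :=
    fun v t => measurable_sInf_setOf fun k => measurableSet_extendable h hρ' v (k :: t)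
  have hcomb : ∀ v u : List ℕ, (∀ t, MeasurableSet {x | strategy ρ (ρ' x) u = t}) →
      Measurable fun x => sInf {k | Extendable ρ (ρ' x) v (k :: strategy ρ (ρ' x) u)} := by
    intro v u hu
    refine measurable_to_countable' fun m => ?_
    have : (fun x => sInf {k | Extendable ρ (ρ' x) v (k :: strategy ρ (ρ' x) u)}) ⁻¹' {m} =
        ⋃ t, ({x | strategy ρ (ρ' x) u = t} ∩
          (fun x => sInf {k | Extendable ρ (ρ' x) v (k :: t)}) ⁻¹' {m}) := by
      ext x
      simp
    rw [this]
    exact MeasurableSet.iUnion fun t => (hu t).inter (hone v t (measurableSet_singleton m))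
  have hstr : ∀ u t : List ℕ, MeasurableSet {x | strategy ρ (ρ' x) u = t} := by
    intro u
    induction u with
    | nil => intro t; simp [strategy]
    | cons i u ih =>
      rintro (_ | ⟨k, t⟩)
      · simp [strategy]
      · simp only [strategy, List.cons.injEq, Set.ofPred_and]
        exact (hcomb (i :: u) u ih (measurableSet_singleton k)).inter (ih t)
  refine measurable_pi_lambda _ fun n => ?_
  unfold strategyCode
  rcases (Encodable.decode n : Option (ℕ ⊕ List ℕ)) with _ | m | _ | ⟨i, u⟩
  · exact measurable_const
  · exact measurable_const
  · exact measurable_const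
  · exact hcomb (i :: u) u (hstr u)

theorem borelColoringLE_of_noBranch {s y₀ : NN} (h : NoBranch (leftTree s y₀))
    (h' : ∀ y, ¬ NoBranch (rightTree s y)) :
    BorelColoringLE {z | (s, z) ∈ witnessSet} 3 := by
  let f : IncSeq → NN := fun z =>
    strategyCode y₀ (leftTree s y₀) (rightTree s (limitPoint z.1))
  have hlim : Measurable fun z : IncSeq => limitPoint z.1 :=
    continuous_limitPoint.measurable.comp measurable_subtype_coe
  have hf : Measurable f := by
    refine (measurable_strategyCode (ρ' := rightTree s) h (fun t => ?_) y₀).comp hlim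
    exact (isLocallyConstant_rightTree continuous_const continuous_id
      t).isClosed_setOf.measurableSet
  have hX : ∀ n, Measurable fun z : IncSeq => pointSeq z.1 n := fun n =>
    (isLocallyConstant_pointSeq n).continuous.measurable.comp measurable_subtype_coe
  have hp : ∀ n, Measurable fun z : IncSeq => intervalIndex (f z) (pointSeq z.1 n) := by
    intro n
    refine measurable_sInf_setOf fun j => measurableSet_lt (hX n) ?_
    exact measurable_const.add (Finset.measurable_sum _ fun k _ => (measurable_pi_apply k).comp hf)
  have hfix : ∀ z, (s, z) ∈ witnessSet → ∀ n, (s, shift^[n] z) ∈ witnessSet ∧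
      f (shift^[n] z) = f z ∧ ∀ m, pointSeq (shift^[n] z).1 m = pointSeq z.1 (n + m) := by
    intro z hz n
    induction n with
    | zero => exact ⟨hz, rfl, fun m => by simp⟩
    | succ n ih =>
      rw [Function.iterate_succ_apply']
      refine ⟨shift_mem_witnessSet ih.1, ?_, fun m => ?_⟩
      · rw [← ih.2.1]
        simp only [f, limitPoint_shift ih.1]
      · rw [Nat.add_right_comm, Nat.add_assoc]
        exact ih.2.2 (m + 1)
  refine borelColoringLE_of_marker (E := {z |
    intervalIndex (f z) (pointSeq z.1 0) = intervalIndex (f z) (pointSeq z.1 1) ∧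
    intervalIndex (f z) (pointSeq z.1 1) ≠ intervalIndex (f z) (pointSeq z.1 2)}) ?_ ?_ ?_
  · exact (measurableSet_eq_fun (hp 0) (hp 1)).inter (measurableSet_eq_fun (hp 1) (hp 2)).compl
  · intro z hz
    have hesc : ∀ n, ∃ m, pointSeq z.1 (n + m) < f z m := by
      intro n
      by_contra! hc
      refine (hz.2.2 n).not_embedsBelow (v := f z) hc fun u _ hu => ?_
      rw [basePoint_strategyCode] at hu
      rw [nodeMap_strategyCode]
      have hb := h' (limitPoint z.1)
      simp only [NoBranch, not_forall, not_exists, not_not] at hb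
      obtain ⟨w, hw⟩ := hb
      have := extendable_strategy (Extendable.of_branch h hw [] 0) hu
      exact (extendable_iff.1 this).1
    obtain ⟨n, hn⟩ := exists_last_in_interval (strictMono_pointSeq hz) hesc
    refine ⟨n, ?_⟩
    simpa only [mem_ofPred_eq, (hfix z hz n).2.1, (hfix z hz n).2.2, Nat.add_zero] using hn
  · rintro z hz ⟨-, h1⟩ ⟨h2, -⟩
    have h3 := hfix z hz 1
    simp only [Function.iterate_one] at h3
    rw [h3.2.1, h3.2.2, h3.2.2] at h2
    exact h1 h2

theorem nodeMap_revPrefix (v w : NN) (n : ℕ) :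
    nodeMap v (revPrefix w n) = revPrefix
      (fun m => v (Encodable.encode (Sum.inr (revPrefix w (m + 1)) : ℕ ⊕ List ℕ))) n := by
  induction n with
  | zero => rfl
  | succ n ih =>
    rw [revPrefix, nodeMap, ih]
    rfl

theorem exists_not_embedsBelow {s y : NN} (h : NoBranch (rightTree s y))
    (h' : ∀ y', ¬ NoBranch (leftTree s y')) (v : NN) : ∃ k, ¬ EmbedsBelow k s y v := by
  by_contra! hc
  have hb := h' (basePoint v)
  simp only [NoBranch, not_forall, not_exists, not_not] at hb
  obtain ⟨w, hw⟩ := hb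
  obtain ⟨n, hn⟩ := h fun m => v (Encodable.encode (Sum.inr (revPrefix w (m + 1)) : ℕ ⊕ List ℕ))
  rw [← nodeMap_revPrefix] at hn
  exact hn (hc _ _ (Nat.lt_succ_self _) (inTree_revPrefix hw n)).self

theorem exists_blocked {s y : NN} (h : ∀ v, ∃ k, ¬ EmbedsBelow k s y v) (x : NN) :
    ∃ k, Blocked k s y x := by
  by_contra! hc
  have hcl : ∀ k, IsClosed {v | EmbedsBelow k s y v} := fun k =>
    (isClopen_embedsBelow continuous_const continuous_const continuous_id k).isClosed
  have hne := IsCompact.nonempty_iInter_of_sequence_nonempty_isCompact_isClosed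
    (fun k => Set.Icc 0 x ∩ {v | EmbedsBelow k s y v})
    (fun k => Set.inter_subset_inter_right _ fun v hv => EmbedsBelow.anti k.le_succ hv)
    (fun k => ?_) (isCompact_Icc.inter_right (hcl 0)) (fun k => isClosed_Icc.inter (hcl k))
  · obtain ⟨v, hv⟩ := hne
    obtain ⟨k, hk⟩ := h v
    exact hk (Set.mem_iInter.1 hv k).2
  · have := hc k
    simp only [Blocked, not_forall, not_not] at this
    obtain ⟨w, hw⟩ := this
    exact ⟨_, ⟨fun _ => Nat.zero_le _, fun m => min_le_right _ _⟩, hw⟩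

theorem strictMono_encode_revPrefix (w : NN) :
    StrictMono fun n => Encodable.encode (revPrefix w n) :=
  strictMono_nat_of_lt_succ fun n => by
    simp only [revPrefix, Encodable.encode_list_cons]
    exact Nat.lt_succ_of_le (Nat.right_le_pair _ _)

/-- The first stage at which everything below `x` is blocked. -/
noncomputable def blockStage (s y x : NN) : ℕ := sInf {k | Blocked k s y x}

/-- The point of the closed set coding `x`. -/
noncomputable def codingSeq (s y : NN) (x : IncSeq) : NN := fun n =>
  Nat.pair (x.1 n) (Nat.pair (blockStage s y fun m => x.1 (n + m))
    (Encodable.encode (revPrefix y (x.1 n))))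

theorem pointSeq_codingSeq (s y : NN) (x : IncSeq) (n : ℕ) :
    pointSeq (codingSeq s y x) n = x.1 n := by
  simp [pointSeq, codingSeq]

theorem stageSeq_codingSeq (s y : NN) (x : IncSeq) (n : ℕ) :
    stageSeq (codingSeq s y x) n = blockStage s y fun m => x.1 (n + m) := by
  simp [stageSeq, codingSeq]

theorem codeSeq_codingSeq (s y : NN) (x : IncSeq) (n : ℕ) :
    codeSeq (codingSeq s y x) n = Encodable.encode (revPrefix y (x.1 n)) := by
  simp [codeSeq, codingSeq]

theorem limitPoint_codingSeq (s y : NN) (x : IncSeq) : limitPoint (codingSeq s y x) = y := by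
  funext m
  refine limitPoint_eq_of_code (codeSeq_codingSeq s y x (m + 1)) ?_
  exact x.2.id_le (m + 1)

theorem not_borelColoringLE_of_noBranch {s y : NN} (h : NoBranch (rightTree s y))
    (h' : ∀ y', ¬ NoBranch (leftTree s y')) (k : ℕ) :
    ¬ BorelColoringLE {z | (s, z) ∈ witnessSet} k := by
  rintro ⟨c, hc, hcol⟩
  have hbl : ∀ x, Blocked (blockStage s y x) s y x := fun x =>
    Nat.sInf_mem (s := {k | Blocked k s y x}) (exists_blocked (exists_not_embedsBelow h h') x)
  have hmono : Monotone (blockStage s y) := fun x x' hx =>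
    Nat.sInf_le ((hbl x').anti hx)
  have hinc : ∀ x : IncSeq, StrictMono (codingSeq s y x) := by
    refine fun x => strictMono_nat_of_lt_succ fun n => ?_
    have h1 : x.1 n < x.1 (n + 1) := x.2 n.lt_succ_self
    have h2 : blockStage s y (fun m => x.1 (n + m)) ≤ blockStage s y fun m => x.1 (n + 1 + m) :=
      hmono fun m => x.2.monotone (by omega)
    have hl : ∀ b, StrictMono fun a => Nat.pair a b := fun b _ _ => Nat.pair_lt_pair_left b
    have hr : ∀ a, StrictMono (Nat.pair a) := fun a _ _ => Nat.pair_lt_pair_right a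
    exact (hl _ h1).trans_le ((hr _).monotone (((hl _).monotone h2).trans
      ((hr _).monotone (strictMono_encode_revPrefix y h1).le)))
  let Φ : IncSeq → IncSeq := fun x => ⟨codingSeq s y x, hinc x⟩
  have hΦ : ∀ x, (s, Φ x) ∈ witnessSet := by
    intro x
    refine ⟨fun n => ?_, fun n => ?_, fun n => ?_⟩
    · simp only [Φ, pointSeq_codingSeq]
      exact x.2 n.lt_succ_self
    · simp only [Φ, pointSeq_codingSeq, codeSeq_codingSeq, limitPoint_codingSeq]
    · simp only [Φ, pointSeq_codingSeq, stageSeq_codingSeq, limitPoint_codingSeq]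
      exact hbl _
  have hΦs : ∀ x, Φ (shift x) = shift (Φ x) := by
    intro x
    refine Subtype.ext (funext fun n => ?_)
    simp only [Φ, shift, codingSeq]
    simp only [Nat.add_right_comm n _ 1]
  have hΦm : Measurable Φ := by
    refine Measurable.subtype_mk (measurable_pi_lambda _ fun n => ?_)
    have hx : ∀ n, Measurable fun x : IncSeq => x.1 n := fun n =>
      (measurable_pi_apply n).comp measurable_subtype_coe
    have hb : Measurable fun x : IncSeq => blockStage s y fun m => x.1 (n + m) := by
      refine measurable_sInf_setOf fun k => IsClosed.measurableSet ?_
      exact isClosed_blocked continuous_const continuous_const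
        (continuous_pi fun m => (continuous_apply (n + m)).comp continuous_subtype_val) k
    exact (Measurable.of_discrete (f := fun p : ℕ × ℕ =>
      Nat.pair p.1 (Nat.pair p.2 (Encodable.encode (revPrefix y p.1))))).comp ((hx n).prodMk hb)
  obtain ⟨x, hx⟩ := exists_eq_shift (fun x => c ⟨Φ x, hΦ x⟩) (hc.comp (hΦm.subtype_mk))
  refine hcol ⟨Φ x, hΦ x⟩ ⟨Φ (shift x), hΦ _⟩ ⟨?_, Or.inl (hΦs x).symm⟩ hx
  simp only [hΦs]
  exact shift_ne _

/-- `E` is the valuation at `z` of the Borel code `ℓ`: a node labelled `m + 1` holds at `z` iff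
`z m.unpair.1 = m.unpair.2`, and a node of the tree of zeros of `ℓ` holds iff one of its
children fails. -/
def IsValuation (ℓ : List ℕ → ℕ) (z : NN) (E : List ℕ → Prop) : Prop :=
  ∀ t, E t ↔ (InTree (fun u => ℓ u = 0) t ∧ ∃ i, ¬ E (i :: t)) ∨
    ∃ m, ℓ t = m + 1 ∧ z m.unpair.1 = m.unpair.2

theorem NoBranch.wellFounded {ρ : List ℕ → Prop} (h : NoBranch ρ) :
    WellFounded fun v u => ∃ i, v = i :: u ∧ InTree ρ u := by
  refine ⟨fun u => ?_⟩
  induction h.acc u with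
  | intro u _ ih =>
    refine ⟨_, ?_⟩
    rintro _ ⟨i, rfl, -⟩
    by_cases hi : InTree ρ (i :: u)
    · exact ih _ ⟨i, rfl, hi⟩
    · refine ⟨_, ?_⟩
      rintro _ ⟨j, rfl, hj⟩
      exact absurd hj hi

theorem exists_isValuation {ℓ : List ℕ → ℕ} (h : NoBranch fun u => ℓ u = 0) :
    ∃ E : NN → List ℕ → Prop, (∀ z, IsValuation ℓ z (E z)) ∧
      ∀ t, MeasurableSet {z | E z t} := by
  let E : NN → List ℕ → Prop := fun z => h.wellFounded.fix fun t ih =>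
    (∃ ht : InTree (fun u => ℓ u = 0) t, ∃ i, ¬ ih (i :: t) ⟨i, rfl, ht⟩) ∨
      ∃ m, ℓ t = m + 1 ∧ z m.unpair.1 = m.unpair.2
  have hE : ∀ z, IsValuation ℓ z (E z) := by
    intro z t
    have := h.wellFounded.fix_eq (C := fun _ => Prop) (fun t ih =>
      (∃ ht : InTree (fun u => ℓ u = 0) t, ∃ i, ¬ ih (i :: t) ⟨i, rfl, ht⟩) ∨
        ∃ m, ℓ t = m + 1 ∧ z m.unpair.1 = m.unpair.2) t
    rw [← exists_prop]
    exact this.to_iff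
  refine ⟨E, hE, fun t => ?_⟩
  induction t using h.wellFounded.induction with
  | _ t ih =>
    have : {z | E z t} = {z | (InTree (fun u => ℓ u = 0) t ∧ ∃ i, ¬ E z (i :: t)) ∨
        ∃ m, ℓ t = m + 1 ∧ z m.unpair.1 = m.unpair.2} := Set.ext fun z => hE z t
    rw [this]
    rw [measurableSet_setOfPred]
    refine Measurable.or ?_ (Measurable.exists fun m => measurable_const.and
      (measurableSet_setOfPred.1
        (measurableSet_eq_fun (measurable_pi_apply _) measurable_const)))
    by_cases ht : InTree (fun u => ℓ u = 0) t
    · exact measurable_const.and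
        (Measurable.exists fun i => (measurableSet_setOfPred.1 (ih _ ⟨i, rfl, ht⟩)).not)
    · simp only [ht, false_and]
      exact measurable_const

/-- `S` has a well-founded Borel code. -/
def IsCoded (S : Set IncSeq) : Prop :=
  ∃ ℓ : List ℕ → ℕ, (NoBranch fun u => ℓ u = 0) ∧
    ∀ (z : IncSeq) (E : List ℕ → Prop), IsValuation ℓ z.1 E → (E [] ↔ z ∈ S)

theorem isCoded_coord (a b : ℕ) : IsCoded {z | z.1 a = b} := by
  refine ⟨fun _ => Nat.pair a b + 1, fun w => ⟨0, by simp⟩, fun z E hE => ?_⟩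
  have := hE []
  simpa [InTree] using this

theorem revPrefix_succ_eq_append (w : NN) (n : ℕ) :
    revPrefix w (n + 1) = revPrefix (fun m => w (m + 1)) n ++ [w 0] := by
  induction n with
  | zero => rfl
  | succ n ih => rw [revPrefix, ih]; rfl

theorem IsCoded.iUnion_compl {S : ℕ → Set IncSeq} (h : ∀ i, IsCoded (S i)) :
    IsCoded (⋃ i, (S i)ᶜ) := by
  choose ℓ hℓ hS using h
  let L : List ℕ → ℕ := fun u => match u.reverse with
    | [] => 0
    | i :: r => ℓ i r.reverse
  have hL : ∀ v i, L (v ++ [i]) = ℓ i v := by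
    intro v i
    simp [L]
  have hL0 : L [] = 0 := rfl
  have hin : ∀ v i, InTree (fun u => L u = 0) (v ++ [i]) ↔ InTree (fun u => ℓ i u = 0) v := by
    intro v i
    induction v with
    | nil => simp [InTree, hL0, ← hL [] i]
    | cons j v ih =>
      rw [List.cons_append, InTree, InTree, ih, ← List.cons_append, hL]
  refine ⟨L, fun w => ?_, fun z E hE => ?_⟩
  · obtain ⟨n, hn⟩ := hℓ (w 0) fun m => w (m + 1)
    refine ⟨n + 1, ?_⟩
    simpa only [revPrefix_succ_eq_append, hL] using hn
  · have hi : ∀ i, IsValuation (ℓ i) z.1 fun v => E (v ++ [i]) := by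
      intro i v
      refine (hE (v ++ [i])).trans ?_
      rw [hin, hL]
      rfl
    have h0 := hE []
    simp only [InTree, hL0, true_and] at h0
    rw [h0]
    simp only [Set.mem_iUnion, Set.mem_compl_iff]
    refine ⟨?_, fun h => Or.inl ?_⟩
    · rintro (⟨i, hi'⟩ | ⟨m, hm, -⟩)
      · exact ⟨i, fun hz => hi' ((hS i z _ (hi i)).2 hz)⟩
      · omega
    · obtain ⟨i, hi'⟩ := h
      exact ⟨i, fun hz => hi' ((hS i z _ (hi i)).1 hz)⟩

theorem IsCoded.compl {S : Set IncSeq} (h : IsCoded S) : IsCoded Sᶜ := by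
  have := IsCoded.iUnion_compl (S := fun _ => S) fun _ => h
  rwa [Set.iUnion_const] at this

theorem MeasurableSet.isCoded {S : Set IncSeq} (hS : MeasurableSet S) : IsCoded S := by
  let m' : MeasurableSpace IncSeq :=
    { MeasurableSet' := IsCoded
      measurableSet_empty := by
        convert isCoded_coord 1 0
        symm
        refine Set.eq_empty_iff_forall_notMem.2 fun z hz => ?_
        have h1 : z.1 0 < z.1 1 := z.2 Nat.zero_lt_one
        have h2 : z.1 1 = 0 := hz
        omega
      measurableSet_compl := fun _ h => h.compl
      measurableSet_iUnion := fun f h => by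
        have := IsCoded.iUnion_compl fun i => (h i).compl
        simpa only [compl_compl] using this }
  have hle : (Subtype.instMeasurableSpace : MeasurableSpace IncSeq) ≤ m' := by
    refine Measurable.comap_le (m₁ := m') ?_
    refine @measurable_pi_iff _ _ _ m' _ _ |>.2 fun n => ?_
    exact @measurable_to_countable' _ _ _ _ m' _ fun k => isCoded_coord n k
  exact hle S hS

instance : PolishSpace IncSeq := by
  refine IsClosed.polishSpace (s := {x : NN | StrictMono x}) ?_
  have : {x : NN | StrictMono x} = ⋂ n, {x : NN | x n < x (n + 1)} := by
    ext x
    simp only [mem_ofPred_eq, Set.mem_iInter]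
    exact ⟨fun h n => h n.lt_succ_self, strictMono_nat_of_lt_succ⟩
  rw [this]
  exact isClosed_iInter fun n => ((isLocallyConstant_apply_const continuous_id n).map₂
    (isLocallyConstant_apply_const continuous_id (n + 1)) (· < ·)).isClosed_setOf

/-- The `i`-th Borel code coded by `l`. -/
def codeAt (l : NN) (i : ℕ) (u : List ℕ) : ℕ := l (Encodable.encode (i, u) + 1)

/-- The `i`-th family of truth values coded by `e`. -/
def truthAt (e : NN) (i : ℕ) (u : List ℕ) : Prop := e (Encodable.encode (i, u)) = 0

/-- `e` codes the valuations at `z` of all the codes coded by `l`. -/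
def Evaluates (l : NN) (z : IncSeq) (e : NN) : Prop :=
  ∀ i, IsValuation (codeAt l i) z.1 (truthAt e i)

/-- `l` codes a Borel coloring of the shift graph on the section of `C` at `s`. -/
def CodesColoring (C : Set (NN × IncSeq)) (s l : NN) : Prop :=
  (∀ i, NoBranch fun u => codeAt l i u = 0) ∧
  (∀ z e, (s, z) ∈ C → Evaluates l z e → ∃ i < l 0, truthAt e i []) ∧
  ∀ z e e', (s, z) ∈ C → (s, shift z) ∈ C → Evaluates l z e → Evaluates l (shift z) e' →
    ∀ i, ¬ (truthAt e i [] ∧ truthAt e' i [])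

theorem borelColoringLE_of_codesColoring {C : Set (NN × IncSeq)} {s l : NN}
    (h : CodesColoring C s l) : BorelColoringLE {z | (s, z) ∈ C} (l 0) := by
  classical
  obtain ⟨h1, h2, h3⟩ := h
  choose E hE hEm using fun i => exists_isValuation (h1 i)
  have hex : ∀ z : IncSeq, ∃ e, Evaluates l z e ∧ ∀ i u, truthAt e i u ↔ E i z.1 u := by
    intro z
    let e : NN := fun n => match (Encodable.decode n : Option (ℕ × List ℕ)) with
      | some (i, u) => if E i z.1 u then 0 else 1
      | none => 0
    have he : ∀ i u, truthAt e i u ↔ E i z.1 u := by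
      intro i u
      simp only [truthAt, e, Encodable.encodek]
      by_cases hc : E i z.1 u <;> simp [hc]
    refine ⟨e, fun i => ?_, he⟩
    have : truthAt e i = E i z.1 := funext fun u => propext (he i u)
    rw [this]
    exact hE i z.1
  have hlt : ∀ z : IncSeq, (s, z) ∈ C →
      sInf {i | E i z.1 []} < l 0 ∧ E (sInf {i | E i z.1 []}) z.1 [] := by
    intro z hz
    obtain ⟨e, he, he'⟩ := hex z
    obtain ⟨i, hi, hi'⟩ := h2 z e hz he
    rw [he'] at hi'
    exact ⟨(Nat.sInf_le hi').trans_lt hi, Nat.sInf_mem (s := {i | E i z.1 []}) ⟨i, hi'⟩⟩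
  have hne : ∀ z, (s, z) ∈ C → (s, shift z) ∈ C →
      sInf {i | E i z.1 []} ≠ sInf {i | E i (shift z).1 []} := by
    intro z hz hz' heq
    obtain ⟨e, he, hv⟩ := hex z
    obtain ⟨e', he', hv'⟩ := hex (shift z)
    refine h3 z e e' hz hz' he he' (sInf {i | E i z.1 []}) ⟨(hv _ _).2 (hlt z hz).2, ?_⟩
    rw [heq]
    exact (hv' _ _).2 (hlt _ hz').2
  have hm : Measurable fun z : IncSeq => sInf {i | E i z.1 []} :=
    measurable_sInf_setOf fun i => measurable_subtype_coe (hEm i [])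
  refine ⟨fun z => ⟨sInf {i | E i z.1.1 []}, (hlt z.1 z.2).1⟩, ?_, ?_⟩
  · refine measurable_to_countable' fun k => ?_
    have := (hm.comp (measurable_subtype_coe (p := fun z => z ∈ {z | (s, z) ∈ C})))
      (measurableSet_singleton (k : ℕ))
    convert this using 1
    ext z
    simp [Fin.ext_iff]
  · rintro ⟨x, hx⟩ ⟨y, hy⟩ ⟨-, h | h⟩ heq
    · have h : shift x = y := h
      subst h
      exact hne x hx hy (congrArg Fin.val heq)
    · have h : shift y = x := h
      subst h
      exact hne y hy hx (congrArg Fin.val heq).symm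

theorem exists_codesColoring {C : Set (NN × IncSeq)} {s : NN} {n : ℕ}
    (h : BorelColoringLE {z | (s, z) ∈ C} n) : ∃ l, CodesColoring C s l := by
  obtain ⟨c, hc, hcol⟩ := h
  have hS : ∀ i : ℕ, ∃ S : Set IncSeq, MeasurableSet S ∧
      ∀ z : {z | (s, z) ∈ C}, z.1 ∈ S ↔ (c z : ℕ) = i := by
    intro i
    have : MeasurableSet {z | (c z : ℕ) = i} :=
      hc (MeasurableSet.of_discrete (s := {k : Fin n | (k : ℕ) = i}))
    obtain ⟨S, hS, hS'⟩ := this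
    exact ⟨S, hS, fun z => Set.ext_iff.1 hS' z⟩
  choose S hSm hS using hS
  choose ℓ hℓ hℓS using fun i => (hSm i).isCoded
  let l : NN := fun k => match k with
    | 0 => n
    | k + 1 => match (Encodable.decode k : Option (ℕ × List ℕ)) with
      | some (i, u) => ℓ i u
      | none => 0
  have hl : ∀ i, codeAt l i = ℓ i := by
    intro i
    funext u
    simp only [codeAt, l, Encodable.encodek]
  have hval : ∀ z e, Evaluates l z e → ∀ i, truthAt e i [] ↔ z ∈ S i := by
    intro z e he i
    refine hℓS i z _ ?_
    rw [← hl]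
    exact he i
  refine ⟨l, fun i => ?_, fun z e hz he => ?_, fun z e e' hz hz' he he' i hi => ?_⟩
  · rw [hl]
    exact hℓ i
  · exact ⟨c ⟨z, hz⟩, (c ⟨z, hz⟩).2, (hval z e he _).2 ((hS _ ⟨z, hz⟩).2 rfl)⟩
  · rw [hval z e he, hval _ e' he'] at hi
    refine hcol ⟨z, hz⟩ ⟨_, hz'⟩ ⟨shift_ne z, Or.inl rfl⟩ (Fin.ext ?_)
    rw [(hS i ⟨z, hz⟩).1 hi.1, (hS i ⟨_, hz'⟩).1 hi.2]

theorem measurable_evaluates {X : Type*} [MeasurableSpace X] {l e : X → NN} {z : X → IncSeq}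
    (hl : Measurable l) (he : Measurable e) (hz : Measurable z) :
    Measurable fun x => Evaluates (l x) (z x) (e x) := by
  have hcode : ∀ i u, Measurable fun x => codeAt (l x) i u := fun i u =>
    (measurable_pi_apply _).comp hl
  have heq : ∀ {f : X → ℕ} (k : ℕ), Measurable f → Measurable fun x => f x = k := fun k hf =>
    measurableSet_setOfPred.1 (hf (measurableSet_singleton k))
  have htruth : ∀ i u, Measurable fun x => truthAt (e x) i u := fun i u =>
    heq 0 ((measurable_pi_apply _).comp he)
  refine Measurable.forall fun i => Measurable.forall fun t => (htruth i t).iff ?_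
  refine Measurable.or (Measurable.and ?_ (Measurable.exists fun j => (htruth i _).not))
    (Measurable.exists fun m => (heq _ (hcode i t)).and (heq _ ?_))
  · exact measurableSet_setOfPred.1 (measurableSet_inTree
      (fun u => measurableSet_setOfPred.2 (heq 0 (hcode i u))) t)
  · exact (measurable_pi_apply _).comp (measurable_subtype_coe.comp hz)

set_option synthInstance.maxSize 1000 in
theorem isSigma12_finite_borel_chromatic {C : Set (NN × IncSeq)} (hC : MeasurableSet C) :
    IsSigma12 {s : NN | ∃ n : ℕ, BorelColoringLE {x : IncSeq | (s, x) ∈ C} n} := by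
  refine ⟨{p | CodesColoring C p.1 p.2}, ?_, ?_⟩
  · let D : Set ((NN × NN) × (NN × IncSeq × NN × NN)) := {p |
      (∃ i, ∀ n, codeAt p.1.2 i (revPrefix p.2.1 n) = 0) ∨
      ((p.1.1, p.2.2.1) ∈ C ∧ Evaluates p.1.2 p.2.2.1 p.2.2.2.1 ∧
        ¬ ∃ i < p.1.2 0, truthAt p.2.2.2.1 i []) ∨
      ((p.1.1, p.2.2.1) ∈ C ∧ (p.1.1, shift p.2.2.1) ∈ C ∧
        Evaluates p.1.2 p.2.2.1 p.2.2.2.1 ∧ Evaluates p.1.2 (shift p.2.2.1) p.2.2.2.2 ∧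
        ∃ i, truthAt p.2.2.2.1 i [] ∧ truthAt p.2.2.2.2 i [])}
    have hD : MeasurableSet D := by
      have h1 : Measurable fun p : (NN × NN) × (NN × IncSeq × NN × NN) => p.1.1 := by fun_prop
      have h2 : Measurable fun p : (NN × NN) × (NN × IncSeq × NN × NN) => p.1.2 := by fun_prop
      have h3 : Continuous fun p : (NN × NN) × (NN × IncSeq × NN × NN) => p.2.1 := by fun_prop
      have h4 : Measurable fun p : (NN × NN) × (NN × IncSeq × NN × NN) => p.2.2.1 := by fun_prop
      have h5 : Measurable fun p : (NN × NN) × (NN × IncSeq × NN × NN) => p.2.2.2.1 := by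
        fun_prop
      have h6 : Measurable fun p : (NN × NN) × (NN × IncSeq × NN × NN) => p.2.2.2.2 := by
        fun_prop
      have h4' := measurable_shift.comp h4
      have hC4 := measurableSet_setOfPred.1 ((h1.prodMk h4) hC)
      have hC4' := measurableSet_setOfPred.1 ((h1.prodMk h4') hC)
      have htruth : ∀ {e : (NN × NN) × (NN × IncSeq × NN × NN) → NN} (i : ℕ), Measurable e →
          Measurable fun p => truthAt (e p) i [] := fun i he =>
        measurableSet_setOfPred.1
          (((measurable_pi_apply _).comp he) (measurableSet_singleton (0 : ℕ)))
      refine measurableSet_setOfPred.2 (Measurable.or ?_ (Measurable.or ?_ ?_))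
      · refine Measurable.exists fun i => Measurable.forall fun n => measurableSet_setOfPred.1 ?_
        refine IsClosed.measurableSet (IsLocallyConstant.isClosed_setOf ?_)
        exact (isLocallyConstant_apply (by fun_prop) ((isLocallyConstant_revPrefix h3 n).comp
          fun u => Encodable.encode (i, u) + 1)).comp (· = 0)
      · refine hC4.and ((measurable_evaluates h2 h5 h4).and (Measurable.not ?_))
        exact Measurable.exists fun i => (measurableSet_setOfPred.1
          (measurableSet_lt measurable_const ((measurable_pi_apply 0).comp h2))).and (htruth i h5)
      · exact hC4.and (hC4'.and ((measurable_evaluates h2 h5 h4).and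
          ((measurable_evaluates h2 h6 h4').and
          (Measurable.exists fun i => (htruth i h5).and (htruth i h6)))))
    have : {p : NN × NN | CodesColoring C p.1 p.2}ᶜ = Prod.fst '' D := by
      ext ⟨s, l⟩
      simp only [mem_compl_iff, mem_ofPred_eq, CodesColoring, NoBranch, mem_image, D,
        Prod.exists, exists_and_right, exists_eq_right]
      constructor
      · intro h
        by_contra hcon
        push Not at hcon
        refine h ⟨fun i w => ?_, fun z e hz he => ?_, fun z e e' hz hz' he he' i hi => ?_⟩
        · exact (hcon w ⟨id, strictMono_id⟩ 0 0).1 i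
        · exact by_contra fun hn => by
            push Not at hn
            obtain ⟨i, hi⟩ := (hcon 0 z e 0).2.1 hz he
            exact hn i hi.1 hi.2
        · exact (hcon 0 z e e').2.2 hz hz' he he' i hi.1 hi.2
      · rintro ⟨w, z, e, e', ⟨i, hi⟩ | ⟨hz, he, hn⟩ | ⟨hz, hz', he, he', i, hi⟩⟩ ⟨h1, h2, h3⟩
        · obtain ⟨n, hn⟩ := h1 i w
          exact hn (hi n)
        · exact hn (h2 z e hz he)
        · exact h3 z e e' hz hz' he he' i hi
    rw [IsCoanalytic, this]
    exact hD.analyticSet.image_of_continuous continuous_fst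
  · ext s
    simp only [mem_ofPred_eq, mem_image, Prod.exists, exists_and_right, exists_eq_right]
    exact ⟨fun ⟨_, h⟩ => exists_codesColoring h,
      fun ⟨l, h⟩ => ⟨l 0, borelColoringLE_of_codesColoring h⟩⟩

/-- An analytic set in the plane is the set of points whose associated tree has a branch. -/
theorem exists_tree_of_analyticSet {P : Set (NN × NN)} (hP : AnalyticSet P) :
    ∃ r : List ℕ → List ℕ → List ℕ → Prop, ∀ x y, (x, y) ∈ P ↔
      ¬ NoBranch fun c => r (revPrefix x c.length) (revPrefix y c.length) c := by
  rw [AnalyticSet] at hP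
  rcases hP with rfl | ⟨g, hg, rfl⟩
  · exact ⟨fun _ _ _ => False, fun x y => by simp [NoBranch]⟩
  let r : List ℕ → List ℕ → List ℕ → Prop := fun a b c => ∃ w : NN,
    revPrefix (g w).1 c.length = a ∧ revPrefix (g w).2 c.length = b ∧ revPrefix w c.length = c
  refine ⟨r, fun x y => ?_⟩
  simp only [NoBranch, not_forall, not_exists, not_not, revPrefix_length, mem_range, r]
  constructor
  · rintro ⟨w, hw⟩
    exact ⟨w, fun n => ⟨w, by rw [hw], by rw [hw], rfl⟩⟩
  · rintro ⟨w, hw⟩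
    choose v hv1 hv2 hv3 using hw
    have hlim : ∀ {a : ℕ → NN} {b : NN}, (∀ n, revPrefix (a n) n = revPrefix b n) →
        Filter.Tendsto a Filter.atTop (nhds b) := by
      intro a b h
      refine tendsto_pi_nhds.2 fun m => tendsto_const_nhds.congr' ?_
      filter_upwards [Filter.eventually_gt_atTop m] with n hn
      exact (eq_of_revPrefix_eq (h n) m hn).symm
    have h1 := (hg.tendsto w).comp (hlim hv3)
    have h2 : Filter.Tendsto (g ∘ v) Filter.atTop (nhds (x, y)) :=
      (hlim hv1).prodMk_nhds (hlim hv2)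
    exact ⟨w, tendsto_nhds_unique h1 h2⟩

/-- Every `Σ¹₂` set is, after a Borel coding of its ambient space, defined by a tree. -/
theorem IsSigma12.exists_tree {Z : Type} [TopologicalSpace Z] [PolishSpace Z]
    [MeasurableSpace Z] [BorelSpace Z] {A : Set Z} (hA : IsSigma12 A) {φ : Z → NN}
    (hφ : Measurable φ) (hinj : Function.Injective φ) :
    ∃ r : List ℕ → List ℕ → List ℕ → Prop, ∀ z, z ∈ A ↔
      ∃ y, NoBranch fun c => r (revPrefix (φ z) c.length) (revPrefix y c.length) c := by
  obtain ⟨C, hC, rfl⟩ := hA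
  have hP : AnalyticSet (Prod.map φ id '' Cᶜ) := by
    rw [IsCoanalytic, AnalyticSet] at hC
    rcases hC with hC | ⟨g, hg, hC⟩
    · rw [hC, image_empty]
      exact analyticSet_empty
    · rw [← hC, ← range_comp, ← image_univ]
      exact MeasurableSet.univ.analyticSet_image
        ((hφ.prodMap measurable_id).comp hg.measurable)
  obtain ⟨r, hr⟩ := exists_tree_of_analyticSet hP
  refine ⟨r, fun z => ?_⟩
  have hmem : ∀ y, (φ z, y) ∈ Prod.map φ id '' Cᶜ ↔ (z, y) ∉ C := by
    intro y
    constructor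
    · rintro ⟨⟨z', y'⟩, h, heq⟩
      simp only [Prod.map_apply, id, Prod.mk.injEq] at heq
      rw [← hinj heq.1, ← heq.2]
      exact h
    · exact fun h => ⟨(z, y), h, rfl⟩
  have : ∀ y, (z, y) ∈ C ↔
      NoBranch fun c => r (revPrefix (φ z) c.length) (revPrefix y c.length) c :=
    fun y => not_iff_not.1 ((hmem y).symm.trans (hr (φ z) y))
  simp only [mem_image, Prod.exists, exists_and_right, exists_eq_right, this]

theorem exists_measurable_injective (Z : Type) [TopologicalSpace Z] [PolishSpace Z]
    [MeasurableSpace Z] [BorelSpace Z] : ∃ φ : Z → NN, Measurable φ ∧ Function.Injective φ := by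
  obtain ⟨f, hf, hinj⟩ := MeasurableSpace.measurable_injection_nat_bool_of_countablySeparated Z
  refine ⟨fun z n => (f z n).toNat, ?_, fun z z' h => hinj (funext fun n => ?_)⟩
  · exact measurable_pi_lambda _ fun n =>
      (Measurable.of_discrete (f := Bool.toNat)).comp ((measurable_pi_apply n).comp hf)
  · have hn : (f z n).toNat = (f z' n).toNat := congrFun h n
    cases hz : f z n <;> cases hz' : f z' n <;> simp_all

open Classical in
/-- The parameter whose first tree is given by `r` at `x` and whose second tree is given by
`r₀`. -/
noncomputable def treeParameter (r r₀ : List ℕ → List ℕ → List ℕ → Prop) (x : NN) : NN := fun n =>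
  match (Encodable.decode n : Option (Bool × List ℕ × List ℕ × List ℕ)) with
  | some (false, b, c, _) => if r (revPrefix x c.length) b c then 0 else 1
  | some (true, a, b, c) => if r₀ a b c then 0 else 1
  | none => 0

theorem leftTree_treeParameter (r r₀ : List ℕ → List ℕ → List ℕ → Prop) (x y : NN)
    (c : List ℕ) : leftTree (treeParameter r r₀ x) y c ↔
      r (revPrefix x c.length) (revPrefix y c.length) c := by
  simp only [leftTree, treeParameter, Encodable.encodek]
  split_ifs with h <;> simp [h]

theorem rightTree_treeParameter (r r₀ : List ℕ → List ℕ → List ℕ → Prop) (x y : NN)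
    (c : List ℕ) : rightTree (treeParameter r r₀ x) y c ↔
      r₀ (revPrefix (treeParameter r r₀ x) c.length) (revPrefix y c.length) c := by
  rw [rightTree]
  generalize revPrefix (treeParameter r r₀ x) c.length = a
  simp only [treeParameter, Encodable.encodek]
  split_ifs with h <;> simp [h]

theorem continuous_treeParameter (r r₀ : List ℕ → List ℕ → List ℕ → Prop) :
    Continuous (treeParameter r r₀) := by
  classical
  refine continuous_of_isLocallyConstant fun n => ?_
  unfold treeParameter
  rcases (Encodable.decode n : Option (Bool × List ℕ × List ℕ × List ℕ)) with
    _ | ⟨_ | _, a, b, c⟩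
  · exact IsLocallyConstant.const _
  · exact (isLocallyConstant_revPrefix continuous_id b.length).comp
      fun u => if r u a b then 0 else 1
  · exact IsLocallyConstant.const _

theorem sigma12Hard_finite_borel_chromatic :
    Sigma12Hard {s : NN | ∃ n : ℕ, BorelColoringLE {x : IncSeq | (s, x) ∈ witnessSet} n} := by
  intro Z _ _ _ _ A' hA'
  obtain ⟨φ, hφ, hinj⟩ := exists_measurable_injective Z
  obtain ⟨r, hr⟩ := hA'.exists_tree hφ hinj
  obtain ⟨r₀, hr₀⟩ := (isSigma12_finite_borel_chromatic
    isClosed_witnessSet.measurableSet).exists_tree measurable_id Function.injective_id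
  refine ⟨fun z => treeParameter r r₀ (φ z),
    (continuous_treeParameter r r₀).measurable.comp hφ, fun z => ?_⟩
  have hleft : z ∈ A' ↔ ∃ y, NoBranch (leftTree (treeParameter r r₀ (φ z)) y) := by
    rw [hr]
    simp only [NoBranch, leftTree_treeParameter]
  have hright := hr₀ (treeParameter r r₀ (φ z))
  have hR : (∃ y, NoBranch (rightTree (treeParameter r r₀ (φ z)) y)) ↔
      ∃ y, NoBranch fun c => r₀ (revPrefix (id (treeParameter r r₀ (φ z))) c.length)
        (revPrefix y c.length) c := by
    simp only [NoBranch, rightTree_treeParameter, id]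
  rw [← hR] at hright
  constructor
  · intro h
    by_contra hn
    obtain ⟨y, hy⟩ := hleft.1 h
    exact hn ⟨3, borelColoringLE_of_noBranch hy fun y' hy' => hn (hright.2 ⟨y', hy'⟩)⟩
  · intro h
    by_contra hn
    obtain ⟨y, hy⟩ := hright.1 h
    obtain ⟨k, hk⟩ := h
    exact not_borelColoringLE_of_noBranch hy (fun y' hy' => hn (hleft.2 ⟨y', hy'⟩)) k hk

/-- There exists a closed set `C ⊆ ℕ^ℕ × [ℕ]^ℕ` such that the set
`{s : χ_B(G_S|_{C_s}) < ∞}` is `Σ¹₂`-complete. -/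
theorem exists_closed_set_with_Sigma12_complete_finiteChromatic_sections :
    ∃ C : Set (NN × IncSeq), IsClosed C ∧
      Sigma12Hard {s : NN | ∃ n : ℕ, BorelColoringLE {x : IncSeq | (s, x) ∈ C} n} ∧
      IsSigma12 {s : NN | ∃ n : ℕ, BorelColoringLE {x : IncSeq | (s, x) ∈ C} n} :=
  ⟨witnessSet, isClosed_witnessSet, sigma12Hard_finite_borel_chromatic,
    isSigma12_finite_borel_chromatic isClosed_witnessSet.measurableSet⟩
end

section
/- Let B ⊆ ℕ^ℕ × [ℕ]^ℕ be a Borel set. There exist a closed set C ⊆ ℕ^ℕ × [ℕ]^ℕ and an injective, vertical-section-preserving continuous map Ψ: C → B such that for every s ∈ ℕ^ℕ the section maps Ψ_s and Ψ_s⁻¹ are shift-invariant, and if χ_B(G_S|_{B_s}) ≥ 3 then χ_B(G_S|_{B_s}) = χ_B(G_S|_{C_s}). Moreover, Ψ_s is a bijection from C_s onto B_s whenever B_s is closed under the shift map. -/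
open MeasureTheory Set

/-- The Borel chromatic number of `G_S|_B`, as an extended natural number
(`⊤` meaning no finite Borel coloring exists). -/
noncomputable def borelChrom (B : Set IncSeq) : ℕ∞ :=
  sInf {k : ℕ∞ | ∃ n : ℕ, k = n ∧ BorelColoringLE B n}

open Filter Topology

/-! ### Borel sets decided by a function with closed graph -/

/-- The set `A` is decided by the first coordinate of a function into the Baire space with
closed graph. -/
def HasClosedWitness {X : Type*} [TopologicalSpace X] (A : Set X) : Prop :=
  ∃ w : X → NN, IsClosed {p : X × NN | p.2 = w p.1} ∧ A = {z | w z 0 ≠ 0}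

section Witness

variable {X : Type*} [TopologicalSpace X]

theorem IsClopen.hasClosedWitness {A : Set X} (hA : IsClopen A) : HasClosedWitness A := by
  classical
  refine ⟨fun z _ => if z ∈ A then 1 else 0, ?_, by ext; simp⟩
  have hc : Continuous fun z => if z ∈ A then 1 else 0 :=
    continuous_const.if (by simp [hA.frontier_eq]) continuous_const
  exact isClosed_eq continuous_snd (continuous_pi fun _ => hc.comp continuous_fst)

theorem HasClosedWitness.compl {A : Set X} (hA : HasClosedWitness A) : HasClosedWitness Aᶜ := by
  obtain ⟨w, hw, rfl⟩ := hA
  refine ⟨fun z n => n.casesOn (if w z 0 = 0 then 1 else 0) (w z), ?_, by ext; simp⟩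
  have h₁ : IsClosed {p : X × NN | (fun n => p.2 (n + 1)) = w p.1} :=
    hw.preimage (f := fun p : X × NN => (p.1, fun n => p.2 (n + 1))) (by fun_prop)
  have h₂ : IsClosed {p : X × NN | p.2 0 = if p.2 1 = 0 then 1 else 0} :=
    (isClosed_discrete {q : ℕ × ℕ | q.1 = if q.2 = 0 then 1 else 0}).preimage
      (f := fun p : X × NN => (p.2 0, p.2 1)) (by fun_prop)
  convert h₁.inter h₂ using 1
  ext ⟨z, u⟩
  simp only [mem_ofPred_eq, mem_inter_iff]
  constructor
  · intro h
    exact ⟨funext fun n => by rw [h], by rw [h]; rfl⟩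
  · rintro ⟨h, h0⟩
    funext n
    cases n with
    | zero => simpa [← h] using h0
    | succ n => exact congrFun h n

theorem HasClosedWitness.iUnion {A : ℕ → Set X} (hA : ∀ n, HasClosedWitness (A n)) :
    HasClosedWitness (⋃ n, A n) := by
  classical
  choose w hw hAw using hA
  obtain rfl : A = fun n => {z | w n z 0 ≠ 0} := funext hAw
  let N : X → ℕ := fun z => if h : ∃ n, w n z 0 ≠ 0 then Nat.find h + 1 else 0
  refine ⟨fun z n => n.casesOn (N z) fun k => w k.unpair.1 z k.unpair.2, ?_, ?_⟩
  · have h₁ : IsClosed {p : X × NN | ∀ n, (fun i => p.2 (Nat.pair n i + 1)) = w n p.1} := by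
      simp only [ofPred_forall]
      exact isClosed_iInter fun n => (hw n).preimage
        (f := fun p : X × NN => (p.1, fun i => p.2 (Nat.pair n i + 1))) (by fun_prop)
    have h₂ : IsClosed {p : X × NN | ∀ n m, (p.2 0 = 0 → p.2 (Nat.pair n 0 + 1) = 0) ∧
        (p.2 0 = n + 1 → p.2 (Nat.pair n 0 + 1) ≠ 0 ∧
          (m < n → p.2 (Nat.pair m 0 + 1) = 0))} := by
      simp only [ofPred_forall]
      exact isClosed_iInter fun n => isClosed_iInter fun m =>
        (isClosed_discrete {q : ℕ × ℕ × ℕ | (q.1 = 0 → q.2.1 = 0) ∧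
          (q.1 = n + 1 → q.2.1 ≠ 0 ∧ (m < n → q.2.2 = 0))}).preimage
        (f := fun p : X × NN => (p.2 0, p.2 (Nat.pair n 0 + 1), p.2 (Nat.pair m 0 + 1)))
        (by fun_prop)
    convert h₁.inter h₂ using 1
    ext ⟨z, u⟩
    simp only [mem_ofPred_eq, mem_inter_iff]
    constructor
    · rintro rfl
      refine ⟨fun n => by simp, fun n m => ?_⟩
      simp only [Nat.unpair_pair, N]
      split_ifs with h
      · refine ⟨by simp, fun hn => ?_⟩
        obtain rfl : Nat.find h = n := by simpa using hn
        exact ⟨Nat.find_spec h, fun hm => by simpa using Nat.find_min h hm⟩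
      · push Not at h
        exact ⟨fun _ => h n, by simp⟩
    · rintro ⟨h, hu⟩
      have h' : ∀ n i, u (Nat.pair n i + 1) = w n z i := fun n => congrFun (h n)
      simp only [h'] at hu
      funext n
      cases n with
      | zero =>
        simp only [N]
        split_ifs with hz
        · cases hu0 : u 0 with
          | zero => exact absurd ((hu _ 0).1 hu0) (Nat.find_spec hz)
          | succ n =>
            congr 1
            refine ((Nat.find_eq_iff hz).2 ⟨((hu n 0).2 hu0).1, fun m hm => ?_⟩).symm
            simpa using ((hu n m).2 hu0).2 hm
        · push Not at hz
          cases hu0 : u 0 with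
          | zero => rfl
          | succ n => exact absurd (hz n) ((hu n 0).2 hu0).1
      | succ k =>
        have := h' k.unpair.1 k.unpair.2
        rwa [Nat.pair_unpair] at this
  · ext z
    simp only [mem_iUnion, mem_ofPred_eq, N]
    split_ifs with h
    · simpa using h
    · simpa using h

/-- The sets decided by a function with closed graph form a σ-algebra. -/
@[reducible] def closedWitnessSpace (X : Type*) [TopologicalSpace X] : MeasurableSpace X where
  MeasurableSet' := HasClosedWitness
  measurableSet_empty := isClopen_empty.hasClosedWitness
  measurableSet_compl _ := HasClosedWitness.compl
  measurableSet_iUnion _ := HasClosedWitness.iUnion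

end Witness

theorem MeasurableSet.hasClosedWitness {B : Set (NN × IncSeq)} (hB : MeasurableSet B) :
    HasClosedWitness B := by
  have key : ∀ g : NN × IncSeq → ℕ, Continuous g → Measurable[closedWitnessSpace _] g :=
    fun g hg t _ => ((isClopen_discrete t).preimage hg).hasClosedWitness
  have hid : Measurable[closedWitnessSpace _] fun z : NN × IncSeq => (z.1, z.2) := by
    refine Measurable.prodMk (f := fun z : NN × IncSeq => z.1) (g := fun z => z.2) ?_ ?_
    · exact @measurable_pi_lambda _ _ _ (closedWitnessSpace (NN × IncSeq)) _ _
        fun n => key _ (by fun_prop)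
    · refine @Measurable.subtype_mk _ _ (closedWitnessSpace (NN × IncSeq)) _ _
        (fun z : NN × IncSeq => z.2.1) ?_ _
      exact @measurable_pi_lambda _ _ _ (closedWitnessSpace (NN × IncSeq)) _ _
        fun n => key (fun z : NN × IncSeq => z.2.1 n)
          ((continuous_apply n).comp (continuous_subtype_val.comp continuous_snd))
  exact hid hB

/-! ### Coding finite sequences -/

/-- A code for the first `k` values of `u`. -/
def seqCode (u : NN) : ℕ → ℕ
  | 0 => 0
  | k + 1 => Nat.pair (seqCode u k) (u k) + 1

theorem seqCode_inj {u v : NN} {k l : ℕ} (h : seqCode u k = seqCode v l) :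
    k = l ∧ ∀ i < k, u i = v i := by
  induction k generalizing l with
  | zero => cases l <;> simp_all [seqCode]
  | succ k ih =>
    cases l with
    | zero => simp [seqCode] at h
    | succ l =>
      simp only [seqCode, Nat.add_right_cancel_iff, Nat.pair_eq_pair] at h
      obtain ⟨rfl, hi⟩ := ih h.1
      refine ⟨rfl, fun i hik => ?_⟩
      rcases Nat.lt_succ_iff_lt_or_eq.1 hik with hik | rfl
      exacts [hi i hik, h.2]

theorem seqCode_congr {u v : NN} {k : ℕ} (h : ∀ i < k, u i = v i) :
    seqCode u k = seqCode v k := by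
  induction k with
  | zero => rfl
  | succ k ih => simp [seqCode, ih fun i hi => h i (hi.trans k.lt_succ_self), h k k.lt_succ_self]

theorem pair_le_pair {a b c d : ℕ} (h₁ : a ≤ c) (h₂ : b ≤ d) : Nat.pair a b ≤ Nat.pair c d := by
  have ha : StrictMono fun a => Nat.pair a b := fun _ _ h => Nat.pair_lt_pair_left b h
  have hb : StrictMono fun b => Nat.pair c b := fun _ _ h => Nat.pair_lt_pair_right c h
  exact (ha.monotone h₁).trans (hb.monotone h₂)

theorem seqCode_mono_left {u v : NN} {k : ℕ} (h : ∀ i, u i ≤ v i) :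
    seqCode u k ≤ seqCode v k := by
  induction k with
  | zero => rfl
  | succ k ih => exact Nat.succ_le_succ (pair_le_pair ih (h k))

theorem seqCode_mono (u : NN) : Monotone (seqCode u) :=
  monotone_nat_of_le_succ fun _ => (Nat.left_le_pair _ _).trans (Nat.le_succ _)

theorem lt_seqCode (u : NN) {i k : ℕ} (h : i < k) : u i < seqCode u k :=
  (Nat.lt_succ_of_le (Nat.right_le_pair _ _)).trans_le (seqCode_mono u h)

/-! ### Adding a new least element -/

/-- The set `{m} ∪ x` if `m` is smaller than every element of `x`, and `x` otherwise. -/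
def IncSeq.cons (m : ℕ) (x : IncSeq) : IncSeq :=
  if h : m < x.1 0 then
    ⟨fun n => n.casesOn m x.1, strictMono_nat_of_lt_succ fun n => by
      cases n with
      | zero => exact h
      | succ n => exact x.2 n.lt_succ_self⟩
  else x

theorem IncSeq.cons_zero {m : ℕ} {x : IncSeq} (h : m < x.1 0) : (cons m x).1 0 = m := by
  simp [cons, h]

theorem IncSeq.cons_succ {m : ℕ} {x : IncSeq} (h : m < x.1 0) (n : ℕ) :
    (cons m x).1 (n + 1) = x.1 n := by
  simp [cons, h]

theorem IncSeq.cons_shift (x : IncSeq) : cons (x.1 0) (shift x) = x := by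
  have h : x.1 0 < (shift x).1 0 := x.2 Nat.zero_lt_one
  ext n
  cases n with
  | zero => exact cons_zero h
  | succ n => exact cons_succ h n

theorem shift_iterate_apply (n : ℕ) (x : IncSeq) (j : ℕ) : (shift^[n] x).1 j = x.1 (j + n) := by
  induction n generalizing x with
  | zero => rfl
  | succ n ih => rw [Function.iterate_succ_apply, ih]; rfl

theorem continuous_shift : Continuous shift :=
  Continuous.subtype_mk
    (continuous_pi fun n => (continuous_apply (n + 1)).comp continuous_subtype_val :
      Continuous fun x : IncSeq => fun n => x.1 (n + 1)) _

theorem tendsto_incSeq_iff {ι : Type*} {l : Filter ι} {x : ι → IncSeq} {a : IncSeq} :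
    Tendsto x l (𝓝 a) ↔ ∀ n, ∀ᶠ i in l, (x i).1 n = a.1 n := by
  rw [tendsto_subtype_rng, tendsto_pi_nhds]
  simp [nhds_discrete, tendsto_pure]

theorem tendsto_cons {ι : Type*} {l : Filter ι} {x : ι → IncSeq} {a : IncSeq} (m : ℕ)
    (h : Tendsto x l (𝓝 a)) : Tendsto (fun i => IncSeq.cons m (x i)) l (𝓝 (IncSeq.cons m a)) := by
  rw [tendsto_incSeq_iff] at h ⊢
  intro n
  by_cases hm : m < a.1 0
  · cases n with
    | zero =>
      filter_upwards [h 0] with i hi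
      rw [IncSeq.cons_zero hm, IncSeq.cons_zero (hi ▸ hm)]
    | succ n =>
      filter_upwards [h 0, h n] with i hi hn
      rw [IncSeq.cons_succ hm, IncSeq.cons_succ (hi ▸ hm), hn]
  · filter_upwards [h 0, h n] with i hi hn
    simp [IncSeq.cons, hm, hi, hn]

theorem isClosed_strictMono : IsClosed {x : NN | StrictMono x} := by
  have : {x : NN | StrictMono x} = ⋂ n, {x : NN | x n < x (n + 1)} := by
    ext x
    simpa using ⟨fun h n => h n.lt_succ_self, strictMono_nat_of_lt_succ⟩
  rw [this]
  exact isClosed_iInter fun n => (isClosed_discrete {q : ℕ × ℕ | q.1 < q.2}).preimage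
    (f := fun x : NN => (x n, x (n + 1))) (by fun_prop)

instance inst_s8 : PolishSpace IncSeq := isClosed_strictMono.polishSpace

/-! ### Coding a point together with its finitely many predecessors -/

/-- A code for the first `k` values of `w` at `(s, x)` and at all `(s, y)` such that `x` is an
iterated shift of `y`. -/
def histCode (w : NN × IncSeq → NN) (k : ℕ) (s : NN) (x : IncSeq) : ℕ :=
  Nat.pair (seqCode (w (s, x)) k)
    (seqCode (fun m => if _h : m < x.1 0 then histCode w k s (IncSeq.cons m x) else 0) (x.1 0))
termination_by x.1 0
decreasing_by simpa [IncSeq.cons_zero _h] using _h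

section HistCode

variable {w : NN × IncSeq → NN}

theorem histCode_inj {k k' : ℕ} {s s' : NN} {x x' : IncSeq}
    (h : histCode w k s x = histCode w k' s' x') :
    k = k' ∧ (∀ i < k, w (s, x) i = w (s', x') i) ∧ x.1 0 = x'.1 0 ∧
      ∀ m < x.1 0, histCode w k s (IncSeq.cons m x) = histCode w k' s' (IncSeq.cons m x') := by
  rw [histCode, histCode, Nat.pair_eq_pair] at h
  obtain ⟨hk, hw⟩ := seqCode_inj h.1
  obtain ⟨hx, hc⟩ := seqCode_inj h.2
  refine ⟨hk, hw, hx, fun m hm => ?_⟩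
  simpa [hm, hx ▸ hm] using hc m hm

theorem histCode_congr {k : ℕ} {s s' : NN} {x x' : IncSeq}
    (hw : ∀ i < k, w (s, x) i = w (s', x') i) (hx : x.1 0 = x'.1 0)
    (hc : ∀ m < x.1 0, histCode w k s (IncSeq.cons m x) = histCode w k s' (IncSeq.cons m x')) :
    histCode w k s x = histCode w k s' x' := by
  rw [histCode, histCode, seqCode_congr hw, ← hx]
  congr 1
  refine seqCode_congr fun m hm => ?_
  simpa [hm, hx ▸ hm] using hc m hm

theorem histCode_restrict {k l : ℕ} (hkl : k ≤ l) {s s' : NN} {x x' : IncSeq}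
    (h : histCode w l s x = histCode w l s' x') : histCode w k s x = histCode w k s' x' := by
  induction hn : x.1 0 using Nat.strong_induction_on generalizing x x' with
  | _ n ih =>
    obtain ⟨-, hw, hx, hc⟩ := histCode_inj h
    refine histCode_congr (fun i hi => hw i (hi.trans_le hkl)) hx fun m hm => ?_
    exact ih m (hn ▸ hm) (hc m hm) (IncSeq.cons_zero hm)

theorem histCode_mono {k l : ℕ} (hkl : k ≤ l) (s : NN) (x : IncSeq) :
    histCode w k s x ≤ histCode w l s x := by
  induction hn : x.1 0 using Nat.strong_induction_on generalizing x with
  | _ n ih =>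
    rw [histCode, histCode]
    refine pair_le_pair (seqCode_mono _ hkl) (seqCode_mono_left fun m => ?_)
    split_ifs with hm
    · exact ih m (hn ▸ hm) _ (IncSeq.cons_zero hm)
    · rfl

theorem histCode_cons_lt (k : ℕ) (s : NN) {x : IncSeq} {m : ℕ} (hm : m < x.1 0) :
    histCode w k s (IncSeq.cons m x) < histCode w k s x := by
  rw [histCode.eq_def w k s x]
  refine lt_of_lt_of_le ?_ (Nat.right_le_pair _ _)
  simpa [hm] using lt_seqCode
    (fun m => if _h : m < x.1 0 then histCode w k s (IncSeq.cons m x) else 0) hm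

theorem histCode_lt_shift (s : NN) (x : IncSeq) :
    histCode w (x.1 0) s x < histCode w ((shift x).1 0) s (shift x) := by
  have h : x.1 0 < (shift x).1 0 := x.2 Nat.zero_lt_one
  have := histCode_cons_lt (w := w) ((shift x).1 0) s h
  rw [IncSeq.cons_shift] at this
  exact (histCode_mono h.le s x).trans_lt this

theorem tendsto_witness (hw : IsClosed {p : (NN × IncSeq) × NN | p.2 = w p.1})
    {s : ℕ → NN} {x : ℕ → IncSeq} {t : NN} {a : IncSeq}
    (hs : Tendsto s atTop (𝓝 t)) (hx : Tendsto x atTop (𝓝 a))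
    (hE : ∀ k, ∃ c, ∀ᶠ i in atTop, histCode w k (s i) (x i) = c) (n : ℕ) :
    ∀ᶠ i in atTop, w (s i, x i) n = w (t, a) n := by
  have hu : ∀ n, ∃ c, ∀ᶠ i in atTop, w (s i, x i) n = c := fun n => by
    obtain ⟨c, hc⟩ := hE (n + 1)
    obtain ⟨j, hj⟩ := hc.exists
    refine ⟨w (s j, x j) n, hc.mono fun i hi => ?_⟩
    exact (histCode_inj (hi.trans hj.symm)).2.1 n n.lt_succ_self
  choose u hu using hu
  have hlim : Tendsto (fun i => w (s i, x i)) atTop (𝓝 u) := by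
    rw [tendsto_pi_nhds]
    simpa [nhds_discrete, tendsto_pure] using hu
  have : u = w (t, a) := hw.mem_of_tendsto ((hs.prodMk_nhds hx).prodMk_nhds hlim)
    (Eventually.of_forall fun i => rfl)
  exact this ▸ hu n

theorem tendsto_histCode (hw : IsClosed {p : (NN × IncSeq) × NN | p.2 = w p.1})
    {s : ℕ → NN} {x : ℕ → IncSeq} {t : NN} {a : IncSeq}
    (hs : Tendsto s atTop (𝓝 t)) (hx : Tendsto x atTop (𝓝 a))
    (hE : ∀ k, ∃ c, ∀ᶠ i in atTop, histCode w k (s i) (x i) = c) (k : ℕ) :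
    ∀ᶠ i in atTop, histCode w k (s i) (x i) = histCode w k t a := by
  induction hn : a.1 0 using Nat.strong_induction_on generalizing x a with
  | _ n ih =>
    have hx0 := tendsto_incSeq_iff.1 hx 0
    have h₁ : ∀ᶠ i in atTop, ∀ j < k, w (s i, x i) j = w (t, a) j :=
      (eventually_all_finset (Finset.range k)).2 (fun j _ => tendsto_witness hw hs hx hE j)
        |>.mono fun i hi j hj => hi j (Finset.mem_range.2 hj)
    have h₂ : ∀ᶠ i in atTop, ∀ m < a.1 0, histCode w k (s i) (IncSeq.cons m (x i)) =
        histCode w k t (IncSeq.cons m a) := by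
      refine ((eventually_all_finset (Finset.range (a.1 0))).2 fun m hm => ?_).mono
        fun i hi j hj => hi j (Finset.mem_range.2 hj)
      have hm : m < a.1 0 := Finset.mem_range.1 hm
      refine ih m (hn ▸ hm) (tendsto_cons m hx) (fun l => ?_) (IncSeq.cons_zero hm)
      obtain ⟨c, hc⟩ := hE l
      obtain ⟨j, hj, hj0⟩ := (hc.and hx0).exists
      refine ⟨histCode w l (s j) (IncSeq.cons m (x j)), (hc.and hx0).mono fun i hi => ?_⟩
      exact (histCode_inj (hi.1.trans hj.symm)).2.2.2 m (hi.2 ▸ hm)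
    filter_upwards [hx0, h₁, h₂] with i h0 h1 h2
    exact histCode_congr h1 h0 fun m hm => h2 m (h0 ▸ hm)

/-- The sequence of codes along the forward orbit of `x`. -/
def orbitCode (w : NN × IncSeq → NN) (s : NN) (x : IncSeq) : IncSeq :=
  ⟨fun n => histCode w ((shift^[n] x).1 0) s (shift^[n] x), strictMono_nat_of_lt_succ fun n => by
    rw [Function.iterate_succ_apply']
    exact histCode_lt_shift s _⟩

theorem orbitCode_shift (s : NN) (x : IncSeq) :
    orbitCode w s (shift x) = shift (orbitCode w s x) := rfl

theorem exists_orbitCode_decode (w : NN × IncSeq → NN) :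
    ∃ d : ℕ → ℕ, ∀ s x n, d ((orbitCode w s x).1 n) = x.1 n := by
  have hf : Function.FactorsThrough (fun p : NN × IncSeq => p.2.1 0)
      (fun p : NN × IncSeq => histCode w (p.2.1 0) p.1 p.2) :=
    fun _ _ h => (histCode_inj h).1
  refine ⟨Function.extend (fun p : NN × IncSeq => histCode w (p.2.1 0) p.1 p.2)
    (fun p => p.2.1 0) 0, fun s x n => ?_⟩
  have := hf.extend_apply 0 (s, shift^[n] x)
  simpa only [shift_iterate_apply, zero_add, orbitCode] using this

theorem exists_of_tendsto_orbitCode (hw : IsClosed {p : (NN × IncSeq) × NN | p.2 = w p.1})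
    {s : ℕ → NN} {x : ℕ → IncSeq} {t : NN} {y : IncSeq}
    (hs : Tendsto s atTop (𝓝 t))
    (hy : Tendsto (fun i => orbitCode w (s i) (x i)) atTop (𝓝 y)) :
    ∃ a, orbitCode w t a = y ∧ ∀ n, ∀ᶠ i in atTop, w (s i, x i) n = w (t, a) n := by
  obtain ⟨d, hd⟩ := exists_orbitCode_decode w
  rw [tendsto_incSeq_iff] at hy
  have hx : ∀ n, ∀ᶠ i in atTop, (x i).1 n = d (y.1 n) := fun n =>
    (hy n).mono fun i hi => by rw [← hi, hd]
  have ha : StrictMono fun n => d (y.1 n) := strictMono_nat_of_lt_succ fun n => by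
    obtain ⟨i, h₁, h₂⟩ := ((hx n).and (hx (n + 1))).exists
    rw [← h₁, ← h₂]
    exact (x i).2 n.lt_succ_self
  let a : IncSeq := ⟨_, ha⟩
  have hxa : Tendsto x atTop (𝓝 a) := tendsto_incSeq_iff.2 hx
  have hiter : ∀ n, Tendsto (fun i => shift^[n] (x i)) atTop (𝓝 (shift^[n] a)) := fun n =>
    ((continuous_shift.iterate n).tendsto a).comp hxa
  have hE' : ∀ j n, ∃ c, ∀ᶠ i in atTop,
      histCode w (a.1 (n + j)) (s i) (shift^[n] (x i)) = c := by
    intro j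
    induction j with
    | zero =>
      refine fun n => ⟨y.1 n, ((hx n).and (hy n)).mono fun i hi => ?_⟩
      rw [← hi.2]
      change _ = histCode w ((shift^[n] (x i)).1 0) (s i) (shift^[n] (x i))
      rw [shift_iterate_apply, zero_add, hi.1, add_zero]
    | succ j ih =>
      intro n
      obtain ⟨c, hc⟩ := ih (n + 1)
      obtain ⟨i₀, hi₀, hx₀⟩ := (hc.and (hx n)).exists
      have hcons : ∀ i, (x i).1 n = d (y.1 n) →
          IncSeq.cons (d (y.1 n)) (shift^[n + 1] (x i)) = shift^[n] (x i) := fun i hi => by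
        have := IncSeq.cons_shift (shift^[n] (x i))
        rwa [shift_iterate_apply, zero_add, hi, ← Function.iterate_succ_apply' shift] at this
      refine ⟨histCode w (a.1 (n + (j + 1))) (s i₀) (shift^[n] (x i₀)),
        (hc.and (hx n)).mono fun i hi => ?_⟩
      have hlt : d (y.1 n) < (shift^[n + 1] (x i)).1 0 := by
        rw [shift_iterate_apply, zero_add, ← hi.2]
        exact (x i).2 n.lt_succ_self
      have := (histCode_inj (hi.1.trans hi₀.symm)).2.2.2 _ hlt
      rwa [hcons i hi.2, hcons i₀ hx₀, show n + 1 + j = n + (j + 1) by omega] at this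
  have hE : ∀ n k, ∃ c, ∀ᶠ i in atTop, histCode w k (s i) (shift^[n] (x i)) = c := by
    intro n k
    obtain ⟨c, hc⟩ := hE' k n
    obtain ⟨i₀, hi₀⟩ := hc.exists
    have hk : k ≤ a.1 (n + k) := (Nat.le_add_left k n).trans (a.2.le_apply)
    exact ⟨histCode w k (s i₀) (shift^[n] (x i₀)), hc.mono fun i hi =>
      histCode_restrict hk (hi.trans hi₀.symm)⟩
  refine ⟨a, ?_, tendsto_witness hw hs hxa (hE 0)⟩
  ext n
  obtain ⟨i, h₁, h₂, h₃⟩ := ((tendsto_histCode hw hs (hiter n) (hE n) (a.1 n)).and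
    ((hx n).and (hy n))).exists
  rw [← h₃]
  change histCode w ((shift^[n] a).1 0) t (shift^[n] a) =
    histCode w ((shift^[n] (x i)).1 0) (s i) (shift^[n] (x i))
  rw [shift_iterate_apply, shift_iterate_apply, zero_add, h₂, ← h₁]

end HistCode

/-! ### Transfer of Borel colorings -/

theorem shiftEdge_image {x y : IncSeq} {f : IncSeq → IncSeq} {C : Set IncSeq}
    (hf : InjOn f C) (hS : ∀ x ∈ C, f (shift x) = shift (f x)) (hx : x ∈ C) (hy : y ∈ C)
    (h : shiftEdge x y) : shiftEdge (f x) (f y) := by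
  refine ⟨fun e => h.1 (hf hx hy e), ?_⟩
  rcases h.2 with rfl | rfl
  exacts [Or.inl (hS x hx).symm, Or.inr (hS y hy).symm]

/-- The largest shift-closed subset of `B`. -/
def shiftCore (B : Set IncSeq) : Set IncSeq := {x | ∀ n, shift^[n] x ∈ B}

theorem shift_mem_shiftCore {B : Set IncSeq} {x : IncSeq} (hx : x ∈ shiftCore B) :
    shift x ∈ shiftCore B := fun n => hx (n + 1)

theorem mem_shiftCore_of_shift {B : Set IncSeq} {x : IncSeq} (hx : x ∈ B)
    (hS : shift x ∈ shiftCore B) : x ∈ shiftCore B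
  | 0 => hx
  | n + 1 => hS n

theorem measurableSet_shiftCore {B : Set IncSeq} (hB : MeasurableSet B) :
    MeasurableSet (shiftCore B) := by
  simp only [shiftCore, ofPred_forall]
  exact MeasurableSet.iInter fun n => (continuous_shift.iterate n).measurable hB

theorem shiftEdge_of_shift_eq {x y : IncSeq} (h : shift x = y) : shiftEdge x y := by
  refine ⟨?_, Or.inl h⟩
  rintro rfl
  have : x.1 0 < (shift x).1 0 := x.2 Nat.zero_lt_one
  exact this.ne (by rw [h])

/-- A measurable function coloring the shift-closed core of `B` can be modified outside of the
core to a Borel coloring of `B`. -/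
theorem borelColoringLE_of_shiftCore {B : Set IncSeq} (hB : MeasurableSet B) {n : ℕ} (hn : 2 ≤ n)
    {g : IncSeq → Fin n} (hg : Measurable g)
    (hcol : ∀ x ∈ shiftCore B, g x ≠ g (shift x)) : BorelColoringLE B n := by
  classical
  have hp : ∀ x : IncSeq, ∃ k, shift^[k] x ∉ B ∨ x ∈ shiftCore B := fun x => by
    by_cases hx : x ∈ shiftCore B
    · exact ⟨0, Or.inr hx⟩
    · obtain ⟨k, hk⟩ := not_forall.1 hx
      exact ⟨k, Or.inl hk⟩
  have hN : Measurable fun x => Nat.find (hp x) :=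
    measurable_find hp fun k => by
      exact ((continuous_shift.iterate k).measurable hB).compl.union (measurableSet_shiftCore hB)
  let col : ℕ → Fin n := fun k => ⟨k % 2, (Nat.mod_lt k two_pos).trans_le hn⟩
  let c : IncSeq → Fin n := fun x => if x ∈ shiftCore B then g x else col (Nat.find (hp x))
  have hc : Measurable c :=
    Measurable.ite (measurableSet_shiftCore hB) hg ((measurable_of_countable col).comp hN)
  have key : ∀ x ∈ B, c x ≠ c (shift x) := by
    intro x hx
    by_cases hxc : x ∈ shiftCore B
    · simpa [c, hxc, shift_mem_shiftCore hxc] using hcol x hxc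
    · have hSc : shift x ∉ shiftCore B := fun h => hxc (mem_shiftCore_of_shift hx h)
      have hfind : Nat.find (hp x) = Nat.find (hp (shift x)) + 1 := by
        rw [Nat.find_eq_iff]
        refine ⟨Or.inl ((Nat.find_spec (hp (shift x))).resolve_right hSc), fun m hm => ?_⟩
        cases m with
        | zero => simpa [hxc] using hx
        | succ m =>
          have := Nat.find_min (hp (shift x)) (Nat.lt_of_succ_lt_succ hm)
          simpa [hxc, hSc] using this
      have h₁ : c x = col (Nat.find (hp x)) := if_neg hxc
      have h₂ : c (shift x) = col (Nat.find (hp (shift x))) := if_neg hSc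
      rw [h₁, h₂, hfind]
      simp only [col, ne_eq, Fin.mk.injEq]
      omega
  refine ⟨fun x => c x, hc.comp measurable_subtype_coe, fun x y h => ?_⟩
  rcases h.2 with h | h
  · have := key x x.2
    rwa [h] at this
  · have := key y y.2
    rw [h] at this
    exact this.symm

theorem BorelColoringLE.comap {B C : Set IncSeq} {f : IncSeq → IncSeq} {n : ℕ}
    (h : BorelColoringLE B n) (hf : ContinuousOn f C) (hinj : InjOn f C) (hmap : MapsTo f C B)
    (hS : ∀ x ∈ C, f (shift x) = shift (f x)) : BorelColoringLE C n := by
  obtain ⟨c, hc, hcol⟩ := h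
  refine ⟨fun x => c (hmap.restrict f C B x), hc.comp (hf.mapsToRestrict hmap).measurable,
    fun x y hxy => hcol _ _ (shiftEdge_image hinj hS x.2 y.2 hxy)⟩

theorem BorelColoringLE.of_lift {B C : Set IncSeq} (hB : MeasurableSet B) (hC : IsClosed C)
    {f : IncSeq → IncSeq} {n : ℕ} (h : BorelColoringLE C n) (hf : ContinuousOn f C)
    (hbij : BijOn f C (shiftCore B)) (hCS : ∀ x ∈ C, shift x ∈ C)
    (hS : ∀ x ∈ C, f (shift x) = shift (f x)) : BorelColoringLE B (max n 2) := by
  obtain ⟨c, hc, hcol⟩ := h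
  have : PolishSpace C := hC.polishSpace
  have : Nonempty (Fin (max n 2)) := ⟨⟨0, by simp⟩⟩
  have hemb : MeasurableEmbedding (C.domRestrict f) :=
    hf.domRestrict.measurableEmbedding (injOn_iff_injective.1 hbij.injOn)
  obtain ⟨g, hg, hgc⟩ := hemb.exists_measurable_extend
    ((measurable_of_countable (Fin.castLE (le_max_left n 2))).comp hc) fun _ => inferInstance
  refine borelColoringLE_of_shiftCore hB (le_max_right n 2) hg fun x hx => ?_
  obtain ⟨y, hy, rfl⟩ := hbij.surjOn hx
  rw [← hS y hy]
  have h₁ := congrFun hgc ⟨y, hy⟩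
  have h₂ := congrFun hgc ⟨shift y, hCS y hy⟩
  simp only [Function.comp_apply, domRestrict_apply] at h₁ h₂
  rw [h₁, h₂, ne_eq, Fin.castLE_inj]
  exact hcol _ _ (shiftEdge_of_shift_eq rfl)

/-- A lift of the shift-closed core of a set which is not Borel 2-colorable has the same Borel
chromatic number as this set. -/
theorem borelChrom_eq_of_lift {B C : Set IncSeq} (hB : MeasurableSet B) (hC : IsClosed C)
    {f : IncSeq → IncSeq} (hf : ContinuousOn f C) (hbij : BijOn f C (shiftCore B))
    (hCS : ∀ x ∈ C, shift x ∈ C) (hS : ∀ x ∈ C, f (shift x) = shift (f x))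
    (h2 : ¬ BorelColoringLE B 2) : borelChrom B = borelChrom C := by
  have h : ∀ n, BorelColoringLE B n ↔ BorelColoringLE C n := fun n => by
    refine ⟨fun h => h.comap hf hbij.injOn (fun x hx => hbij.mapsTo hx 0) hS, fun h => ?_⟩
    have h' := h.of_lift hB hC hf hbij hCS hS
    rcases le_total n 2 with hn | hn
    · exact absurd (max_eq_right hn ▸ h') h2
    · exact max_eq_left hn ▸ h'
  simp only [borelChrom, h]

/-- For every Borel `B ⊆ ℕ^ℕ × [ℕ]^ℕ` there are a closed set `C ⊆ ℕ^ℕ × [ℕ]^ℕ` and an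
injective, vertical-section-preserving continuous map `Ψ : C → B` such that each section
map `Ψ_s` and its inverse are shift-invariant, `χ_B(G_S|_{B_s}) ≥ 3` implies
`χ_B(G_S|_{B_s}) = χ_B(G_S|_{C_s})`, and `Ψ_s` is a bijection from `C_s` onto `B_s`
whenever `B_s` is closed under the shift. -/
theorem sectionwise_closed_lift (B : Set (NN × IncSeq)) (hB : MeasurableSet B) :
    ∃ (C : Set (NN × IncSeq)) (Ψ : NN × IncSeq → NN × IncSeq),
      IsClosed C ∧
      ContinuousOn Ψ C ∧
      Set.InjOn Ψ C ∧
      Set.MapsTo Ψ C B ∧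
      (∀ p ∈ C, (Ψ p).1 = p.1) ∧
      (∀ s : NN, ∀ x : IncSeq, (s, x) ∈ C → (s, shift x) ∈ C) ∧
      (∀ s : NN, ∀ x : IncSeq, (s, x) ∈ C → (Ψ (s, shift x)).2 = shift ((Ψ (s, x)).2)) ∧
      (∀ s : NN, ∀ x y : IncSeq, (s, x) ∈ C → (s, y) ∈ C →
        (Ψ (s, y)).2 = shift ((Ψ (s, x)).2) → y = shift x) ∧
      (∀ s : NN, ¬ BorelColoringLE {x : IncSeq | (s, x) ∈ B} 2 →
        borelChrom {x : IncSeq | (s, x) ∈ B} = borelChrom {x : IncSeq | (s, x) ∈ C}) ∧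
      (∀ s : NN, (∀ x : IncSeq, (s, x) ∈ B → (s, shift x) ∈ B) →
        Set.BijOn (fun x : IncSeq => (Ψ (s, x)).2)
          {x : IncSeq | (s, x) ∈ C} {x : IncSeq | (s, x) ∈ B}) := by
  classical
  let B' : Set (NN × IncSeq) := {p | p.2 ∈ shiftCore {x | (p.1, x) ∈ B}}
  have hB' : MeasurableSet B' := by
    have : B' = ⋂ n, {p | (p.1, shift^[n] p.2) ∈ B} := by
      ext p
      simp [B', shiftCore]
    rw [this]
    exact MeasurableSet.iInter fun n =>
      (continuous_fst.prodMk ((continuous_shift.iterate n).comp continuous_snd)).measurable hB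
  obtain ⟨w, hw, hwB⟩ := hB'.hasClosedWitness
  obtain ⟨d, hd⟩ := exists_orbitCode_decode w
  let Φ : NN × IncSeq → NN × IncSeq := fun p => (p.1, orbitCode w p.1 p.2)
  let Ψ : NN × IncSeq → NN × IncSeq := fun p =>
    (p.1, if h : StrictMono fun n => d (p.2.1 n) then ⟨_, h⟩ else p.2)
  have hdΦ : ∀ s x, (fun n => d ((orbitCode w s x).1 n)) = x.1 := fun s x => funext (hd s x)
  have hΨΦ : ∀ s x, Ψ (s, orbitCode w s x) = (s, x) := fun s x => by
    have h : StrictMono fun n => d ((orbitCode w s x).1 n) := (hdΦ s x).symm ▸ x.2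
    simp only [Ψ, dif_pos h, Prod.mk.injEq, true_and]
    exact Subtype.ext (hdΦ s x)
  let C : Set (NN × IncSeq) := Φ '' B'
  have hmem : ∀ s y, (s, y) ∈ C → ∃ x, (s, x) ∈ B' ∧ orbitCode w s x = y := by
    rintro s y ⟨⟨s', x⟩, hx, h⟩
    obtain ⟨rfl, rfl⟩ := Prod.mk.inj h
    exact ⟨x, hx, rfl⟩
  have hclosed : IsClosed C := by
    refine IsSeqClosed.isClosed fun p ⟨t, y⟩ hp hlim => ?_
    choose z hz hzp using hp
    have hs : Tendsto (fun i => (z i).1) atTop (𝓝 t) := by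
      convert (continuous_fst.tendsto _).comp hlim using 1
      exact funext fun i => (congrArg Prod.fst (hzp i) :)
    have hy : Tendsto (fun i => orbitCode w (z i).1 (z i).2) atTop (𝓝 y) := by
      convert (continuous_snd.tendsto _).comp hlim using 1
      exact funext fun i => (congrArg Prod.snd (hzp i) :)
    obtain ⟨a, rfl, ha⟩ := exists_of_tendsto_orbitCode hw hs hy
    refine ⟨(t, a), ?_, rfl⟩
    obtain ⟨i, hi⟩ := (ha 0).exists
    have hzi := hz i
    rw [hwB] at hzi ⊢
    exact fun h => hzi (hi.trans h)
  have hcont : ContinuousOn Ψ C := by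
    refine continuousOn_fst.prodMk (continuousOn_iff_continuous_domRestrict.2 ?_)
    rw [continuous_induced_rng]
    have : Continuous fun p : C => fun n => d (p.1.2.1 n) := by
      have hdc : Continuous d := continuous_of_discreteTopology
      exact continuous_pi fun n => hdc.comp ((continuous_apply n).comp
        (continuous_subtype_val.comp (continuous_snd.comp continuous_subtype_val)))
    convert this using 1
    funext ⟨⟨s, y⟩, hy⟩
    obtain ⟨x, -, rfl⟩ := hmem s y hy
    have h : StrictMono fun n => d ((orbitCode w s x).1 n) := (hdΦ s x).symm ▸ x.2
    simp [dif_pos h]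
  have hinj : InjOn Ψ C := by
    rintro _ ⟨⟨s, x⟩, -, rfl⟩ _ ⟨⟨s', x'⟩, -, rfl⟩ h
    simp only [Φ, hΨΦ] at h
    rw [h]
  have hCS : ∀ s x, (s, x) ∈ C → (s, shift x) ∈ C := by
    intro s y hy
    obtain ⟨x, hx, rfl⟩ := hmem s y hy
    exact ⟨(s, shift x), shift_mem_shiftCore hx, rfl⟩
  have hΨS : ∀ s x, (s, x) ∈ C → (Ψ (s, shift x)).2 = shift (Ψ (s, x)).2 := by
    intro s y hy
    obtain ⟨x, -, rfl⟩ := hmem s y hy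
    rw [← orbitCode_shift, hΨΦ, hΨΦ]
  have hbij : ∀ s, BijOn (fun x => (Ψ (s, x)).2) {x | (s, x) ∈ C}
      (shiftCore {x | (s, x) ∈ B}) := by
    refine fun s => ⟨fun y hy => ?_, fun y hy y' hy' h => ?_, fun x hx => ?_⟩
    · obtain ⟨x, hx, rfl⟩ := hmem s y hy
      simp only [hΨΦ]
      exact hx
    · exact congrArg Prod.snd (hinj hy hy' (Prod.ext rfl h))
    · exact ⟨orbitCode w s x, ⟨(s, x), hx, rfl⟩, by simp only [hΨΦ]⟩
  refine ⟨C, Ψ, hclosed, hcont, hinj, fun p hp => (hbij p.1).mapsTo hp 0, fun _ _ => rfl,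
    hCS, hΨS, fun s x y hx hy h => ?_, fun s h2 => ?_, fun s hs => ?_⟩
  · rw [← hΨS s x hx] at h
    exact congrArg Prod.snd (hinj hy (hCS s x hx) (Prod.ext rfl h))
  · have hs : Continuous fun x : IncSeq => (s, x) := by fun_prop
    exact borelChrom_eq_of_lift (hs.measurable hB) (hclosed.preimage hs)
      (continuous_snd.comp_continuousOn (hcont.comp hs.continuousOn fun x hx => hx)) (hbij s)
      (hCS s) (hΨS s) h2
  · have hcore : shiftCore {x | (s, x) ∈ B} = {x | (s, x) ∈ B} := by
      refine Subset.antisymm (fun x hx => hx 0) fun x hx n => ?_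
      induction n generalizing x with
      | zero => exact hx
      | succ n ih => exact ih _ (hs x hx)
    exact hcore ▸ hbij s
end

section
/- Let H be the graph on ℕ^ℕ × [ℕ]^ℕ where (s,x) and (s',x') are adjacent if and only if s = s' and x, x' are adjacent in the shift graph G_S. There exists a continuous injection e: ℕ^ℕ × [ℕ]^ℕ → [ℕ]^ℕ which is a graph isomorphism between H and the restriction of G_S to the range of e. -/
open MeasureTheory Set

/-- The edge relation of the graph `ℋ` on `ℕ^ℕ × [ℕ]^ℕ`: `(s,x)` and `(s',x')` are
adjacent iff `s = s'` and `x, x'` are adjacent in the shift graph. -/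
def HEdge (p q : NN × IncSeq) : Prop := p.1 = q.1 ∧ shiftEdge p.2 q.2

/-- An injective code for the finite sequence `(s 0, …, s (k - 1))`, strictly increasing
in its length `k`. -/
def segmentCode (s : NN) : ℕ → ℕ
  | 0 => 0
  | k + 1 => Nat.pair (segmentCode s k) (s k) + 1

theorem segmentCode_strictMono (s : NN) : StrictMono (segmentCode s) :=
  strictMono_nat_of_lt_succ fun _ => Nat.lt_succ_of_le (Nat.left_le_pair _ _)

theorem segmentCode_inj {s t : NN} {k l : ℕ} (h : segmentCode s k = segmentCode t l) :
    k = l ∧ ∀ i < k, s i = t i := by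
  induction k generalizing l with
  | zero =>
    cases l with
    | zero => simp
    | succ l => simp [segmentCode] at h
  | succ k ih =>
    cases l with
    | zero => simp [segmentCode] at h
    | succ l =>
      simp only [segmentCode, Nat.add_right_cancel_iff, Nat.pair_eq_pair] at h
      obtain ⟨rfl, hst⟩ := ih h.1
      refine ⟨rfl, fun i hi => ?_⟩
      rcases Nat.lt_succ_iff_lt_or_eq.1 hi with hi | rfl
      · exact hst i hi
      · exact h.2

theorem continuous_segmentCode (k : ℕ) : Continuous fun s : NN => segmentCode s k := by
  induction k with
  | zero => exact continuous_const
  | succ k ih =>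
    exact (continuous_of_discreteTopology (f := fun a : ℕ × ℕ => Nat.pair a.1 a.2 + 1)).comp
      (ih.prodMk (continuous_apply k))

/-- The increasing sequence of codes of the initial segments of `s` whose lengths lie in `x`. -/
def segmentCodes (p : NN × IncSeq) : IncSeq :=
  ⟨fun n => segmentCode p.1 (p.2.1 n), (segmentCode_strictMono p.1).comp p.2.2⟩

theorem shift_segmentCodes (p : NN × IncSeq) :
    shift (segmentCodes p) = segmentCodes (p.1, shift p.2) := rfl

theorem continuous_segmentCodes : Continuous segmentCodes := by
  refine Continuous.subtype_mk (continuous_pi fun n => ?_) _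
  have h : Continuous fun q : NN × ℕ => segmentCode q.1 q.2 :=
    continuous_prod_of_discrete_right.2 continuous_segmentCode
  exact h.comp (continuous_fst.prodMk
    ((continuous_apply n).comp (continuous_subtype_val.comp continuous_snd)))

theorem segmentCodes_injective : Function.Injective segmentCodes := by
  intro p q h
  have hc (n : ℕ) := segmentCode_inj (congrFun (congrArg Subtype.val h) n)
  refine Prod.ext (funext fun i => ?_) (Subtype.ext (funext fun n => (hc n).1))
  exact (hc (i + 1)).2 i (p.2.2.le_apply (x := i + 1))

theorem shift_segmentCodes_eq_iff (p q : NN × IncSeq) :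
    shift (segmentCodes p) = segmentCodes q ↔ p.1 = q.1 ∧ shift p.2 = q.2 := by
  rw [shift_segmentCodes, segmentCodes_injective.eq_iff, Prod.ext_iff]

/-- There is a continuous injection `e : ℕ^ℕ × [ℕ]^ℕ → [ℕ]^ℕ` which is a graph
isomorphism between `ℋ` and the restriction of the shift graph `G_S` to the range
of `e` (it maps edges to edges and non-edges to non-edges). -/
theorem H_embeds_into_shift_graph :
    ∃ e : NN × IncSeq → IncSeq, Continuous e ∧ Function.Injective e ∧
      ∀ p q : NN × IncSeq, HEdge p q ↔ shiftEdge (e p) (e q) := by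
  refine ⟨segmentCodes, continuous_segmentCodes, segmentCodes_injective, fun p q => ?_⟩
  simp only [HEdge, shiftEdge, ne_eq, segmentCodes_injective.eq_iff,
    shift_segmentCodes_eq_iff, Prod.ext_iff]
  grind
end

section
/- For every x ∈ [ℕ]^ℕ, the set {y ∈ [ℕ]^ℕ : y ≤^∞ x} can be partitioned into three Borel sets each of which is independent in the shift graph G_S; consequently, every Borel set B ⊆ [ℕ]^ℕ that is contained in {y : y ≤^∞ x} for some x (in particular, every non-dominating Borel set) satisfies χ_B(G_S|_B) ≤ 3. -/
open MeasureTheory Set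

/-- `y ≤^∞ x` : `y(n) ≤ x(n)` for infinitely many `n`. -/
def leInfOften (y x : IncSeq) : Prop := ∀ N : ℕ, ∃ n : ℕ, N ≤ n ∧ y.1 n ≤ x.1 n

/-- `S ⊆ [ℕ]^ℕ` is dominating: every `y` is eventually dominated by some member of `S`. -/
def Dominating (S : Set IncSeq) : Prop :=
  ∀ y : IncSeq, ∃ x ∈ S, ∃ N : ℕ, ∀ n : ℕ, N ≤ n → y.1 n ≤ x.1 n

/-- Position `n` holds the next to last element of `y` in its `b`-block. -/
def IsBlockEnd (b : ℕ → ℕ) (y : IncSeq) (n : ℕ) : Prop :=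
  b (y.1 n) = b (y.1 (n + 1)) ∧ b (y.1 (n + 1)) ≠ b (y.1 (n + 2))

lemma measurable_eval (n : ℕ) : Measurable fun y : IncSeq => y.1 n :=
  (measurable_pi_apply n).comp measurable_subtype_coe

lemma measurableSet_isBlockEnd (b : ℕ → ℕ) (n : ℕ) :
    MeasurableSet {y : IncSeq | IsBlockEnd b y n} := by
  have hb : ∀ k, Measurable fun y : IncSeq => b (y.1 k) := fun k =>
    (measurable_from_top (f := b)).comp (measurable_eval k)
  exact (measurableSet_eq_fun (hb n) (hb (n + 1))).inter
    (measurableSet_eq_fun (hb (n + 1)) (hb (n + 2))).compl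

lemma measurableSet_leInfOften (x : IncSeq) : MeasurableSet {y : IncSeq | leInfOften y x} := by
  simp only [leInfOften, ← exists_prop, ofPred_forall, ofPred_exists]
  exact .iInter fun N => .iUnion fun n => .iUnion fun _ =>
    measurableSet_le (measurable_eval n) measurable_const

/-- A lower adjoint of `j ↦ x (j + 1)`. -/
lemma exists_lower_adjoint (x : IncSeq) :
    ∃ b : ℕ → ℕ, GaloisConnection b fun j => x.1 (j + 1) := by
  classical
  have hex : ∀ m, ∃ j, m ≤ x.1 (j + 1) := fun m =>
    ⟨m, (Nat.le_succ m).trans (x.2.le_apply)⟩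
  refine ⟨fun m => Nat.find (hex m), fun m j => ⟨fun h => ?_, fun h => Nat.find_min' _ h⟩⟩
  exact (Nat.find_spec (hex m)).trans (x.2.monotone (Nat.add_le_add_right h 1))

lemma exists_isBlockEnd {x y : IncSeq} {b : ℕ → ℕ}
    (hb : GaloisConnection b fun j => x.1 (j + 1)) (hy : leInfOften y x) :
    ∃ n, IsBlockEnd b y n := by
  classical
  obtain ⟨n, hn⟩ : ∃ n, b (y.1 n) = b (y.1 (n + 1)) := by
    by_contra! hne
    have hmono : StrictMono fun n => b (y.1 n) := strictMono_nat_of_lt_succ fun n =>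
      lt_of_le_of_ne (hb.monotone_l (y.2 (Nat.lt_succ_self n)).le) (hne n)
    obtain ⟨n, hn1, hn⟩ := hy 1
    obtain ⟨k, rfl⟩ : ∃ k, n = k + 1 := ⟨n - 1, by omega⟩
    have h1 : b (y.1 (k + 1)) ≤ k := hb.l_le hn
    have h2 : k + 1 ≤ b (y.1 (k + 1)) := hmono.le_apply
    omega
  have hex : ∃ k, b (y.1 (n + 1 + k)) ≠ b (y.1 n) := by
    by_contra! h
    have h1 : ∀ k, n + 1 + k ≤ x.1 (b (y.1 n) + 1) := fun k =>
      y.2.le_apply.trans (hb.le_u (h k).le)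
    have h2 := h1 (x.1 (b (y.1 n) + 1))
    omega
  have hmin : ∀ j < Nat.find hex, b (y.1 (n + 1 + j)) = b (y.1 n) := fun j hj =>
    not_not.mp (Nat.find_min hex hj)
  have hspec := Nat.find_spec hex
  generalize Nat.find hex = k at hmin hspec
  match k with
  | 0 => exact absurd hn.symm hspec
  | 1 => exact ⟨n, hn, by rw [← hn]; exact hspec.symm⟩
  | k + 2 =>
    refine ⟨n + 1 + k, (hmin k (by omega)).trans (hmin (k + 1) (by omega)).symm, ?_⟩
    rw [add_assoc _ k 1, hmin (k + 1) (by omega)]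
    exact hspec.symm

/-- The distance to the first block end; its parity, with `0` treated apart, gives the coloring. -/
lemma exists_measurable_coloring (x : IncSeq) : ∃ c : IncSeq → Fin 3, Measurable c ∧
    ∀ y, leInfOften y x → leInfOften (shift y) x → c y ≠ c (shift y) := by
  classical
  obtain ⟨b, hb⟩ := exists_lower_adjoint x
  have hex : ∀ y : IncSeq, ∃ n, IsBlockEnd b y n ∨ ∀ k, ¬ IsBlockEnd b y k := fun y => by
    by_cases h : ∃ n, IsBlockEnd b y n
    · exact h.imp fun _ => Or.inl
    · exact ⟨0, Or.inr (not_exists.mp h)⟩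
  obtain ⟨N, hmeas, hfind⟩ : ∃ N : IncSeq → ℕ, Measurable N ∧ ∀ y, leInfOften y x →
      IsBlockEnd b y (N y) ∧ ∀ j < N y, ¬ IsBlockEnd b y j := by
    refine ⟨fun y => Nat.find (hex y), measurable_find hex fun k => ?_, fun y hy => ?_⟩
    · refine (measurableSet_isBlockEnd b k).union
        (s₂ := {y | ∀ k, ¬ IsBlockEnd b y k}) ?_
      simp only [ofPred_forall]
      exact .iInter fun k => (measurableSet_isBlockEnd b k).compl
    · obtain ⟨n, hn⟩ := exists_isBlockEnd hb hy
      exact ⟨(Nat.find_spec (hex y)).resolve_right fun h => h n hn,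
        fun j hj h => Nat.find_min (hex y) hj (Or.inl h)⟩
  refine ⟨_, (measurable_from_top (f := fun k : ℕ =>
    if k = 0 then (2 : Fin 3) else if k % 2 = 0 then 0 else 1)).comp hmeas, fun y hy hsy => ?_⟩
  obtain ⟨h1, h2⟩ := hfind y hy
  obtain ⟨h3, h4⟩ := hfind (shift y) hsy
  simp only [Function.comp]
  generalize N y = m at h1 h2
  generalize N (shift y) = k at h3 h4
  have h0 : m = 0 → k ≠ 0 := by
    rintro rfl rfl
    exact h1.2 h3.1
  have hs : m ≠ 0 → m = k + 1 := by
    intro hm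
    obtain ⟨j, rfl⟩ := Nat.exists_eq_succ_of_ne_zero hm
    have hjk : ¬ j < k := fun h => h4 j h h1
    have hkj : ¬ k + 1 < j + 1 := fun h => h2 (k + 1) h h3
    omega
  split_ifs <;> first | decide | omega

lemma exists_measurable_edge_coloring (x : IncSeq) : ∃ c : IncSeq → Fin 3, Measurable c ∧
    ∀ y z, leInfOften y x → leInfOften z x → shiftEdge y z → c y ≠ c z := by
  obtain ⟨c, hc, h⟩ := exists_measurable_coloring x
  refine ⟨c, hc, ?_⟩
  rintro y z hy hz ⟨-, rfl | rfl⟩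
  · exact h y hy hz
  · exact (h z hz hy).symm

lemma borelColoringLE_of_subset {B : Set IncSeq} {x : IncSeq}
    (hB : B ⊆ {y | leInfOften y x}) : BorelColoringLE B 3 := by
  obtain ⟨c, hc, h⟩ := exists_measurable_edge_coloring x
  exact ⟨fun y => c y, hc.comp measurable_subtype_coe,
    fun y z => h y z (hB y.2) (hB z.2)⟩

/-- For every `x ∈ [ℕ]^ℕ`, the set `{y : y ≤^∞ x}` can be partitioned into three Borel
sets, each independent in the shift graph `G_S`; consequently every Borel set contained
in some `{y : y ≤^∞ x}`, and in particular every non-dominating Borel set, has Borel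
chromatic number at most `3`. -/
theorem nondominating_three_coloring :
    (∀ x : IncSeq, ∃ A : Fin 3 → Set IncSeq,
      (∀ i, MeasurableSet (A i)) ∧
      (⋃ i, A i) = {y : IncSeq | leInfOften y x} ∧
      (Pairwise fun i j => Disjoint (A i) (A j)) ∧
      (∀ i, ∀ y ∈ A i, ∀ z ∈ A i, ¬ shiftEdge y z)) ∧
    (∀ (B : Set IncSeq), MeasurableSet B →
      (∃ x : IncSeq, B ⊆ {y : IncSeq | leInfOften y x}) → BorelColoringLE B 3) ∧
    (∀ (B : Set IncSeq), MeasurableSet B → ¬ Dominating B → BorelColoringLE B 3) := by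
  refine ⟨fun x => ?_, fun B _ ⟨x, hx⟩ => borelColoringLE_of_subset hx, fun B _ hB => ?_⟩
  · obtain ⟨c, hc, h⟩ := exists_measurable_edge_coloring x
    refine ⟨fun i => {y | leInfOften y x} ∩ c ⁻¹' {i}, fun i => ?_, ?_, fun i j hij => ?_, ?_⟩
    · exact (measurableSet_leInfOften x).inter (hc (measurableSet_singleton i))
    · ext y
      simp
    · exact Set.disjoint_left.mpr fun y hi hj => hij (hi.2.symm.trans hj.2)
    · exact fun i y hy z hz hyz => h y z hy.1 hz.1 hyz (hy.2.trans hz.2.symm)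
  · unfold Dominating at hB
    push Not at hB
    obtain ⟨x, hx⟩ := hB
    exact borelColoringLE_of_subset (x := x) fun y hy N =>
      (hx y hy N).imp fun n hn => ⟨hn.1, hn.2.le⟩
end

section
/- There exists a Borel function f_dom: [ℕ]^ℕ → ℕ^ℕ such that for each x ∈ [ℕ]^ℕ, f_dom(x) = ⟨c₀,c₁,c₂⟩ where each c_i is a Borel code of a Borel subset A_{c_i} of [ℕ]^ℕ, each A_{c_i} is independent in the shift graph G_S, and {y ∈ [ℕ]^ℕ : y ≤^∞ x} = A_{c₀} ∪ A_{c₁} ∪ A_{c₂}. -/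
open MeasureTheory Set

/-- The number of `k` with `x (2 * k) < m`. -/
def evenCount (x : NN) (m : ℕ) : ℕ := ∑ k ∈ Finset.range m, if x (2 * k) < m then 1 else 0

lemma evenCount_eq_card (x : NN) (m : ℕ) :
    evenCount x m = ((Finset.range m).filter fun k => x (2 * k) < m).card := by
  simp [evenCount]

lemma evenCount_mono (x : NN) : Monotone (evenCount x) := by
  intro a b hab
  rw [evenCount_eq_card, evenCount_eq_card]
  refine Finset.card_le_card fun k hk => ?_
  simp only [Finset.mem_filter, Finset.mem_range] at hk ⊢
  omega

lemma evenCount_apply_le {x : NN} (hx : StrictMono x) (n : ℕ) :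
    evenCount x (x n) ≤ (n + 1) / 2 := by
  rw [evenCount_eq_card]
  calc _ ≤ (Finset.range ((n + 1) / 2)).card := by
        refine Finset.card_le_card fun k hk => ?_
        simp only [Finset.mem_filter, Finset.mem_range, hx.lt_iff_lt] at hk ⊢
        omega
    _ = _ := Finset.card_range _

lemma le_evenCount {x : NN} (hx : StrictMono x) (K : ℕ) :
    K ≤ evenCount x (x (2 * K)) := by
  rw [evenCount_eq_card]
  calc K = (Finset.range K).card := (Finset.card_range _).symm
    _ ≤ _ := by
        refine Finset.card_le_card fun k hk => ?_
        have := hx.id_le (2 * K)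
        simp only [Finset.mem_filter, Finset.mem_range, hx.lt_iff_lt, id] at hk this ⊢
        omega

/-- The `n`-th shift of `y` starts with an element followed by a jump of `evenCount x`, which in
turn is followed by no jump. -/
def JumpThenFlat (x y : IncSeq) (n : ℕ) : Prop :=
  evenCount x.1 (y.1 n) ≠ evenCount x.1 (y.1 (n + 1)) ∧
    evenCount x.1 (y.1 (n + 1)) = evenCount x.1 (y.1 (n + 2))

lemma exists_jumpThenFlat {x y : IncSeq} (h : leInfOften y x) : ∃ n, JumpThenFlat x y n := by
  by_contra! hW
  have hmono : Monotone fun n => evenCount x.1 (y.1 n) :=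
    (evenCount_mono x.1).comp y.2.monotone
  obtain ⟨N, hN⟩ : ∃ N, evenCount x.1 (y.1 N) ≠ evenCount x.1 (y.1 (N + 1)) := by
    by_contra! hflat
    have hconst : ∀ n, evenCount x.1 (y.1 n) = evenCount x.1 (y.1 0) := by
      intro n
      induction n with
      | zero => rfl
      | succ n ih => rw [← hflat n, ih]
    have h1 := le_evenCount x.2 (evenCount x.1 (y.1 0) + 1)
    have h2 := evenCount_mono x.1 (y.2.id_le (x.1 (2 * (evenCount x.1 (y.1 0) + 1))))
    simp only [hconst, id] at h1 h2
    omega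
  have hjump : ∀ j, evenCount x.1 (y.1 (N + j)) ≠ evenCount x.1 (y.1 (N + j + 1)) := by
    intro j
    induction j with
    | zero => exact hN
    | succ j ih => exact fun he => hW (N + j) ⟨ih, he⟩
  have hgrow : ∀ j, j ≤ evenCount x.1 (y.1 (N + j)) := by
    intro j
    induction j with
    | zero => exact Nat.zero_le _
    | succ j ih =>
      have h1 := hjump j
      have h2 : evenCount x.1 (y.1 (N + j)) ≤ evenCount x.1 (y.1 (N + j + 1)) :=
        hmono (Nat.le_succ _)
      rw [← add_assoc]
      omega
  obtain ⟨n, hn, hyx⟩ := h (2 * N + 2)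
  have h1 := hgrow (n - N)
  rw [Nat.add_sub_cancel' (by omega)] at h1
  have h2 := evenCount_mono x.1 hyx
  have h3 := evenCount_apply_le x.2 n
  omega

/-- `n` is the first index at which `JumpThenFlat` holds. -/
def FirstHit (x y : IncSeq) (n : ℕ) : Prop :=
  JumpThenFlat x y n ∧ ∀ m < n, ¬ JumpThenFlat x y m

lemma FirstHit.eq {x y : IncSeq} {m n : ℕ} (hm : FirstHit x y m) (hn : FirstHit x y n) :
    m = n := by
  rcases lt_trichotomy m n with h | h | h
  · exact absurd hm.1 (hn.2 m h)
  · exact h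
  · exact absurd hn.1 (hm.2 n h)

lemma FirstHit.shift {x y : IncSeq} {n : ℕ} (h : FirstHit x y (n + 1)) :
    FirstHit x (shift y) n :=
  ⟨h.1, fun m hm => h.2 (m + 1) (by omega)⟩

/-- The color given to a sequence whose first hit is at `n`. -/
def hitColor (n : ℕ) : ℕ := if n = 0 then 2 else n % 2

/-- The pairs `(x, y)` such that `y ≤^∞ x` and `y` gets color `i`. -/
def colorClass (i : ℕ) : Set (IncSeq × IncSeq) :=
  {p | leInfOften p.2 p.1 ∧ ∃ n, hitColor n = i ∧ FirstHit p.1 p.2 n}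

lemma not_mem_colorClass_shift {i : ℕ} {x y : IncSeq} (hy : (x, y) ∈ colorClass i) :
    (x, shift y) ∉ colorClass i := by
  rintro ⟨-, m, hm, hmhit⟩
  obtain ⟨-, n, hn, hnhit⟩ := hy
  rw [← hn] at hm
  cases n with
  | zero =>
    have hm0 : m ≠ 0 := by
      rintro rfl
      exact hmhit.1.1 hnhit.1.2
    simp only [hitColor, if_neg hm0, if_true] at hm
    omega
  | succ k =>
    obtain rfl : m = k := hmhit.eq hnhit.shift
    unfold hitColor at hm
    split_ifs at hm <;> omega

lemma not_shiftEdge_of_mem_colorClass {i : ℕ} {x y z : IncSeq} (hy : (x, y) ∈ colorClass i)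
    (hz : (x, z) ∈ colorClass i) : ¬ shiftEdge y z := by
  rintro ⟨-, rfl | rfl⟩
  · exact not_mem_colorClass_shift hy hz
  · exact not_mem_colorClass_shift hz hy

lemma leInfOften_iff_mem_colorClass (x y : IncSeq) :
    leInfOften y x ↔
      ((x, y) ∈ colorClass 0 ∨ (x, y) ∈ colorClass 1) ∨ (x, y) ∈ colorClass 2 := by
  classical
  refine ⟨fun h => ?_, by rintro ((h | h) | h) <;> exact h.1⟩
  have hex := exists_jumpThenFlat h
  have hfirst : FirstHit x y (Nat.find hex) :=
    ⟨Nat.find_spec hex, fun m hm => Nat.find_min hex hm⟩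
  have hcol : (hitColor (Nat.find hex) = 0 ∨ hitColor (Nat.find hex) = 1) ∨
      hitColor (Nat.find hex) = 2 := by
    unfold hitColor
    split_ifs <;> omega
  exact hcol.imp (Or.imp (fun hc => ⟨h, _, hc, hfirst⟩) fun hc => ⟨h, _, hc, hfirst⟩)
    fun hc => ⟨h, _, hc, hfirst⟩

lemma measurable_incSeq_apply (n : ℕ) : Measurable fun x : IncSeq => x.1 n :=
  (measurable_pi_apply n).comp measurable_subtype_coe

lemma measurable_evenCount_apply (n : ℕ) :
    Measurable fun p : IncSeq × IncSeq => evenCount p.1.1 (p.2.1 n) := by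
  have h : Measurable fun q : IncSeq × ℕ => evenCount q.1.1 q.2 := by
    refine measurable_from_prod_countable_left fun m => ?_
    change Measurable fun x : IncSeq =>
      ∑ k ∈ Finset.range m, if x.1 (2 * k) < m then 1 else 0
    exact Finset.measurable_fun_sum _ fun k _ => Measurable.ite
      (measurableSet_lt (measurable_incSeq_apply _) measurable_const)
      measurable_const measurable_const
  exact h.comp (measurable_fst.prodMk ((measurable_incSeq_apply n).comp measurable_snd))

lemma measurableSet_jumpThenFlat (n : ℕ) :
    MeasurableSet {p : IncSeq × IncSeq | JumpThenFlat p.1 p.2 n} :=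
  (measurableSet_eq_fun (measurable_evenCount_apply n)
    (measurable_evenCount_apply (n + 1))).compl.inter
    (measurableSet_eq_fun (measurable_evenCount_apply (n + 1))
      (measurable_evenCount_apply (n + 2)))

lemma measurableSet_colorClass (i : ℕ) : MeasurableSet (colorClass i) := by
  have hle : ∀ n, MeasurableSet {p : IncSeq × IncSeq | p.2.1 n ≤ p.1.1 n} := fun n =>
    measurableSet_le ((measurable_incSeq_apply n).comp measurable_snd)
      ((measurable_incSeq_apply n).comp measurable_fst)
  refine MeasurableSet.inter (?_ : MeasurableSet {p : IncSeq × IncSeq | leInfOften p.2 p.1})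
    (?_ : MeasurableSet {p : IncSeq × IncSeq | ∃ n, hitColor n = i ∧ FirstHit p.1 p.2 n})
  · simp only [leInfOften, ofPred_forall, ofPred_exists]
    exact MeasurableSet.iInter fun N => MeasurableSet.iUnion fun n =>
      (MeasurableSet.const _).inter (hle n)
  · have hmin : ∀ n, MeasurableSet {p : IncSeq × IncSeq | ∀ m < n, ¬ JumpThenFlat p.1 p.2 m} := by
      intro n
      simp only [ofPred_forall]
      exact MeasurableSet.iInter fun m => MeasurableSet.iInter fun _ =>
        (measurableSet_jumpThenFlat m).compl
    rw [ofPred_exists]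
    exact MeasurableSet.iUnion fun n => (MeasurableSet.const _).inter
      ((measurableSet_jumpThenFlat n).inter (hmin n))

lemma polishSpace_incSeq : PolishSpace IncSeq := by
  have hclosed : IsClosed {x : NN | StrictMono x} := by
    have : {x : NN | StrictMono x} = ⋂ n, {x : NN | x n + 1 ≤ x (n + 1)} := by
      ext x
      simp only [mem_ofPred_eq, mem_iInter]
      exact ⟨fun h n => h n.lt_succ_self, fun h => strictMono_nat_of_lt_succ h⟩
    rw [this]
    exact isClosed_iInter fun n => isClosed_le (by fun_prop) (by fun_prop)
  exact hclosed.polishSpace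

/-- (Di Prisco–Todorčević, uniform version.)  Fix a coding of Borel subsets of `[ℕ]^ℕ`:
a `Π¹₁` set `BC ⊆ ℕ^ℕ` of codes, a `Σ¹₁` set `Acode` and a `Π¹₁` set `Ccode` agreeing on
codes (with `Acode_c` the Borel set coded by `c`), such that every Borel set in a product
`P × [ℕ]^ℕ` admits a Borel code-assigning map; and fix a homeomorphism
`trip : (ℕ^ℕ)³ ≃ₜ ℕ^ℕ`.  Then there is a Borel function `f_dom : [ℕ]^ℕ → ℕ^ℕ` such that
for every `x`, `f_dom x = ⟨c₀,c₁,c₂⟩` where each `c_i ∈ BC` codes a `G_S`-independent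
Borel set and `{y : y ≤^∞ x} = A_{c₀} ∪ A_{c₁} ∪ A_{c₂}`. -/
theorem exists_fdom
    (trip : (NN × NN × NN) ≃ₜ NN)
    (BC : Set NN) (Acode Ccode : Set (NN × IncSeq))
    (hBC : IsCoanalytic BC)
    (hAcode : AnalyticSet Acode)
    (hCcode : IsCoanalytic Ccode)
    (hagree : ∀ c ∈ BC, ∀ x : IncSeq, (c, x) ∈ Acode ↔ (c, x) ∈ Ccode)
    (huniv : ∀ (P : Type) [TopologicalSpace P] [PolishSpace P] [MeasurableSpace P]
      [BorelSpace P] (B : Set (P × IncSeq)), MeasurableSet B →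
      ∃ g : P → NN, Measurable g ∧ (∀ p : P, g p ∈ BC) ∧
        ∀ p : P, {x : IncSeq | (g p, x) ∈ Acode} = {x : IncSeq | (p, x) ∈ B}) :
    ∃ fdom : IncSeq → NN, Measurable fdom ∧
      ∀ x : IncSeq, ∃ c₀ c₁ c₂ : NN,
        fdom x = trip (c₀, c₁, c₂) ∧
        c₀ ∈ BC ∧ c₁ ∈ BC ∧ c₂ ∈ BC ∧
        (∀ c ∈ ({c₀, c₁, c₂} : Set NN), ∀ y z : IncSeq,
          (c, y) ∈ Acode → (c, z) ∈ Acode → ¬ shiftEdge y z) ∧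
        {y : IncSeq | leInfOften y x} =
          {y : IncSeq | (c₀, y) ∈ Acode} ∪ {y : IncSeq | (c₁, y) ∈ Acode} ∪
            {y : IncSeq | (c₂, y) ∈ Acode} := by
  have := polishSpace_incSeq
  choose g hgm hgBC hg using fun i : ℕ => huniv IncSeq (colorClass i) (measurableSet_colorClass i)
  have hmem : ∀ i x y, (g i x, y) ∈ Acode ↔ (x, y) ∈ colorClass i := fun i x y =>
    Set.ext_iff.1 (hg i x) y
  refine ⟨fun x => trip (g 0 x, g 1 x, g 2 x), trip.continuous.measurable.comp
    ((hgm 0).prodMk ((hgm 1).prodMk (hgm 2))), fun x => ⟨g 0 x, g 1 x, g 2 x, rfl,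
    hgBC 0 x, hgBC 1 x, hgBC 2 x, ?_, ?_⟩⟩
  · rintro c (rfl | rfl | rfl) y z hy hz <;>
      exact not_shiftEdge_of_mem_colorClass ((hmem _ _ _).1 hy) ((hmem _ _ _).1 hz)
  · ext y
    simp only [mem_union, mem_ofPred_eq, hmem]
    exact leInfOften_iff_mem_colorClass x y
end
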